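/- Let n ≥ 1, 0 < λ ≤ Λ, m ∈ (1,2] and s > m. Let F : ℝⁿ × Sⁿ → ℝ (Sⁿ the symmetric n×n real matrices) satisfy: (i) λ·Tr(Y) ≤ F(x,X+Y) − F(x,X) ≤ Λ·Tr(Y) for all x ∈ ℝⁿ, X ∈ Sⁿ and all positive semidefinite Y ∈ Sⁿ; (ii) F(x,0) = 0 for all x; (iii) x ↦ F(x,X) is continuous for every X ∈ Sⁿ; (iv) for every R > 0 there is a modulus of continuity ω_R such that F(x,X) − F(y,Y) ≤ ω_R(|x−y| + ε⁻¹|x−y|²) whenever ε > 0, |x|,|y| < R and X,Y ∈ Sⁿ satisfy the block inequalities −(3/ε)[[I,0],[0,I]] ≤ [[X,0],[0,−Y]] ≤ (3/ε)[[I,−I],[−I,I]] in the positive semidefinite order on 2n×2n symmetric matrices; (v) F(x,σX) = σF(x,X) for all σ ∈ (0,1), x ∈ ℝⁿ, X ∈ Sⁿ. Let H : ℝⁿ × ℝⁿ → ℝ satisfy H(x,0) = 0 for all x, and: (a) there exist constants γ₁, γ_m > 0 and a modulus of continuity ω such that |H(x,p+q) − H(y,p)| ≤ ω(|x−y|)(|p|^m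 + 1) + (γ₁ + γ_m(|p|^{m−1} + |q|^{m−1}))|q| for all x,y,p,q ∈ ℝⁿ; (b) there exist constants c̄, A > 0 and σ₀ ∈ (0,1) such that H(x,p) − σH(x,σ⁻¹p) ≤ (1−σ)(−c̄|p|^m + A) for all x,p ∈ ℝⁿ and σ ∈ (σ₀,1). Let f : ℝⁿ → ℝ be continuous and suppose there exists ρ ≥ 0 with limsup_{|x|→∞} f⁻(x)/|x|^ρ < ∞, where ρ < m(s−1)/((m−1)s) if 1 < m ≤ 2s/(s+1), and ρ < 2(s−m)/(s(m−1)) if 2s/(s+1) < m. Then the equation F(x,D²u) + H(x,Du) − |u|^{s−1}u = f(x) admits exactly one entire continuous viscosity solution u : ℝⁿ → ℝ. -/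

import Mathlib

noncomputable section
open Real

abbrev En (n : ℕ) := EuclideanSpace ℝ (Fin n)

/-- A modulus of continuity. -/
def IsModulus (ω : ℝ → ℝ) : Prop :=
  (∀ t, 0 ≤ t → 0 ≤ ω t) ∧ MonotoneOn ω (Set.Ici 0) ∧ ω 0 = 0 ∧
    ContinuousWithinAt ω (Set.Ici 0) 0

/-- The Hessian matrix of a function. -/
def hessianMatrix {n : ℕ} (φ : En n → ℝ) (x : En n) : Matrix (Fin n) (Fin n) ℝ :=
  fun i j =>
    iteratedFDeriv ℝ 2 φ x ![EuclideanSpace.single i 1, EuclideanSpace.single j 1]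

/-- Viscosity subsolution of `F(x,D²u) + H(x,Du) - |u|^{s-1}u = f(x)` in `ℝⁿ`. -/
def ViscositySubsolution {n : ℕ} (F : En n → Matrix (Fin n) (Fin n) ℝ → ℝ)
    (H : En n → En n → ℝ) (s : ℝ) (f : En n → ℝ) (u : En n → ℝ) : Prop :=
  ∀ φ : En n → ℝ, ContDiff ℝ 2 φ → ∀ x₀ : En n, IsLocalMax (u - φ) x₀ →
    F x₀ (hessianMatrix φ x₀) + H x₀ (gradient φ x₀)
      - |u x₀| ^ (s - 1) * u x₀ ≥ f x₀

def ViscositySupersolution {n : ℕ} (F : En n → Matrix (Fin n) (Fin n) ℝ → ℝ)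
    (H : En n → En n → ℝ) (s : ℝ) (f : En n → ℝ) (u : En n → ℝ) : Prop :=
  ∀ φ : En n → ℝ, ContDiff ℝ 2 φ → ∀ x₀ : En n, IsLocalMin (u - φ) x₀ →
    F x₀ (hessianMatrix φ x₀) + H x₀ (gradient φ x₀)
      - |u x₀| ^ (s - 1) * u x₀ ≤ f x₀

/-- The Pucci maximal operator. -/
def pucci (lam Lam : ℝ) {n : ℕ} (X : Matrix (Fin n) (Fin n) ℝ) : ℝ :=
  sSup ((fun A : Matrix (Fin n) (Fin n) ℝ => (A * X).trace) ''
    {A | A.IsSymm ∧ (A - lam • (1 : Matrix (Fin n) (Fin n) ℝ)).PosSemidef ∧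
      (Lam • (1 : Matrix (Fin n) (Fin n) ℝ) - A).PosSemidef})

section PB
open Set Filter Topology MeasureTheory
open scoped RealInnerProductSpace NNReal Pointwise

variable {V : Type*} [NormedAddCommGroup V] [InnerProductSpace ℝ V]

/-- A vector `d` with `⟪d,h⟫ ≤ c ‖h‖²` for all `h` vanishes. -/
lemma ja_zero_of_le (d : V) (c : ℝ) (h : ∀ x : V, ⟪d, x⟫ ≤ c * ‖x‖ ^ 2) : d = 0 := by
  by_contra hd
  have hd' : 0 < ‖d‖ := norm_pos_iff.mpr hd
  have hc : 0 < |c| + 1 := by positivity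
  have := h ((1 / (|c| + 1)) • d)
  rw [inner_smul_right, real_inner_self_eq_norm_sq, norm_smul, Real.norm_of_nonneg (by positivity)] at this
  have h2 : c ≤ |c| := le_abs_self c
  have h3 : (1 / (|c| + 1)) * ‖d‖ ^ 2 ≤ |c| * (1 / (|c| + 1) * ‖d‖) ^ 2 :=
    this.trans (by gcongr)
  have h4 : |c| * (1 / (|c| + 1) * ‖d‖) ^ 2 = (|c| / (|c| + 1)) * ((1 / (|c| + 1)) * ‖d‖ ^ 2) := by
    field_simp
  have h5 : |c| / (|c| + 1) < 1 := by rw [div_lt_one hc]; linarith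
  have h6 : 0 < (1 / (|c| + 1)) * ‖d‖ ^ 2 := by positivity
  nlinarith

/-- Closeness of generalized gradients. -/
lemma ja_close (w : V → ℝ) (C : ℝ) (hC : 0 < C) (q : V → V)
    (hq : ∀ z h, w z + ⟪q z, h⟫ - C / 2 * ‖h‖ ^ 2 ≤ w (z + h)) (x z : V)
    (hx : ∀ z', w z' ≤ w x + ⟪q x, z' - x⟫) : ‖q z - q x‖ ≤ C * ‖z - x‖ := by
  by_cases hzx : z = x
  · subst hzx; simp
  have hr : 0 < ‖z - x‖ := norm_pos_iff.mpr (sub_ne_zero.mpr hzx)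
  by_cases hd : q z - q x = 0
  · rw [hd]; simp; positivity
  have hdp : 0 < ‖q z - q x‖ := norm_pos_iff.mpr hd
  set r := ‖z - x‖
  set d := q z - q x
  set h : V := (r / ‖d‖) • d
  have hh : ‖h‖ = r := by
    simp only [h]; rw [norm_smul, Real.norm_of_nonneg (by positivity)]; field_simp
  have h1 := hq z h
  have h2 := hx (z + h)
  have h3 := hq x (z - x)
  rw [add_sub_cancel] at h3
  have h4 : ⟪d, h⟫ = r * ‖d‖ := by
    simp only [h]; rw [inner_smul_right, real_inner_self_eq_norm_sq]; field_simp
  have h5 : ⟪d, h⟫ = ⟪q z, h⟫ - ⟪q x, h⟫ := by simp only [d]; rw [inner_sub_left]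
  have h6 : ⟪q x, z + h - x⟫ = ⟪q x, z - x⟫ + ⟪q x, h⟫ := by
    rw [← inner_add_right]; congr 1; abel
  have h7 : ‖z - x‖ = r := rfl
  rw [hh] at h1
  rw [h7] at h3
  have h8 : r * ‖d‖ ≤ r * (C * r) := by nlinarith
  exact le_of_mul_le_mul_left h8 hr

/-- Partition argument. -/
lemma ja_partition (g : ℝ → ℝ) (a b : ℝ) (hb : 0 ≤ b)
    (hg : ∀ t t', 0 ≤ t → t ≤ t' → t' ≤ 1 → |g t' - g t| ≤ a * (t' - t) + b * (t' - t) ^ 2) :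
    |g 1 - g 0| ≤ a := by
  have key : ∀ N : ℕ, 0 < N → |g 1 - g 0| ≤ a + b / N := by
    intro N hN
    have hN' : (0 : ℝ) < N := by exact_mod_cast hN
    have ind : ∀ k : ℕ, k ≤ N → |g (k / N) - g 0| ≤ k * (a / N + b / N ^ 2) := by
      intro k
      induction k with
      | zero => intro _; simp
      | succ k ih =>
        intro hk
        have h1 := ih (by omega)
        have h2 := hg (k / N) ((k + 1 : ℕ) / N) (by positivity) (by gcongr; simp)
          (by rw [div_le_one hN']; exact_mod_cast hk)
        have h3 : ((k + 1 : ℕ) : ℝ) / N - k / N = 1 / N := by push_cast; ring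
        rw [h3] at h2
        have h4 := abs_sub_le (g ((k + 1 : ℕ) / N)) (g (k / N)) (g 0)
        have h5 : a * (1 / (N : ℝ)) + b * (1 / (N : ℝ)) ^ 2 = a / N + b / N ^ 2 := by ring
        rw [h5] at h2
        push_cast at *
        linarith
    have := ind N le_rfl
    rw [div_self hN'.ne'] at this
    refine this.trans (le_of_eq ?_)
    field_simp
  refine le_of_forall_pos_le_add fun e he => ?_
  obtain ⟨N, hN⟩ := exists_nat_gt (b / e)
  have hN0 : 0 < N := by
    have : (0 : ℝ) < N := lt_of_le_of_lt (by positivity) hN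
    exact_mod_cast this
  have hN' : (0 : ℝ) < N := by exact_mod_cast hN0
  refine (key N hN0).trans ?_
  have : b / N ≤ e := by
    rw [div_lt_iff₀ he] at hN
    rw [div_le_iff₀ hN']; linarith
  linarith

variable [FiniteDimensional ℝ V]

lemma ja_continuous (w : V → ℝ) (C : ℝ) (q : V → V)
    (hq : ∀ z h, w z + ⟪q z, h⟫ - C / 2 * ‖h‖ ^ 2 ≤ w (z + h)) : Continuous w := by
  have hconv : ConvexOn ℝ univ (fun z => w z + C / 2 * ‖z‖ ^ 2) := by
    refine ⟨convex_univ, fun x _ y _ a b ha hb hab => ?_⟩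
    set z := a • x + b • y
    have hx := hq z (x - z)
    have hy := hq z (y - z)
    rw [add_sub_cancel] at hx hy
    have e1 : ‖x‖ ^ 2 = ‖z‖ ^ 2 + 2 * ⟪z, x - z⟫ + ‖x - z‖ ^ 2 := by
      rw [← norm_add_sq_real]; congr 2; abel
    have e2 : ‖y‖ ^ 2 = ‖z‖ ^ 2 + 2 * ⟪z, y - z⟫ + ‖y - z‖ ^ 2 := by
      rw [← norm_add_sq_real]; congr 2; abel
    have e3 : a • (x - z) + b • (y - z) = 0 := by
      have : a • (x - z) + b • (y - z) = z - (a + b) • z := by simp only [z]; module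
      rw [this, hab]; simp
    have e4 : ∀ v : V, a * ⟪v, x - z⟫ + b * ⟪v, y - z⟫ = 0 := by
      intro v
      rw [← inner_smul_right, ← inner_smul_right, ← inner_add_right, e3, inner_zero_right]
    have e5 := e4 z
    have e6 := e4 (q z)
    have hbb : b = 1 - a := by linarith
    simp only [smul_eq_mul]
    rw [e1, e2]
    have t1 := mul_le_mul_of_nonneg_left hx ha
    have t2 := mul_le_mul_of_nonneg_left hy hb
    have e5' : C * (a * ⟪z, x - z⟫ + b * ⟪z, y - z⟫) = 0 := by rw [e5]; ring
    have e7 : (a + b) * (w z + C / 2 * ‖z‖ ^ 2) = w z + C / 2 * ‖z‖ ^ 2 := by rw [hab]; ring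
    nlinarith
  have hc := hconv.continuousOn isOpen_univ
  rw [continuousOn_univ] at hc
  have : w = fun z => (w z + C / 2 * ‖z‖ ^ 2) - C / 2 * ‖z‖ ^ 2 := by funext z; ring
  rw [this]
  fun_prop

theorem jensen_alexandrov (w : V → ℝ) (C κ r : ℝ) (hC : 0 < C) (hκ : 0 < κ) (hr : 0 < r)
    (hsub : ∀ z, ∃ q : V, ∀ h, w z + ⟪q, h⟫ - C / 2 * ‖h‖ ^ 2 ≤ w (z + h))
    (hmax : ∀ z, w z ≤ w 0 - κ * ‖z‖ ^ 2) :
    ∃ (z p : V) (T : V →L[ℝ] V), ‖z‖ ≤ r / κ ∧ ‖p‖ ≤ r ∧ (∀ z', w z' ≤ w z + ⟪p, z' - z⟫) ∧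
      ∀ η > 0, ∀ᶠ h in 𝓝 (0 : V),
        |w (z + h) - w z - ⟪p, h⟫ - 1 / 2 * ⟪T h, h⟫| ≤ η * ‖h‖ ^ 2 := by
  choose q hq using hsub
  have hcont : Continuous w := ja_continuous w C q hq
  set K : Set V := {z | ‖q z‖ ≤ r ∧ ∀ z', w z' ≤ w z + ⟪q z, z' - z⟫} with hK
  have hsurj : Metric.closedBall (0 : V) r ⊆ q '' K := by
    intro p hp
    rw [mem_closedBall_zero_iff] at hp
    have hcpt : IsCompact (Metric.closedBall (0 : V) (r / κ)) := isCompact_closedBall _ _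
    obtain ⟨x, hxB, hx⟩ := hcpt.exists_isMaxOn (f := fun z => w z - ⟪p, z⟫) ⟨0, by simp; positivity⟩
      (by fun_prop)
    have hglob : ∀ z', w z' - ⟪p, z'⟫ ≤ w x - ⟪p, x⟫ := by
      intro z'
      by_cases hz : z' ∈ Metric.closedBall (0 : V) (r / κ)
      · exact hx hz
      · rw [mem_closedBall_zero_iff, not_le, div_lt_iff₀ hκ] at hz
        have h0 : w 0 - ⟪p, (0 : V)⟫ ≤ w x - ⟪p, x⟫ := hx (by simp; positivity)
        rw [inner_zero_right] at h0
        have h1 := hmax z'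
        have h2 : -(‖p‖ * ‖z'‖) ≤ ⟪p, z'⟫ := neg_le_of_abs_le (abs_real_inner_le_norm p z')
        have h3 : ‖p‖ * ‖z'‖ ≤ (‖z'‖ * κ) * ‖z'‖ := by gcongr; linarith
        nlinarith
    have hpq : q x - p = 0 := by
      apply ja_zero_of_le _ (C / 2)
      intro h
      have h1 := hq x h
      have h2 := hglob (x + h)
      rw [inner_add_right] at h2
      rw [inner_sub_left]; linarith
    have hpq' : q x = p := sub_eq_zero.mp hpq
    refine ⟨x, ⟨by rw [hpq']; exact hp, fun z' => ?_⟩, hpq'⟩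
    have := hglob z'
    rw [hpq', inner_sub_right]; linarith
  have hclose : ∀ x ∈ K, ∀ z, ‖q z - q x‖ ≤ C * ‖z - x‖ :=
    fun x hx z => ja_close w C hC q hq x z hx.2
  have hLip : LipschitzOnWith (Real.toNNReal C) q K := by
    refine LipschitzOnWith.of_dist_le_mul fun x _ y hy => ?_
    rw [dist_eq_norm, dist_eq_norm, Real.coe_toNNReal _ hC.le]
    exact hclose y hy x
  let _ : MeasurableSpace V := borel V
  have : BorelSpace V := ⟨rfl⟩
  set μ : Measure V := Measure.hausdorffMeasure (Module.finrank ℝ V : ℝ) with hμ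
  have : μ.IsAddHaarMeasure := MeasureTheory.isAddHaarMeasure_hausdorffMeasure
  have hKpos : μ K ≠ 0 := by
    intro h0
    have h1 := hLip.hausdorffMeasure_image_le (d := (Module.finrank ℝ V : ℝ)) (by positivity)
    rw [← hμ, h0, mul_zero] at h1
    have h2 : μ (Metric.closedBall (0 : V) r) ≤ 0 := (measure_mono hsurj).trans h1
    exact (Metric.measure_closedBall_pos μ 0 hr).ne' (le_antisymm h2 bot_le)
  have hdens := Besicovitch.ae_tendsto_measure_inter_div μ K
  have hdiff : ∀ᵐ x ∂μ.restrict K, DifferentiableWithinAt ℝ q K x := by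
    obtain ⟨g, hgl, hge⟩ : ∃ g : V → V, (∃ K' : ℝ≥0, LipschitzWith K' g) ∧ EqOn q g K := by
      obtain ⟨g, h1, h2⟩ := hLip.extend_finite_dimension
      exact ⟨g, ⟨_, h1⟩, h2⟩
    obtain ⟨K', hgl⟩ := hgl
    have := hgl.ae_differentiableAt (μ := μ)
    have h3 : ∀ᵐ x ∂μ.restrict K, DifferentiableAt ℝ g x := ae_restrict_of_ae this
    have hKm : MeasurableSet K := by
      have : IsClosed K := by
        have hqc : IsClosed K := by
          refine isClosed_of_closure_subset fun x hx => ?_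
          have hqx : ∀ z', w z' ≤ w x + ⟪q x, z' - x⟫ ∧ ‖q x‖ ≤ r := by
            obtain ⟨y, hyK, hyx⟩ := mem_closure_iff_seq_limit.mp hx
            have hqy : Tendsto (fun n => q (y n)) atTop (𝓝 (q x)) := by
              rw [tendsto_iff_norm_sub_tendsto_zero]
              have hb : ∀ n, ‖q (y n) - q x‖ ≤ C * ‖x - y n‖ := fun n => by
                rw [norm_sub_rev]; exact hclose _ (hyK n) x
              refine squeeze_zero (fun n => norm_nonneg _) hb ?_
              have : Tendsto (fun n => C * ‖x - y n‖) atTop (𝓝 (C * ‖x - x‖)) :=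
                ((tendsto_const_nhds.sub hyx).norm).const_mul C
              simpa using this
            intro z'
            constructor
            · have hl : Tendsto (fun n => w (y n) + ⟪q (y n), z' - y n⟫) atTop
                  (𝓝 (w x + ⟪q x, z' - x⟫)) :=
                ((hcont.tendsto x).comp hyx).add (hqy.inner (tendsto_const_nhds.sub hyx))
              exact ge_of_tendsto' hl fun n => (hyK n).2 z'
            · exact le_of_tendsto' hqy.norm fun n => (hyK n).1
          exact ⟨(hqx 0).2, fun z' => (hqx z').1⟩
        exact hqc
      exact this.measurableSet
    filter_upwards [h3, ae_restrict_mem hKm] with x hx hxK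
    exact hx.differentiableWithinAt.congr hge (hge hxK)
  have hne : (ae (μ.restrict K)).NeBot := by
    rw [ae_neBot]
    intro h
    rw [Measure.restrict_eq_zero] at h
    exact hKpos h
  have hmem : ∃ x, x ∈ K ∧ DifferentiableWithinAt ℝ q K x ∧
      Tendsto (fun r => μ (K ∩ Metric.closedBall x r) / μ (Metric.closedBall x r)) (𝓝[>] 0) (𝓝 1) := by
    by_contra hcon
    push Not at hcon
    have : K ⊆ {x | ¬ (DifferentiableWithinAt ℝ q K x ∧ Tendsto (fun r => μ (K ∩ Metric.closedBall x r) / μ (Metric.closedBall x r)) (𝓝[>] 0) (𝓝 1))} := by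
      intro x hx h
      exact hcon x hx h.1 h.2
    have h0 := hdiff.and hdens
    rw [ae_iff] at h0
    have h1 : μ.restrict K K ≤ 0 := (measure_mono this).trans h0.le
    rw [Measure.restrict_apply_self] at h1
    exact hKpos (le_antisymm h1 bot_le)
  obtain ⟨z, hzK, hzd, hzdens⟩ := hmem
  obtain ⟨T, hT⟩ := hzd
  refine ⟨z, q z, T, ?_, hzK.1, hzK.2, ?_⟩
  · have h0 := hzK.2 0
    have h1 := hmax z
    rw [zero_sub, inner_neg_right] at h0
    have h2 := neg_le_of_abs_le (abs_real_inner_le_norm (q z) z)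
    have h2' : ‖q z‖ * ‖z‖ ≤ r * ‖z‖ := mul_le_mul_of_nonneg_right hzK.1 (norm_nonneg z)
    have h3 : κ * ‖z‖ ^ 2 ≤ r * ‖z‖ := by linarith
    rw [le_div_iff₀ hκ]
    by_cases hz0 : ‖z‖ = 0
    · rw [hz0]; linarith
    · have : 0 < ‖z‖ := lt_of_le_of_ne (norm_nonneg z) (Ne.symm hz0)
      nlinarith
  -- first-order expansion of `q` at `z`
  have hfirst : ∀ η > 0, ∀ᶠ h in 𝓝 (0 : V), ‖q (z + h) - q z - T h‖ ≤ η * ‖h‖ := by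
    intro η hη
    -- parameter
    obtain ⟨θ, hθ, hθ1, hθ2⟩ : ∃ θ > 0, θ ≤ 1 ∧ (C + ‖T‖) * (2 * θ) ≤ η / 2 := by
      refine ⟨min 1 (η / (4 * (C + ‖T‖))), by positivity, min_le_left _ _, ?_⟩
      have : min 1 (η / (4 * (C + ‖T‖))) ≤ η / (4 * (C + ‖T‖)) := min_le_right _ _
      have hp : 0 < C + ‖T‖ := by positivity
      calc (C + ‖T‖) * (2 * min 1 (η / (4 * (C + ‖T‖)))) ≤ (C + ‖T‖) * (2 * (η / (4 * (C + ‖T‖)))) := by gcongr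
        _ = η / 2 := by field_simp; norm_num
    have hsph : IsCompact (Metric.sphere (0 : V) 1) := isCompact_sphere _ _
    obtain ⟨t, -, htfin, hcov⟩ := hsph.finite_cover_balls hθ
    have hev : ∀ᶠ ρ in 𝓝[>] (0 : ℝ), ∀ v ∈ t, (K ∩ ({z} + ρ • Metric.closedBall v θ)).Nonempty := by
      rw [htfin.eventually_all]
      intro v _
      exact Measure.eventually_nonempty_inter_smul_of_density_one μ K z hzdens _
        Metric.isClosed_closedBall.measurableSet (Metric.measure_closedBall_pos μ v hθ).ne'
    rw [eventually_nhdsWithin_iff, Metric.eventually_nhds_iff] at hev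
    obtain ⟨ρ₀, hρ₀, hev⟩ := hev
    have hTo := hT.isLittleO.def (show 0 < η / 6 by positivity)
    rw [eventually_nhdsWithin_iff, Metric.eventually_nhds_iff] at hTo
    obtain ⟨ρ₁, hρ₁, hTo⟩ := hTo
    rw [Metric.eventually_nhds_iff]
    refine ⟨min ρ₀ (ρ₁ / 3), by positivity, fun h hh => ?_⟩
    rw [dist_zero_right, lt_min_iff] at hh
    by_cases hh0 : h = 0
    · subst hh0; simp
    have hhp : 0 < ‖h‖ := norm_pos_iff.mpr hh0
    have hu : (‖h‖⁻¹ • h) ∈ Metric.sphere (0 : V) 1 := by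
      rw [mem_sphere_zero_iff_norm, norm_smul, norm_inv, norm_norm, inv_mul_cancel₀ hhp.ne']
    obtain ⟨v, hvt, hv⟩ := mem_iUnion₂.mp (hcov hu)
    obtain ⟨x, hxK, hx⟩ := hev (y := ‖h‖) (by rw [dist_zero_right, norm_norm]; exact hh.1) hhp v hvt
    obtain ⟨a, ha, b, hb, hab⟩ := Set.mem_add.mp hx
    obtain ⟨c, hc, hcb⟩ := Set.mem_smul_set.mp hb
    rw [mem_singleton_iff] at ha
    subst ha
    have hxh : ‖x - (a + h)‖ ≤ 2 * θ * ‖h‖ := by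
      have e : x - (a + h) = ‖h‖ • ((c - v) - (‖h‖⁻¹ • h - v)) := by
        rw [← hab, ← hcb, smul_sub, smul_sub, smul_sub, smul_smul, mul_inv_cancel₀ hhp.ne', one_smul]; abel
      rw [e, norm_smul, norm_norm]
      have h1 : ‖c - v‖ ≤ θ := by rw [← dist_eq_norm]; exact hc
      have h2 : ‖‖h‖⁻¹ • h - v‖ ≤ θ := by rw [← dist_eq_norm]; exact (Metric.mem_ball.mp hv).le
      have := norm_sub_le (c - v) (‖h‖⁻¹ • h - v)
      nlinarith
    have hxa : ‖x - a‖ ≤ 3 * ‖h‖ := by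
      have : x - a = (x - (a + h)) + h := by abel
      rw [this]
      refine (norm_add_le _ _).trans ?_
      nlinarith
    have h1 := hclose x hxK (a + h)
    rw [norm_sub_rev (a + h) x] at h1
    have h2 := hTo (y := x) (by rw [dist_eq_norm]; linarith) hxK
    have h3 : q (a + h) - q a - T h = (q (a + h) - q x) + (q x - q a - T (x - a)) + T (x - (a + h)) := by
      have : T (x - (a + h)) = T (x - a) - T h := by rw [← map_sub]; congr 1; abel
      rw [this]; abel
    rw [h3]
    have h4 := T.le_opNorm (x - (a + h))
    have h5 := norm_add₃_le (a := q (a + h) - q x) (b := q x - q a - T (x - a)) (c := T (x - (a + h)))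
    have h6 : ‖T‖ * ‖x - (a + h)‖ ≤ ‖T‖ * (2 * θ * ‖h‖) := by gcongr
    have h7 : C * ‖x - (a + h)‖ ≤ C * (2 * θ * ‖h‖) := by gcongr
    have h8 : (C + ‖T‖) * (2 * θ) * ‖h‖ ≤ η / 2 * ‖h‖ := by gcongr
    nlinarith
  intro η hη
  have := hfirst η hη
  rw [Metric.eventually_nhds_iff] at this ⊢
  obtain ⟨ρ₀, hρ₀, hf⟩ := this
  refine ⟨ρ₀, hρ₀, fun h hh => ?_⟩
  rw [dist_zero_right] at hh
  have hf' : ∀ t, 0 ≤ t → t ≤ 1 → |⟪q (z + t • h), h⟫ - ⟪q z, h⟫ - t * ⟪T h, h⟫| ≤ η * ‖h‖ ^ 2 := by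
    intro t ht0 ht1
    have hn : ‖t • h‖ ≤ ‖h‖ := by
      rw [norm_smul, Real.norm_of_nonneg ht0]; nlinarith [norm_nonneg h]
    have h1 := hf (y := t • h) (by rw [dist_zero_right]; linarith)
    have h2 : ⟪q (z + t • h), h⟫ - ⟪q z, h⟫ - t * ⟪T h, h⟫ = ⟪q (z + t • h) - q z - T (t • h), h⟫ := by
      rw [inner_sub_left, inner_sub_left, map_smul, inner_smul_left]; simp
    rw [h2]
    refine (abs_real_inner_le_norm _ _).trans ?_
    have h3 : ‖q (z + t • h) - q z - T (t • h)‖ ≤ η * ‖h‖ := h1.trans (by gcongr)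
    nlinarith [norm_nonneg h]
  have hp := ja_partition (fun t => w (z + t • h) - t * ⟪q z, h⟫ - t ^ 2 / 2 * ⟪T h, h⟫)
    (η * ‖h‖ ^ 2) (C / 2 * ‖h‖ ^ 2 + |⟪T h, h⟫| / 2) (by positivity) ?_
  · simp only [one_smul, zero_smul, add_zero] at hp
    convert hp using 2
    ring
  intro t t' ht htt' ht'
  have a1 := hq (z + t • h) ((t' - t) • h)
  have a2 := hq (z + t' • h) ((t - t') • h)
  have e1 : z + t • h + (t' - t) • h = z + t' • h := by module
  have e2 : z + t' • h + (t - t') • h = z + t • h := by module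
  rw [e1, inner_smul_right, norm_smul, mul_pow, Real.norm_eq_abs, sq_abs] at a1
  rw [e2, inner_smul_right, norm_smul, mul_pow, Real.norm_eq_abs, sq_abs] at a2
  have b1 := abs_le.mp (hf' t ht (by linarith))
  have b2 := abs_le.mp (hf' t' (by linarith) ht')
  have hd : 0 ≤ t' - t := by linarith
  set Q := ⟪T h, h⟫
  have c1 := le_abs_self Q
  have c2 := neg_abs_le Q
  have d1 := mul_le_mul_of_nonneg_left b1.1 hd
  have d2 := mul_le_mul_of_nonneg_left b2.2 hd
  have f1 : 0 ≤ (t' - t) ^ 2 * (|Q| - Q) := mul_nonneg (sq_nonneg _) (by linarith)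
  have f2 : 0 ≤ (t' - t) ^ 2 * (|Q| + Q) := mul_nonneg (sq_nonneg _) (by linarith)
  rw [abs_le]
  constructor
  · nlinarith
  · nlinarith

end PB

section PB2
open Set Filter Topology
open scoped RealInnerProductSpace
variable {E : Type*} [NormedAddCommGroup E] [InnerProductSpace ℝ E] [FiniteDimensional ℝ E]

lemma le_of_sq_aux {a b : ℝ} (h : a ^ 2 ≤ b ^ 2) (hb : 0 ≤ b) : a ≤ b := by nlinarith

theorem ja_prod (G : E → E → ℝ) (C κ r : ℝ) (hC : 0 < C) (hκ : 0 < κ) (hr : 0 < r)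
    (hsub : ∀ a b, ∃ q1 q2 : E, ∀ h k, G a b + ⟪q1, h⟫ + ⟪q2, k⟫ - C / 2 * (‖h‖ ^ 2 + ‖k‖ ^ 2) ≤ G (a + h) (b + k))
    (hmax : ∀ a b, G a b ≤ G 0 0 - κ * (‖a‖ ^ 2 + ‖b‖ ^ 2)) :
    ∃ (a b p1 p2 : E) (T1 T2 : E →L[ℝ] E), ‖a‖ ≤ r / κ ∧ ‖b‖ ≤ r / κ ∧ ‖p1‖ ≤ r ∧ ‖p2‖ ≤ r ∧
      (∀ h k, G (a + h) (b + k) ≤ G a b + ⟪p1, h⟫ + ⟪p2, k⟫) ∧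
      (∀ η > 0, ∀ᶠ h in 𝓝 (0 : E), |G (a + h) b - G a b - ⟪p1, h⟫ - 1 / 2 * ⟪T1 h, h⟫| ≤ η * ‖h‖ ^ 2) ∧
      (∀ η > 0, ∀ᶠ k in 𝓝 (0 : E), |G a (b + k) - G a b - ⟪p2, k⟫ - 1 / 2 * ⟪T2 k, k⟫| ≤ η * ‖k‖ ^ 2) := by
  have hnz : ∀ z : WithLp 2 (E × E), ‖z‖ ^ 2 = ‖z.fst‖ ^ 2 + ‖z.snd‖ ^ 2 := fun z => WithLp.prod_norm_sq_eq_of_L2 z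
  have hin : ∀ z w : WithLp 2 (E × E), ⟪z, w⟫ = ⟪z.fst, w.fst⟫ + ⟪z.snd, w.snd⟫ := fun z w => WithLp.prod_inner_apply z w
  obtain ⟨z, P, T, hz, hP, hPmax, hexp⟩ := jensen_alexandrov
    (fun z : WithLp 2 (E × E) => G z.fst z.snd) C κ r hC hκ hr
    (by
      intro z
      obtain ⟨q1, q2, hq⟩ := hsub z.fst z.snd
      refine ⟨WithLp.toLp 2 (q1, q2), fun h => ?_⟩
      have h1 := hq h.fst h.snd
      rw [hin, hnz]
      change G z.fst z.snd + (⟪q1, h.fst⟫ + ⟪q2, h.snd⟫) - C / 2 * (‖h.fst‖ ^ 2 + ‖h.snd‖ ^ 2) ≤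
        G (z.fst + h.fst) (z.snd + h.snd)
      linarith)
    (by
      intro z
      rw [hnz]
      exact hmax z.fst z.snd)
  let i1 : E →L[ℝ] WithLp 2 (E × E) := LinearMap.toContinuousLinearMap
    { toFun := fun h => WithLp.toLp 2 (h, 0),
      map_add' := fun x y => by rw [← WithLp.toLp_add]; simp
      map_smul' := fun r x => by rw [RingHom.id_apply, ← WithLp.toLp_smul]; simp }
  let i2 : E →L[ℝ] WithLp 2 (E × E) := LinearMap.toContinuousLinearMap
    { toFun := fun h => WithLp.toLp 2 (0, h),
      map_add' := fun x y => by rw [← WithLp.toLp_add]; simp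
      map_smul' := fun r x => by rw [RingHom.id_apply, ← WithLp.toLp_smul]; simp }
  let J1 : WithLp 2 (E × E) →L[ℝ] E := LinearMap.toContinuousLinearMap
    { toFun := fun z => z.fst, map_add' := fun x y => rfl, map_smul' := fun r x => rfl }
  let J2 : WithLp 2 (E × E) →L[ℝ] E := LinearMap.toContinuousLinearMap
    { toFun := fun z => z.snd, map_add' := fun x y => rfl, map_smul' := fun r x => rfl }
  have f1 : ∀ h, (i1 h).fst = h := fun h => rfl
  have s1 : ∀ h, (i1 h).snd = 0 := fun h => rfl
  have f2 : ∀ h, (i2 h).fst = 0 := fun h => rfl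
  have s2 : ∀ h, (i2 h).snd = h := fun h => rfl
  have af : ∀ z w : WithLp 2 (E × E), (z + w).fst = z.fst + w.fst := fun z w => rfl
  have as : ∀ z w : WithLp 2 (E × E), (z + w).snd = z.snd + w.snd := fun z w => rfl
  refine ⟨z.fst, z.snd, P.fst, P.snd, (J1.comp T).comp i1, (J2.comp T).comp i2, ?_, ?_, ?_, ?_, ?_, ?_, ?_⟩
  · refine le_trans ?_ hz
    have := hnz z
    exact le_of_sq_aux (by nlinarith [sq_nonneg ‖z.snd‖]) (norm_nonneg _)
  · refine le_trans ?_ hz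
    have := hnz z
    exact le_of_sq_aux (by nlinarith [sq_nonneg ‖z.fst‖]) (norm_nonneg _)
  · refine le_trans ?_ hP
    have := hnz P
    exact le_of_sq_aux (by nlinarith [sq_nonneg ‖P.snd‖]) (norm_nonneg _)
  · refine le_trans ?_ hP
    have := hnz P
    exact le_of_sq_aux (by nlinarith [sq_nonneg ‖P.fst‖]) (norm_nonneg _)
  · intro h k
    have := hPmax (z + (i1 h + i2 k))
    rw [add_sub_cancel_left, hin] at this
    simp only [af, as, f1, f2, s1, s2, add_zero, zero_add] at this
    linarith
  · intro η hη
    have hc : Tendsto i1 (𝓝 0) (𝓝 0) := by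
      have := i1.continuous.tendsto 0
      rwa [map_zero] at this
    filter_upwards [hc.eventually (hexp η hη)] with h hh
    rw [hnz, hin, hin] at hh
    simp only [af, as, f1, s1, add_zero, zero_add, norm_zero, inner_zero_right, zero_pow (two_ne_zero)] at hh
    exact hh
  · intro η hη
    have hc : Tendsto i2 (𝓝 0) (𝓝 0) := by
      have := i2.continuous.tendsto 0
      rwa [map_zero] at this
    filter_upwards [hc.eventually (hexp η hη)] with h hh
    rw [hnz, hin, hin] at hh
    simp only [af, as, f2, s2, add_zero, zero_add, norm_zero, inner_zero_right, zero_pow (two_ne_zero)] at hh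
    exact hh

end PB2

section PC
open Set Filter Topology
open scoped RealInnerProductSpace

lemma quad_le_of_eventually {V : Type*} [NormedAddCommGroup V] [NormedSpace ℝ V] (l Q : V → ℝ)
    (hl : ∀ z, l (-z) = - l z) (hQ : ∀ (t : ℝ) z, Q (t • z) = t ^ 2 * Q z)
    (h : ∀ η > 0, ∀ᶠ z in 𝓝 (0 : V), l z + Q z ≤ η * ‖z‖ ^ 2) (z : V) : Q z ≤ 0 := by
  have key : ∀ η > 0, Q z ≤ η * ‖z‖ ^ 2 := by
    intro η hη
    have h1 := h η hη
    have h2 : Tendsto (fun t : ℝ => t • z) (𝓝[>] 0) (𝓝 0) := by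
      have : Tendsto (fun t : ℝ => t • z) (𝓝 0) (𝓝 ((0 : ℝ) • z)) :=
        (continuous_id.smul continuous_const).tendsto 0
      rw [zero_smul] at this
      exact this.mono_left nhdsWithin_le_nhds
    have h3 : Tendsto (fun t : ℝ => -(t • z)) (𝓝[>] 0) (𝓝 0) := by simpa using h2.neg
    obtain ⟨t, ht1, ht2, ht0⟩ := ((h2.eventually h1).and ((h3.eventually h1).and self_mem_nhdsWithin)).exists
    have ht0' : 0 < t := ht0
    have e1 : Q (-(t • z)) = t ^ 2 * Q z := by
      rw [← neg_smul, hQ]; ring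
    rw [hl, e1, norm_neg, norm_smul, Real.norm_of_nonneg ht0'.le] at ht2
    rw [hQ, norm_smul, Real.norm_of_nonneg ht0'.le] at ht1
    have : t ^ 2 * Q z ≤ t ^ 2 * (η * ‖z‖ ^ 2) := by nlinarith
    exact le_of_mul_le_mul_left this (by positivity)
  refine le_of_forall_pos_le_add fun e he => ?_
  have := key (e / (‖z‖ ^ 2 + 1)) (by positivity)
  refine this.trans ?_
  rw [zero_add, div_mul_eq_mul_div, div_le_iff₀ (by positivity)]
  nlinarith [sq_nonneg ‖z‖]

variable {E : Type*} [NormedAddCommGroup E] [InnerProductSpace ℝ E] [FiniteDimensional ℝ E]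

lemma three_sq (d e k : E) : ‖d + e - k‖ ^ 2 ≤ 3 * (‖d‖ ^ 2 + ‖e‖ ^ 2 + ‖k‖ ^ 2) := by
  have h1 : ‖d + e - k‖ ≤ ‖d‖ + ‖e‖ + ‖k‖ :=
    (norm_sub_le _ _).trans (by gcongr; exact norm_add_le _ _)
  have h2 : ‖d + e - k‖ ^ 2 ≤ (‖d‖ + ‖e‖ + ‖k‖) ^ 2 := by gcongr
  nlinarith [sq_nonneg (‖d‖ - ‖e‖), sq_nonneg (‖d‖ - ‖k‖), sq_nonneg (‖e‖ - ‖k‖)]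

/-- Sup-convolution data over a compact set. -/
lemma supconv_exists (g : E → ℝ) (B : Set E) (hB : IsCompact B) (hne : B.Nonempty)
    (hg : UpperSemicontinuousOn g B) (xb : E) (p : E) (c : ℝ) (a : E) :
    ∃ x ∈ B, ∀ x' ∈ B, g x' - ⟪p, x' - xb⟫ - c * ‖x' - xb - a‖ ^ 2 ≤
      g x - ⟪p, x - xb⟫ - c * ‖x - xb - a‖ ^ 2 := by
  have h1 : UpperSemicontinuousOn (fun x => g x + (- ⟪p, x - xb⟫ - c * ‖x - xb - a‖ ^ 2)) B := by
    apply hg.add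
    apply ContinuousOn.upperSemicontinuousOn
    fun_prop
  obtain ⟨x, hx, hmx⟩ := h1.exists_isMaxOn hne hB
  refine ⟨x, hx, fun x' hx' => ?_⟩
  have := hmx hx'
  simp only [mem_ofPred_eq] at this
  linarith

set_option maxHeartbeats 1000000 in
theorem sums_aux (u v : E → ℝ) (B : Set E) (hB : IsCompact B)
    (hu : UpperSemicontinuousOn u B) (hv : LowerSemicontinuousOn v B) (ε : ℝ) (hε : 0 < ε)
    (xb yb : E) (hx : xb ∈ interior B) (hy : yb ∈ interior B)
    (hmax : ∀ x ∈ B, ∀ y ∈ B, u x - v y - ‖x - y‖ ^ 2 / (2 * ε) ≤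
      u xb - v yb - ‖xb - yb‖ ^ 2 / (2 * ε)) (δ : ℝ) (hδ : 0 < δ) :
    ∃ (x y p q : E) (S T : E →L[ℝ] E), ‖x - xb‖ < δ ∧ ‖y - yb‖ < δ ∧ |u x - u xb| < δ ∧
      |v y - v yb| < δ ∧ ‖p - ε⁻¹ • (xb - yb)‖ < δ ∧ ‖q - ε⁻¹ • (xb - yb)‖ < δ ∧
      (∀ h k, ⟪S h, h⟫ - ⟪T k, k⟫ ≤ 3 / ε * ‖h - k‖ ^ 2 + δ * (‖h‖ ^ 2 + ‖k‖ ^ 2)) ∧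
      (∀ h, - (3 / ε * ‖h‖ ^ 2) ≤ ⟪S h, h⟫) ∧ (∀ k, ⟪T k, k⟫ ≤ 3 / ε * ‖k‖ ^ 2) ∧
      (∀ η > 0, ∀ᶠ h in 𝓝 (0 : E), u (x + h) ≤ u x + ⟪p, h⟫ + 1 / 2 * ⟪S h, h⟫ + η * ‖h‖ ^ 2) ∧
      (∀ η > 0, ∀ᶠ k in 𝓝 (0 : E), v y + ⟪q, k⟫ + 1 / 2 * ⟪T k, k⟫ - η * ‖k‖ ^ 2 ≤ v (y + k)) := by
  set pb : E := ε⁻¹ • (xb - yb) with hpb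
  set c : ℝ := 3 / (2 * ε) with hc
  have hcp : 0 < c := by positivity
  have hc3 : 3 / ε = 2 * c := by rw [hc]; field_simp
  have hxB : xb ∈ B := interior_subset hx
  have hyB : yb ∈ B := interior_subset hy
  have hne : B.Nonempty := ⟨xb, hxB⟩
  choose xa hxaB hxa using supconv_exists u B hB hne hu xb pb c
  have hv' : UpperSemicontinuousOn (fun y => - v y) B := by
    intro y hy c' hc'
    filter_upwards [hv y hy (-c') (by simp only at hc'; linarith)] with z hz
    linarith
  choose ya hyaB hya using supconv_exists (fun y => - v y) B hB hne hv' yb (-pb) c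
  set U : E → ℝ := fun a => u (xa a) - u xb - ⟪pb, xa a - xb⟫ - c * ‖xa a - xb - a‖ ^ 2 with hU
  set W : E → ℝ := fun b => v (ya b) - v yb - ⟪pb, ya b - yb⟫ + c * ‖ya b - yb - b‖ ^ 2 with hW
  have hUle : ∀ a, ∀ x ∈ B, u x - u xb - ⟪pb, x - xb⟫ - c * ‖x - xb - a‖ ^ 2 ≤ U a := by
    intro a x hx; have := hxa a x hx; simp only [hU]; linarith
  have hWle : ∀ b, ∀ y ∈ B, W b ≤ v y - v yb - ⟪pb, y - yb⟫ + c * ‖y - yb - b‖ ^ 2 := by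
    intro b y hy; have := hya b y hy; simp only [hW]; simp only [inner_neg_left] at this; linarith
  -- the translated maximum inequality
  have hmax' : ∀ x ∈ B, ∀ y ∈ B, (u x - u xb - ⟪pb, x - xb⟫) - (v y - v yb - ⟪pb, y - yb⟫) ≤
      c / 3 * ‖(x - xb) - (y - yb)‖ ^ 2 := by
    intro x hx y hy
    have h1 := hmax x hx y hy
    have e1 : ‖x - y‖ ^ 2 = ‖xb - yb‖ ^ 2 + 2 * ⟪xb - yb, (x - xb) - (y - yb)⟫ +
        ‖(x - xb) - (y - yb)‖ ^ 2 := by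
      rw [← norm_add_sq_real]; congr 2; abel
    have e2 : ⟪pb, x - xb⟫ - ⟪pb, y - yb⟫ = ε⁻¹ * ⟪xb - yb, (x - xb) - (y - yb)⟫ := by
      rw [← inner_sub_right, hpb, inner_smul_left]; simp
    rw [e1] at h1
    have e3 : (‖xb - yb‖ ^ 2 + 2 * ⟪xb - yb, (x - xb) - (y - yb)⟫ + ‖(x - xb) - (y - yb)‖ ^ 2) / (2 * ε)
        = ‖xb - yb‖ ^ 2 / (2 * ε) + ε⁻¹ * ⟪xb - yb, (x - xb) - (y - yb)⟫ + c / 3 * ‖(x - xb) - (y - yb)‖ ^ 2 := by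
      rw [hc]; field_simp
    linarith
  have hUW : ∀ a b, U a - W b ≤ c * ‖a - b‖ ^ 2 := by
    intro a b
    have h1 := hmax' _ (hxaB a) _ (hyaB b)
    have h2 := three_sq (a - b) (xa a - xb - a) (ya b - yb - b)
    have e : a - b + (xa a - xb - a) - (ya b - yb - b) = (xa a - xb) - (ya b - yb) := by abel
    rw [e] at h2
    simp only [hU, hW]
    nlinarith
  have hU0 : U 0 = 0 ∧ W 0 = 0 := by
    have h1 := hUle 0 xb hxB
    have h2 := hWle 0 yb hyB
    have h3 := hUW 0 0
    simp at h1 h2 h3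
    constructor <;> linarith
  -- semiconvexity
  have hUsc : ∀ a h, U a + 2 * c * ⟪xa a - xb - a, h⟫ - c * ‖h‖ ^ 2 ≤ U (a + h) := by
    intro a h
    have h1 := hUle (a + h) (xa a) (hxaB a)
    have e : ‖xa a - xb - (a + h)‖ ^ 2 = ‖xa a - xb - a‖ ^ 2 - 2 * ⟪xa a - xb - a, h⟫ + ‖h‖ ^ 2 := by
      rw [← norm_sub_sq_real]; congr 2; abel
    rw [e] at h1
    simp only [hU] at h1 ⊢
    linarith
  have hWsc : ∀ b k, W (b + k) ≤ W b - 2 * c * ⟪ya b - yb - b, k⟫ + c * ‖k‖ ^ 2 := by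
    intro b k
    have h1 := hWle (b + k) (ya b) (hyaB b)
    have e : ‖ya b - yb - (b + k)‖ ^ 2 = ‖ya b - yb - b‖ ^ 2 - 2 * ⟪ya b - yb - b, k⟫ + ‖k‖ ^ 2 := by
      rw [← norm_sub_sq_real]; congr 2; abel
    rw [e] at h1
    simp only [hW] at h1 ⊢
    linarith
  -- localisation
  have hloc : ∀ a, ‖xa a - xb - a‖ ^ 2 ≤ 5 * ‖a‖ ^ 2 ∧ - (c * ‖a‖ ^ 2) ≤ U a := by
    intro a
    have h1 := hUle a xb hxB
    have h2 := hmax' _ (hxaB a) yb hyB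
    simp at h1 h2
    have h3 : ‖xa a - xb‖ ^ 2 ≤ 2 * ‖xa a - xb - a‖ ^ 2 + 2 * ‖a‖ ^ 2 := by
      have : ‖xa a - xb‖ ≤ ‖xa a - xb - a‖ + ‖a‖ := by
        simpa using norm_add_le (xa a - xb - a) a
      have : ‖xa a - xb‖ ^ 2 ≤ (‖xa a - xb - a‖ + ‖a‖) ^ 2 := by gcongr
      nlinarith [sq_nonneg (‖xa a - xb - a‖ - ‖a‖)]
    refine ⟨?_, by linarith⟩
    have h4 : U a + c * ‖xa a - xb - a‖ ^ 2 ≤ c / 3 * ‖xa a - xb‖ ^ 2 := by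
      simp only [hU]; linarith
    have h5 : c * ‖xa a - xb - a‖ ^ 2 ≤ c * (5 * ‖a‖ ^ 2) := by nlinarith
    exact le_of_mul_le_mul_left h5 hcp
  have hlocy : ∀ b, ‖ya b - yb - b‖ ^ 2 ≤ 5 * ‖b‖ ^ 2 ∧ W b ≤ c * ‖b‖ ^ 2 := by
    intro b
    have h1 := hWle b yb hyB
    have h2 := hmax' xb hxB _ (hyaB b)
    simp at h1 h2
    have h3 : ‖ya b - yb‖ ^ 2 ≤ 2 * ‖ya b - yb - b‖ ^ 2 + 2 * ‖b‖ ^ 2 := by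
      have : ‖ya b - yb‖ ≤ ‖ya b - yb - b‖ + ‖b‖ := by
        simpa using norm_add_le (ya b - yb - b) b
      have : ‖ya b - yb‖ ^ 2 ≤ (‖ya b - yb - b‖ + ‖b‖) ^ 2 := by gcongr
      nlinarith [sq_nonneg (‖ya b - yb - b‖ - ‖b‖)]
    refine ⟨?_, by linarith⟩
    rw [norm_sub_rev] at h2
    have h4 : - W b + c * ‖ya b - yb - b‖ ^ 2 ≤ c / 3 * ‖ya b - yb‖ ^ 2 := by
      simp only [hW]; linarith
    have h5 : c * ‖ya b - yb - b‖ ^ 2 ≤ c * (5 * ‖b‖ ^ 2) := by nlinarith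
    exact le_of_mul_le_mul_left h5 hcp
  -- the doubled function
  set κ : ℝ := δ / 2 with hκ
  have hκp : 0 < κ := by positivity
  let G : E → E → ℝ := fun a b => U a - W b - c * ‖a - b‖ ^ 2 - κ * (‖a‖ ^ 2 + ‖b‖ ^ 2)
  have hG : ∀ a b, G a b = U a - W b - c * ‖a - b‖ ^ 2 - κ * (‖a‖ ^ 2 + ‖b‖ ^ 2) := fun a b => rfl
  have hexpn : ∀ a b h k, G (a + h) (b + k) = U (a + h) - W (b + k) - c * (‖a - b‖ ^ 2 +
        2 * ⟪a - b, h⟫ - 2 * ⟪a - b, k⟫ + ‖h - k‖ ^ 2) - κ * (‖a‖ ^ 2 + 2 * ⟪a, h⟫ + ‖h‖ ^ 2 +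
        (‖b‖ ^ 2 + 2 * ⟪b, k⟫ + ‖k‖ ^ 2)) := by
    intro a b h k
    have e1 : ‖a + h - (b + k)‖ ^ 2 = ‖a - b‖ ^ 2 + 2 * ⟪a - b, h - k⟫ + ‖h - k‖ ^ 2 := by
      rw [← norm_add_sq_real]; congr 2; abel
    rw [hG, e1, norm_add_sq_real a h, norm_add_sq_real b k, inner_sub_right]
    ring
  clear_value G
  have hG0 : G 0 0 = 0 := by rw [hG]; simp [hU0.1, hU0.2]
  have hGmax : ∀ a b, G a b ≤ G 0 0 - κ * (‖a‖ ^ 2 + ‖b‖ ^ 2) := by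
    intro a b
    have := hUW a b
    rw [hG0, hG]; linarith
  have hGsub : ∀ a b, ∃ q1 q2 : E, ∀ h k, G a b + ⟪q1, h⟫ + ⟪q2, k⟫ -
      (6 * c + 2 * κ) / 2 * (‖h‖ ^ 2 + ‖k‖ ^ 2) ≤ G (a + h) (b + k) := by
    intro a b
    refine ⟨(2 * c) • (xa a - xb - a) - (2 * c) • (a - b) - (2 * κ) • a,
      (2 * c) • (ya b - yb - b) + (2 * c) • (a - b) - (2 * κ) • b, fun h k => ?_⟩
    have h1 := hUsc a h
    have h2 := hWsc b k
    have e4 : ‖h - k‖ ^ 2 ≤ 2 * ‖h‖ ^ 2 + 2 * ‖k‖ ^ 2 := by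
      have t1 := norm_sub_le h k
      have t2 : ‖h - k‖ ^ 2 ≤ (‖h‖ + ‖k‖) ^ 2 := by gcongr
      nlinarith [sq_nonneg (‖h‖ - ‖k‖)]
    have i1 : ⟪(2 * c) • (xa a - xb - a) - (2 * c) • (a - b) - (2 * κ) • a, h⟫ =
        2 * c * ⟪xa a - xb - a, h⟫ - 2 * c * ⟪a - b, h⟫ - 2 * κ * ⟪a, h⟫ := by
      rw [inner_sub_left, inner_sub_left, real_inner_smul_left, real_inner_smul_left, real_inner_smul_left]
    have i2 : ⟪(2 * c) • (ya b - yb - b) + (2 * c) • (a - b) - (2 * κ) • b, k⟫ =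
        2 * c * ⟪ya b - yb - b, k⟫ + 2 * c * ⟪a - b, k⟫ - 2 * κ * ⟪b, k⟫ := by
      rw [inner_sub_left, inner_add_left, real_inner_smul_left, real_inner_smul_left, real_inner_smul_left]
    rw [i1, i2, hexpn, hG]
    have e5 := mul_le_mul_of_nonneg_left e4 hcp.le
    linarith
  -- choice of the small radius
  obtain ⟨t, ht, ht1, htδ, htu, htv, htp⟩ : ∃ t : ℝ, 0 < t ∧ t ≤ 1 ∧ 4 * t < δ ∧
      4 * ‖pb‖ * t + 16 * c * t < δ ∧ 4 * ‖pb‖ * t + 16 * c * t < δ ∧ (κ + 4 * c + 2 * κ) * t < δ := by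
    have h0 : ∀ M : ℝ, ∀ᶠ t in 𝓝[>] (0 : ℝ), M * t < δ := by
      intro M
      have : Tendsto (fun t : ℝ => M * t) (𝓝 0) (𝓝 (M * 0)) := (continuous_const.mul continuous_id).tendsto 0
      rw [mul_zero] at this
      exact (this.mono_left nhdsWithin_le_nhds).eventually (gt_mem_nhds hδ)
    have h1 : ∀ᶠ t in 𝓝[>] (0 : ℝ), t ≤ 1 :=
      mem_nhdsWithin_of_mem_nhds (Iic_mem_nhds one_pos)
    obtain ⟨t, a1, a2, a3, a4, a5⟩ := (h1.and ((h0 4).and ((h0 (4 * ‖pb‖ + 16 * c)).and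
      ((h0 (κ + 4 * c + 2 * κ)).and self_mem_nhdsWithin)))).exists
    exact ⟨t, a5, a1, a2, by linarith, by linarith, a4⟩
  -- neighbourhoods inside B
  obtain ⟨rx, hrx, hrxB⟩ := Metric.isOpen_iff.mp isOpen_interior xb hx
  obtain ⟨ry, hry, hryB⟩ := Metric.isOpen_iff.mp isOpen_interior yb hy
  set t' : ℝ := min t (min (rx / 8) (ry / 8)) with ht'
  have ht'p : 0 < t' := by positivity
  have ht't : t' ≤ t := min_le_left _ _
  have ht'x : t' ≤ rx / 8 := (min_le_right _ _).trans (min_le_left _ _)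
  have ht'y : t' ≤ ry / 8 := (min_le_right _ _).trans (min_le_right _ _)
  obtain ⟨a, b, P1, P2, T1, T2, hza, hzb, hP1, hP2, hPmax, hexp1, hexp2⟩ := ja_prod G (6 * c + 2 * κ) κ (κ * t')
    (by positivity) hκp (by positivity) hGsub hGmax
  rw [mul_div_cancel_left₀ _ hκp.ne'] at hza hzb
  have hx4 : ‖xa a - xb‖ ≤ 4 * t' := by
    have h1 : ‖xa a - xb - a‖ ≤ 3 * ‖a‖ :=
      le_of_sq_aux (by nlinarith [(hloc a).1, sq_nonneg ‖a‖]) (by positivity)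
    have h2 : ‖xa a - xb‖ ≤ ‖xa a - xb - a‖ + ‖a‖ := by simpa using norm_add_le (xa a - xb - a) a
    linarith
  have hy4 : ‖ya b - yb‖ ≤ 4 * t' := by
    have h1 : ‖ya b - yb - b‖ ≤ 3 * ‖b‖ :=
      le_of_sq_aux (by nlinarith [(hlocy b).1, sq_nonneg ‖b‖]) (by positivity)
    have h2 : ‖ya b - yb‖ ≤ ‖ya b - yb - b‖ + ‖b‖ := by simpa using norm_add_le (ya b - yb - b) b
    linarith
  have ht'1 : t' ≤ 1 := ht't.trans ht1
  have ht'sq : t' ^ 2 ≤ t' := by nlinarith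
  have hasq : ‖a‖ ^ 2 ≤ t' ^ 2 := by gcongr
  have hbsq : ‖b‖ ^ 2 ≤ t' ^ 2 := by gcongr
  have hxsq : ‖xa a - xb‖ ^ 2 ≤ (4 * t') ^ 2 := by gcongr
  have hysq : ‖ya b - yb‖ ^ 2 ≤ (4 * t') ^ 2 := by gcongr
  let S : E →L[ℝ] E := T1 + (2 * c + 2 * κ) • ContinuousLinearMap.id ℝ E
  let R : E →L[ℝ] E := -T2 - (2 * c + 2 * κ) • ContinuousLinearMap.id ℝ E
  have hS : ∀ h, ⟪S h, h⟫ = ⟪T1 h, h⟫ + (2 * c + 2 * κ) * ‖h‖ ^ 2 := by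
    intro h
    have : S h = T1 h + (2 * c + 2 * κ) • h := rfl
    rw [this, inner_add_left, real_inner_smul_left, real_inner_self_eq_norm_sq]
  have hR : ∀ h, ⟪R h, h⟫ = - ⟪T2 h, h⟫ - (2 * c + 2 * κ) * ‖h‖ ^ 2 := by
    intro h
    have : R h = -(T2 h) - (2 * c + 2 * κ) • h := rfl
    rw [this, inner_sub_left, real_inner_smul_left, real_inner_self_eq_norm_sq, inner_neg_left]
  clear_value S R
  obtain ⟨p', hp'⟩ : ∃ p' : E, p' = P1 + (2 * c) • (a - b) + (2 * κ) • a := ⟨_, rfl⟩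
  obtain ⟨q', hq'⟩ : ∃ q' : E, q' = -P2 + (2 * c) • (a - b) - (2 * κ) • b := ⟨_, rfl⟩
  have hp'i : ∀ h, ⟪p', h⟫ = ⟪P1, h⟫ + 2 * c * ⟪a - b, h⟫ + 2 * κ * ⟪a, h⟫ := by
    intro h; rw [hp', inner_add_left, inner_add_left, real_inner_smul_left, real_inner_smul_left]
  have hq'i : ∀ h, ⟪q', h⟫ = -⟪P2, h⟫ + 2 * c * ⟪a - b, h⟫ - 2 * κ * ⟪b, h⟫ := by
    intro h; rw [hq', inner_sub_left, inner_add_left, real_inner_smul_left, real_inner_smul_left, inner_neg_left]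
  have hUexp : ∀ η > 0, ∀ᶠ h in 𝓝 (0 : E),
      |U (a + h) - U a - ⟪p', h⟫ - 1 / 2 * ⟪S h, h⟫| ≤ η * ‖h‖ ^ 2 := by
    intro η hη
    filter_upwards [hexp1 η hη] with h hh
    have e0 : U (a + h) - U a - ⟪p', h⟫ - 1 / 2 * ⟪S h, h⟫ =
        G (a + h) b - G a b - ⟪P1, h⟫ - 1 / 2 * ⟪T1 h, h⟫ := by
      have e := hexpn a b h 0
      simp only [add_zero, inner_zero_right, sub_zero, mul_zero, norm_zero] at e
      rw [e, hG, hS, hp'i]; ring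
    rw [e0]; exact hh
  have hWexp : ∀ η > 0, ∀ᶠ h in 𝓝 (0 : E),
      |W (b + h) - W b - ⟪q', h⟫ - 1 / 2 * ⟪R h, h⟫| ≤ η * ‖h‖ ^ 2 := by
    intro η hη
    filter_upwards [hexp2 η hη] with h hh
    have e0 : W (b + h) - W b - ⟪q', h⟫ - 1 / 2 * ⟪R h, h⟫ =
        -(G a (b + h) - G a b - ⟪P2, h⟫ - 1 / 2 * ⟪T2 h, h⟫) := by
      have e := hexpn a b 0 h
      simp only [add_zero, inner_zero_right, zero_sub, norm_neg, mul_zero, norm_zero] at e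
      rw [e, hG, hR, hq'i]; ring
    rw [e0, abs_neg]; exact hh
  have hab : ‖a - b‖ ≤ 2 * t' := (norm_sub_le a b).trans (by linarith)
  have hfin : (κ + 4 * c + 2 * κ) * t' < δ := by
    refine lt_of_le_of_lt ?_ htp
    gcongr
  have hfin2 : 4 * ‖pb‖ * t' + 16 * c * t' < δ := by
    refine lt_of_le_of_lt ?_ htu
    gcongr
  refine ⟨xa a, ya b, pb + p', pb + q', S, R, by linarith, by linarith, ?_, ?_, ?_, ?_, ?_, ?_, ?_, ?_, ?_⟩
  · have h1 := (hloc a).2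
    have h2 := hmax' _ (hxaB a) yb hyB
    simp at h2
    have h3 : |⟪pb, xa a - xb⟫| ≤ ‖pb‖ * (4 * t') :=
      (abs_real_inner_le_norm _ _).trans (by gcongr)
    have h4 := abs_le.mp h3
    simp only [hU] at h1
    have h5 : 0 ≤ c * ‖xa a - xb - a‖ ^ 2 := by positivity
    have h6 : c * ‖a‖ ^ 2 ≤ c * t' := by gcongr; linarith
    have h7 : c / 3 * ‖xa a - xb‖ ^ 2 ≤ c / 3 * (16 * t') := by gcongr; nlinarith
    have h8 : 0 < c * t' := by positivity
    rw [abs_lt]; constructor <;> linarith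
  · have h1 := (hlocy b).2
    have h2 := hmax' xb hxB _ (hyaB b)
    simp at h2
    rw [norm_sub_rev] at h2
    have h3 : |⟪pb, ya b - yb⟫| ≤ ‖pb‖ * (4 * t') :=
      (abs_real_inner_le_norm _ _).trans (by gcongr)
    have h4 := abs_le.mp h3
    simp only [hW] at h1
    have h5 : 0 ≤ c * ‖ya b - yb - b‖ ^ 2 := by positivity
    have h6 : c * ‖b‖ ^ 2 ≤ c * t' := by gcongr; linarith
    have h7 : c / 3 * ‖ya b - yb‖ ^ 2 ≤ c / 3 * (16 * t') := by gcongr; nlinarith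
    have h8 : 0 < c * t' := by positivity
    rw [abs_lt]; constructor <;> linarith
  · rw [add_sub_cancel_left]
    refine lt_of_le_of_lt ?_ hfin
    have h1 : ‖p'‖ ≤ ‖P1‖ + ‖(2 * c) • (a - b)‖ + ‖(2 * κ) • a‖ := by
      rw [hp']; exact norm_add₃_le
    rw [norm_smul, norm_smul, Real.norm_of_nonneg (by positivity), Real.norm_of_nonneg (by positivity)] at h1
    have h2 : 2 * c * ‖a - b‖ ≤ 2 * c * (2 * t') := by gcongr
    have h3 : 2 * κ * ‖a‖ ≤ 2 * κ * t' := by gcongr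
    linarith
  · rw [add_sub_cancel_left]
    refine lt_of_le_of_lt ?_ hfin
    have h1 : ‖q'‖ ≤ ‖-P2‖ + ‖(2 * c) • (a - b)‖ + ‖(2 * κ) • b‖ := by
      rw [hq']; exact (norm_sub_le _ _).trans (by gcongr; exact norm_add_le _ _)
    rw [norm_neg, norm_smul, norm_smul, Real.norm_of_nonneg (by positivity), Real.norm_of_nonneg (by positivity)] at h1
    have h2 : 2 * c * ‖a - b‖ ≤ 2 * c * (2 * t') := by gcongr
    have h3 : 2 * κ * ‖b‖ ≤ 2 * κ * t' := by gcongr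
    linarith
  · -- upper matrix inequality
    intro h k
    have hq := quad_le_of_eventually (V := E × E) (fun _ => 0)
      (fun w => 1 / 2 * ⟪S w.1, w.1⟫ - 1 / 2 * ⟪R w.2, w.2⟫ - c * ‖w.1 - w.2‖ ^ 2 - κ * (‖w.1‖ ^ 2 + ‖w.2‖ ^ 2))
      ?_ ?_ ?_ (h, k)
    · simp only at hq
      rw [hc3]
      have hκδ : δ = 2 * κ := by rw [hκ]; ring
      rw [hκδ]
      linarith
    · intro w; simp
    · intro t w
      have e1 : ‖t • w.1 - t • w.2‖ ^ 2 = t ^ 2 * ‖w.1 - w.2‖ ^ 2 := by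
        rw [← smul_sub, norm_smul, mul_pow, Real.norm_eq_abs, sq_abs]
      have e2 : ∀ x : E, ‖t • x‖ ^ 2 = t ^ 2 * ‖x‖ ^ 2 := by
        intro x; rw [norm_smul, mul_pow, Real.norm_eq_abs, sq_abs]
      simp only [Prod.smul_fst, Prod.smul_snd, map_smul, real_inner_smul_left, real_inner_smul_right, e1, e2]
      ring
    · intro η hη
      have hf : Tendsto (fun w : E × E => w.1) (𝓝 0) (𝓝 0) := continuous_fst.tendsto 0
      have hs : Tendsto (fun w : E × E => w.2) (𝓝 0) (𝓝 0) := continuous_snd.tendsto 0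
      filter_upwards [hf.eventually (hUexp (η / 2) (by positivity)), hs.eventually (hWexp (η / 2) (by positivity))] with w h1 h2
      have h3 := hPmax w.1 w.2
      rw [hexpn, hG] at h3
      rw [hp'i] at h1
      rw [hq'i] at h2
      have h1' := abs_le.mp h1
      have h2' := abs_le.mp h2
      have n1 : η / 2 * ‖w.1‖ ^ 2 ≤ η / 2 * ‖w‖ ^ 2 := by gcongr; exact norm_fst_le w
      have n2 : η / 2 * ‖w.2‖ ^ 2 ≤ η / 2 * ‖w‖ ^ 2 := by gcongr; exact norm_snd_le w
      linarith [h1'.1, h2'.2]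
  · intro h
    have hq := quad_le_of_eventually (V := E)
      (fun h => 2 * c * ⟪xa a - xb - a, h⟫ - ⟪p', h⟫) (fun h => - (c * ‖h‖ ^ 2) - 1 / 2 * ⟪S h, h⟫) ?_ ?_ ?_ h
    · rw [hc3]; linarith
    · intro w; simp only [inner_neg_right]; ring
    · intro t w
      simp only [map_smul, inner_smul_left, inner_smul_right, norm_smul, mul_pow, Real.norm_eq_abs, sq_abs, conj_trivial]; ring
    · intro η hη
      filter_upwards [hUexp η hη] with w h1
      have := hUsc a w
      have h1' := abs_le.mp h1
      linarith [h1'.2]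
  · intro k
    have hq := quad_le_of_eventually (V := E)
      (fun h => 2 * c * ⟪ya b - yb - b, h⟫ + ⟪q', h⟫) (fun h => - (c * ‖h‖ ^ 2) + 1 / 2 * ⟪R h, h⟫) ?_ ?_ ?_ k
    · rw [hc3]; linarith
    · intro w; simp only [inner_neg_right]; ring
    · intro t w
      simp only [map_smul, inner_smul_left, inner_smul_right, norm_smul, mul_pow, Real.norm_eq_abs, sq_abs, conj_trivial]; ring
    · intro η hη
      filter_upwards [hWexp η hη] with w h1
      have := hWsc b w
      have h1' := abs_le.mp h1
      linarith [h1'.1]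
  · intro η hη
    have hball : ∀ᶠ h in 𝓝 (0 : E), ‖h‖ < rx / 2 := by
      filter_upwards [Metric.ball_mem_nhds (0 : E) (show 0 < rx / 2 by positivity)] with h hh
      simpa using hh
    filter_upwards [hUexp η hη, hball] with h h1 h2
    have hin : xa a + h ∈ B := by
      apply interior_subset; apply hrxB
      rw [Metric.mem_ball, dist_eq_norm]
      have : xa a + h - xb = (xa a - xb) + h := by abel
      rw [this]
      refine lt_of_le_of_lt (norm_add_le _ _) ?_
      linarith
    have h3 := hUle (a + h) _ hin
    have e1 : xa a + h - xb - (a + h) = xa a - xb - a := by abel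
    have e2 : xa a + h - xb = (xa a - xb) + h := by abel
    rw [e1, e2, inner_add_right] at h3
    have h1' := abs_le.mp h1
    have h4 : U a = u (xa a) - u xb - ⟪pb, xa a - xb⟫ - c * ‖xa a - xb - a‖ ^ 2 := rfl
    rw [inner_add_left]
    linarith [h1'.2]
  · intro η hη
    have hball : ∀ᶠ h in 𝓝 (0 : E), ‖h‖ < ry / 2 := by
      filter_upwards [Metric.ball_mem_nhds (0 : E) (show 0 < ry / 2 by positivity)] with h hh
      simpa using hh
    filter_upwards [hWexp η hη, hball] with h h1 h2
    have hin : ya b + h ∈ B := by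
      apply interior_subset; apply hryB
      rw [Metric.mem_ball, dist_eq_norm]
      have : ya b + h - yb = (ya b - yb) + h := by abel
      rw [this]
      refine lt_of_le_of_lt (norm_add_le _ _) ?_
      linarith
    have h3 := hWle (b + h) _ hin
    have e1 : ya b + h - yb - (b + h) = ya b - yb - b := by abel
    have e2 : ya b + h - yb = (ya b - yb) + h := by abel
    rw [e1, e2, inner_add_right] at h3
    have h1' := abs_le.mp h1
    have h4 : W b = v (ya b) - v yb - ⟪pb, ya b - yb⟫ + c * ‖ya b - yb - b‖ ^ 2 := rfl
    rw [inner_add_left]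
    linarith [h1'.1]

end PC

section PD
open Set Filter Topology
open scoped RealInnerProductSpace

/-- Shorthand for square matrices. -/
abbrev Mn (n : ℕ) := Matrix (Fin n) (Fin n) ℝ

/-- The operator of a matrix. -/
def opm {n : ℕ} (X : Mn n) : En n →L[ℝ] En n := Matrix.toEuclideanCLM (𝕜 := ℝ) X

/-- The quadratic form of a matrix. -/
def qf {n : ℕ} (X : Mn n) (h : En n) : ℝ := ⟪opm X h, h⟫

variable {n : ℕ}

lemma opm_add (X Y : Mn n) (h : En n) : opm (X + Y) h = opm X h + opm Y h := by
  simp [opm]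
lemma opm_smul (c : ℝ) (X : Mn n) (h : En n) : opm (c • X) h = c • opm X h := by
  simp [opm]
lemma opm_one (h : En n) : opm (1 : Mn n) h = h := by
  simp [opm]
lemma opm_symm (X : Mn n) (hX : X.IsSymm) (h k : En n) : ⟪opm X h, k⟫ = ⟪opm X k, h⟫ := by
  rw [real_inner_comm, opm, Matrix.inner_toEuclideanCLM, real_inner_comm, Matrix.inner_toEuclideanCLM,
    Matrix.dotProduct_mulVec, dotProduct_comm, ← Matrix.mulVec_transpose, hX.eq]

lemma qf_add (X Y : Mn n) (h : En n) : qf (X + Y) h = qf X h + qf Y h := by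
  simp [qf, opm_add, inner_add_left]
lemma qf_smul (c : ℝ) (X : Mn n) (h : En n) : qf (c • X) h = c * qf X h := by
  simp [qf, opm_smul, real_inner_smul_left]
lemma qf_one (h : En n) : qf (1 : Mn n) h = ‖h‖ ^ 2 := by
  simp [qf, opm_one]
lemma qf_zero (h : En n) : qf (0 : Mn n) h = 0 := by
  simp [qf, opm]
lemma qf_neg (X : Mn n) (h : En n) : qf (-X) h = - qf X h := by
  simp [qf, opm]
lemma qf_sub (X Y : Mn n) (h : En n) : qf (X - Y) h = qf X h - qf Y h := by
  rw [sub_eq_add_neg, qf_add, qf_neg]; ring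
lemma qf_at_zero (X : Mn n) : qf X 0 = 0 := by simp [qf]
lemma qf_at_smul (X : Mn n) (t : ℝ) (h : En n) : qf X (t • h) = t ^ 2 * qf X h := by
  simp [qf, real_inner_smul_left, real_inner_smul_right]; ring
lemma qf_at_add (X : Mn n) (hX : X.IsSymm) (h k : En n) :
    qf X (h + k) = qf X h + 2 * ⟪opm X h, k⟫ + qf X k := by
  simp only [qf, map_add, inner_add_left, inner_add_right]
  rw [opm_symm X hX k h]; ring
lemma qf_abs_le (X : Mn n) (h : En n) : |qf X h| ≤ ‖opm X‖ * ‖h‖ ^ 2 := by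
  unfold qf
  refine (abs_real_inner_le_norm _ _).trans ?_
  have := (opm X).le_opNorm h
  nlinarith [norm_nonneg h]
lemma qf_continuous (X : Mn n) : Continuous (qf X) := by
  unfold qf; fun_prop
lemma qf_dot (X : Mn n) (h : En n) : qf X h = h.ofLp ⬝ᵥ X.mulVec h.ofLp := by
  rw [qf, real_inner_comm, opm, Matrix.inner_toEuclideanCLM]

lemma symm_add {X Y : Mn n} (hX : X.IsSymm) (hY : Y.IsSymm) : (X + Y).IsSymm := by
  unfold Matrix.IsSymm at *; rw [Matrix.transpose_add, hX, hY]
lemma symm_smul {X : Mn n} (c : ℝ) (hX : X.IsSymm) : (c • X).IsSymm := by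
  unfold Matrix.IsSymm at *; rw [Matrix.transpose_smul, hX]
lemma symm_one : (1 : Mn n).IsSymm := Matrix.transpose_one
lemma symm_sub {X Y : Mn n} (hX : X.IsSymm) (hY : Y.IsSymm) : (X - Y).IsSymm := by
  unfold Matrix.IsSymm at *; rw [Matrix.transpose_sub, hX, hY]

lemma psd_of_qf {X : Mn n} (hX : X.IsSymm) (h : ∀ h, 0 ≤ qf X h) : X.PosSemidef := by
  refine Matrix.PosSemidef.of_dotProduct_mulVec_nonneg ?_ ?_
  · rw [Matrix.IsHermitian, Matrix.conjTranspose_eq_transpose_of_trivial]; exact hX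
  · intro x
    have := h (WithLp.toLp 2 x)
    rw [qf_dot] at this
    simpa using this

/-- Matrix from an operator. -/
lemma exists_matrix (S : En n →L[ℝ] En n) : ∃ X : Mn n, X.IsSymm ∧ ∀ h, qf X h = ⟪S h, h⟫ := by
  let e := (Matrix.toEuclideanCLM (n := Fin n) (𝕜 := ℝ))
  let M : Mn n := e.symm S
  have hM : opm M = S := e.apply_symm_apply S
  refine ⟨(1 / 2 : ℝ) • (M + M.transpose), ?_, ?_⟩
  · apply symm_smul
    unfold Matrix.IsSymm
    rw [Matrix.transpose_add, Matrix.transpose_transpose, add_comm]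
  · intro h
    have h2 : qf M.transpose h = qf M h := by
      rw [qf_dot, qf_dot, Matrix.dotProduct_mulVec, Matrix.vecMul_transpose, dotProduct_comm]
    rw [qf_smul, qf_add, h2, qf, hM]; ring

/-! ### Calculus of quadratics -/

lemma quad_hasFDerivAt (p x0 : En n) (X : Mn n) (hX : X.IsSymm) (x : En n) :
    HasFDerivAt (fun x => ⟪p, x - x0⟫ + 1 / 2 * qf X (x - x0))
      (innerSL ℝ (p + opm X (x - x0))) x := by
  have h0 : HasFDerivAt (fun x : En n => x - x0) (ContinuousLinearMap.id ℝ (En n)) x :=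
    (hasFDerivAt_id x).sub_const x0
  have h1 : HasFDerivAt (fun x => ⟪p, x - x0⟫) ((innerSL ℝ p).comp (ContinuousLinearMap.id ℝ (En n))) x :=
    ((innerSL ℝ p).hasFDerivAt).comp x h0
  have h2 : HasFDerivAt (fun x => opm X (x - x0)) ((opm X).comp (ContinuousLinearMap.id ℝ (En n))) x :=
    ((opm X).hasFDerivAt).comp x h0
  have h3 := (h1.add ((h2.inner ℝ h0).const_mul (1 / 2)))
  refine h3.congr_fderiv ?_
  ext k
  simp only [_root_.add_apply, ContinuousLinearMap.comp_apply, _root_.smul_apply,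
    ContinuousLinearMap.prod_apply, fderivInnerCLM_apply, ContinuousLinearMap.id_apply, innerSL_apply_apply,
    inner_add_left, smul_eq_mul]
  rw [opm_symm X hX k (x - x0)]; ring

lemma quad_contDiff (p x0 : En n) (X : Mn n) :
    ContDiff ℝ 2 (fun x => ⟪p, x - x0⟫ + 1 / 2 * qf X (x - x0)) := by
  have h : ContDiff ℝ 2 (fun x : En n => x - x0) := by fun_prop
  exact (contDiff_const.inner ℝ h).add (contDiff_const.mul (((opm X).contDiff.comp h).inner ℝ h))

lemma quad_gradient (p x0 : En n) (X : Mn n) (hX : X.IsSymm) :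
    gradient (fun x => ⟪p, x - x0⟫ + 1 / 2 * qf X (x - x0)) x0 = p := by
  have h := quad_hasFDerivAt p x0 X hX x0
  rw [sub_self, map_zero, add_zero] at h
  have : HasGradientAt (fun x => ⟪p, x - x0⟫ + 1 / 2 * qf X (x - x0)) p x0 := h
  exact this.gradient

lemma hess_eq (φ : En n → ℝ) (x : En n) (i j : Fin n) : hessianMatrix φ x i j =
    fderiv ℝ (fderiv ℝ φ) x (EuclideanSpace.single i 1) (EuclideanSpace.single j 1) := by
  rw [hessianMatrix, iteratedFDeriv_two_apply]; rfl

lemma quad_hess (p x0 : En n) (X : Mn n) (hX : X.IsSymm) :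
    hessianMatrix (fun x => ⟪p, x - x0⟫ + 1 / 2 * qf X (x - x0)) x0 = X := by
  ext i j
  rw [hess_eq]
  have e : fderiv ℝ (fun x => ⟪p, x - x0⟫ + 1 / 2 * qf X (x - x0)) =
      fun x => innerSL ℝ (p + opm X (x - x0)) := by
    funext x; exact (quad_hasFDerivAt p x0 X hX x).fderiv
  rw [e]
  have h0 : HasFDerivAt (fun x : En n => x - x0) (ContinuousLinearMap.id ℝ (En n)) x0 :=
    (hasFDerivAt_id x0).sub_const x0
  have h2 : HasFDerivAt (fun x => p + opm X (x - x0)) ((opm X).comp (ContinuousLinearMap.id ℝ (En n))) x0 :=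
    (((opm X).hasFDerivAt).comp x0 h0).const_add p
  have h3 : HasFDerivAt (fun x => innerSL ℝ (p + opm X (x - x0)))
      ((innerSL ℝ : En n →L[ℝ] _).comp ((opm X).comp (ContinuousLinearMap.id ℝ (En n)))) x0 :=
    ((innerSL ℝ : En n →L[ℝ] _).hasFDerivAt).comp x0 h2
  rw [h3.fderiv]
  simp only [ContinuousLinearMap.comp_apply, ContinuousLinearMap.id_apply, innerSL_apply_apply]
  rw [opm_symm X hX, EuclideanSpace.inner_single_right]
  simp [opm, Matrix.ofLp_toEuclideanCLM]

lemma hess_symm (φ : En n → ℝ) (hφ : ContDiff ℝ 2 φ) (x : En n) : (hessianMatrix φ x).IsSymm := by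
  ext i j
  rw [Matrix.transpose_apply, hess_eq, hess_eq]
  exact (hφ.contDiffAt.isSymmSndFDerivAt (by simp)) _ _

lemma hess_bilin (φ : En n → ℝ) (hφ : ContDiff ℝ 2 φ) (x h k : En n) :
    fderiv ℝ (fderiv ℝ φ) x h k = ⟪opm (hessianMatrix φ x) h, k⟫ := by
  have hs := hess_symm φ hφ x
  rw [opm_symm _ hs]
  have hh : h = ∑ i, h i • EuclideanSpace.single i (1 : ℝ) := by
    ext j; simp [Finset.sum_apply, Pi.single_apply]
  have hk : k = ∑ i, k i • EuclideanSpace.single i (1 : ℝ) := by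
    ext j; simp [Finset.sum_apply, Pi.single_apply]
  have : ⟪opm (hessianMatrix φ x) k, h⟫ = ∑ i, ∑ j, h i * (k j * hessianMatrix φ x i j) := by
    rw [real_inner_comm, opm, Matrix.inner_toEuclideanCLM]
    simp only [dotProduct, Matrix.mulVec, Finset.mul_sum]
    refine Finset.sum_congr rfl fun i _ => Finset.sum_congr rfl fun j _ => ?_
    ring
  rw [this]
  conv_lhs => rw [hh, hk]
  simp only [map_sum, map_smul, _root_.sum_apply, _root_.smul_apply, hess_eq,
    smul_eq_mul, Finset.mul_sum]
  rw [Finset.sum_comm]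
  refine Finset.sum_congr rfl fun i _ => Finset.sum_congr rfl fun j _ => ?_
  ring

lemma taylor_two (φ : En n → ℝ) (hφ : ContDiff ℝ 2 φ) (x0 : En n) (η : ℝ) (hη : 0 < η) :
    ∀ᶠ x in 𝓝 x0, |φ x - φ x0 - ⟪gradient φ x0, x - x0⟫ - 1 / 2 * qf (hessianMatrix φ x0) (x - x0)| ≤
      η * ‖x - x0‖ ^ 2 := by
  have hd : Differentiable ℝ φ := hφ.differentiable (by norm_num)
  have hd2 : Differentiable ℝ (fderiv ℝ φ) :=
    (hφ.fderiv_right (m := 1) (by norm_num)).differentiable (by norm_num)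
  have hs := hess_symm φ hφ x0
  have hg : ∀ h, ⟪gradient φ x0, h⟫ = fderiv ℝ φ x0 h := by
    intro h
    have := (hd x0).hasGradientAt.hasFDerivAt.fderiv
    rw [this]; simp
  have h1 := (hd2 x0).hasFDerivAt.isLittleO.def hη
  obtain ⟨r, hr, hball⟩ := Metric.eventually_nhds_iff_ball.mp h1
  filter_upwards [Metric.ball_mem_nhds x0 hr] with x hx
  set ψ : En n → ℝ := fun y => φ y - (⟪gradient φ x0, y - x0⟫ + 1 / 2 * qf (hessianMatrix φ x0) (y - x0)) with hψ
  have hder : ∀ y, HasFDerivAt ψ (fderiv ℝ φ y - innerSL ℝ (gradient φ x0 + opm (hessianMatrix φ x0) (y - x0))) y :=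
    fun y => (hd y).hasFDerivAt.sub (quad_hasFDerivAt _ x0 _ hs y)
  have hR : 0 ≤ ‖x - x0‖ := norm_nonneg _
  have key := Convex.norm_image_sub_le_of_norm_hasFDerivWithin_le (𝕜 := ℝ) (f := ψ)
    (s := Metric.closedBall x0 ‖x - x0‖) (C := η * ‖x - x0‖) (x := x0) (y := x)
    (fun y _ => (hder y).hasFDerivWithinAt) ?_ (convex_closedBall _ _) ?_ ?_
  · simp only [hψ, sub_self, inner_zero_right, qf_at_zero, Real.norm_eq_abs] at key
    have e : φ x - φ x0 - ⟪gradient φ x0, x - x0⟫ - 1 / 2 * qf (hessianMatrix φ x0) (x - x0) =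
      φ x - (⟪gradient φ x0, x - x0⟫ + 1 / 2 * qf (hessianMatrix φ x0) (x - x0)) - (φ x0 - (0 + 1 / 2 * 0)) := by ring
    rw [e]
    refine key.trans (le_of_eq (by ring))
  · intro y hy
    have hy' : ‖y - x0‖ ≤ ‖x - x0‖ := by simpa [dist_eq_norm] using hy
    have hyr : y ∈ Metric.ball x0 r := by
      rw [Metric.mem_ball, dist_eq_norm] at hx ⊢; linarith
    have h2 := hball y hyr
    have e : fderiv ℝ φ y - innerSL ℝ (gradient φ x0 + opm (hessianMatrix φ x0) (y - x0)) =
        fderiv ℝ φ y - fderiv ℝ φ x0 - fderiv ℝ (fderiv ℝ φ) x0 (y - x0) := by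
      ext k
      simp only [_root_.sub_apply, innerSL_apply_apply, inner_add_left, hg, hess_bilin φ hφ]
      ring
    rw [e]
    exact h2.trans (by gcongr)
  · simp
  · simp [dist_eq_norm]

end PD

section PE
open Set Filter Topology
open scoped RealInnerProductSpace

/-- All the data and hypotheses of the theorem. -/
structure Dat (n : ℕ) where
  (lam Lam m s ρ γ₁ γm cbar A σ₀ : ℝ)
  (ω : ℝ → ℝ)
  (F : En n → Mn n → ℝ)
  (H : En n → En n → ℝ)
  (f : En n → ℝ)
  (hn : 1 ≤ n)
  (hlam : 0 < lam) (hlamLam : lam ≤ Lam)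
  (hm1 : 1 < m) (hm2 : m ≤ 2) (hsm : m < s)
  (hFell : ∀ (x : En n) (X Y : Mn n), X.IsSymm → Y.IsSymm →
      Y.PosSemidef →
      lam * Y.trace ≤ F x (X + Y) - F x X ∧ F x (X + Y) - F x X ≤ Lam * Y.trace)
  (hF0 : ∀ x, F x 0 = 0)
  (hFcont : ∀ X : Mn n, X.IsSymm → Continuous fun x => F x X)
  (hFstruct : ∀ R > (0 : ℝ), ∃ ωR : ℝ → ℝ, IsModulus ωR ∧
      ∀ ε > (0 : ℝ), ∀ (x y : En n) (X Y : Mn n),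
        ‖x‖ < R → ‖y‖ < R → X.IsSymm → Y.IsSymm →
        (Matrix.fromBlocks X 0 0 (-Y) +
          (3 / ε) • (1 : Matrix (Fin n ⊕ Fin n) (Fin n ⊕ Fin n) ℝ)).PosSemidef →
        ((3 / ε) • Matrix.fromBlocks (1 : Mn n) (-1) (-1) 1 -
          Matrix.fromBlocks X 0 0 (-Y)).PosSemidef →
        F x X - F y Y ≤ ωR (‖x - y‖ + ε⁻¹ * ‖x - y‖ ^ 2))
  (hFhom : ∀ σ ∈ Set.Ioo (0 : ℝ) 1, ∀ (x : En n) (X : Mn n),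
      F x (σ • X) = σ * F x X)
  (hH0 : ∀ x, H x 0 = 0)
  (hγ₁ : 0 < γ₁) (hγm : 0 < γm) (hω : IsModulus ω)
  (hHstruct : ∀ x y p q : En n,
      |H x (p + q) - H y p| ≤ ω ‖x - y‖ * (‖p‖ ^ m + 1) +
        (γ₁ + γm * (‖p‖ ^ (m - 1) + ‖q‖ ^ (m - 1))) * ‖q‖)
  (hcbar : 0 < cbar) (hA : 0 < A) (hσ₀ : σ₀ ∈ Set.Ioo (0 : ℝ) 1)
  (hHconv : ∀ (x p : En n), ∀ σ ∈ Set.Ioo σ₀ 1,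
      H x p - σ * H x (σ⁻¹ • p) ≤ (1 - σ) * (-cbar * ‖p‖ ^ m + A))
  (hf : Continuous f) (hρ : 0 ≤ ρ)
  (hρ1 : m ≤ 2 * s / (s + 1) → ρ < m * (s - 1) / ((m - 1) * s))
  (hρ2 : 2 * s / (s + 1) < m → ρ < 2 * (s - m) / (s * (m - 1)))
  (hflimsup : ∃ C M : ℝ, ∀ x : En n, M ≤ ‖x‖ → max (-f x) 0 ≤ C * ‖x‖ ^ ρ)

variable {n : ℕ}
namespace Dat
variable (D : Dat n)

lemma hLam : 0 < D.Lam := lt_of_lt_of_le D.hlam D.hlamLam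
lemma hs1 : 1 < D.s := D.hm1.trans D.hsm
lemma hs0 : 0 < D.s := zero_lt_one.trans D.hs1
lemma hm0 : 0 < D.m := zero_lt_one.trans D.hm1
lemma hnpos (D : Dat n) : (0 : ℝ) < n := by exact_mod_cast D.hn

/-- the zeroth order term -/
def g (t : ℝ) : ℝ := |t| ^ (D.s - 1) * t

lemma g_of_nonneg {t : ℝ} (ht : 0 ≤ t) : D.g t = t ^ D.s := by
  rw [g, abs_of_nonneg ht]
  rcases ht.eq_or_lt with rfl | h
  · rw [mul_zero, Real.zero_rpow D.hs0.ne']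
  · nth_rewrite 2 [← Real.rpow_one t]
    rw [← Real.rpow_add h]; congr 1; ring
lemma g_neg (t : ℝ) : D.g (-t) = - D.g t := by
  simp [g]
lemma g_cont : Continuous D.g := by
  unfold g
  have : 0 < D.s - 1 := sub_pos.mpr D.hs1
  exact ((continuous_abs).rpow_const (fun x => Or.inr this.le)).mul continuous_id
lemma g_strictMono : StrictMono D.g := by
  have hpos : ∀ a b : ℝ, 0 ≤ a → a < b → D.g a < D.g b := by
    intro a b ha hab
    rw [D.g_of_nonneg ha, D.g_of_nonneg (ha.trans hab.le)]
    exact Real.rpow_lt_rpow ha hab D.hs0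
  have hzero : D.g 0 = 0 := by simp [g]
  intro a b hab
  rcases le_or_gt 0 a with ha | ha
  · exact hpos a b ha hab
  · rcases le_or_gt b 0 with hb | hb
    · have := hpos (-b) (-a) (by linarith) (by linarith)
      rw [D.g_neg, D.g_neg] at this; linarith
    · have h1 := hpos 0 b le_rfl hb
      have h2 := hpos 0 (-a) le_rfl (by linarith)
      rw [D.g_neg] at h2; linarith

lemma F_le (x : En n) (X X' : Mn n) (hX : X.IsSymm) (hX' : X'.IsSymm) (c : ℝ) (hc : 0 ≤ c)
    (h : ∀ h, qf X h ≤ qf X' h + c * ‖h‖ ^ 2) : D.F x X ≤ D.F x X' + D.Lam * n * c := by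
  have h1 : (c • (1 : Mn n)).IsSymm := symm_smul c symm_one
  have hY : (X' + c • 1 - X : Mn n).IsSymm := symm_sub (symm_add hX' h1) hX
  have hp : (X' + c • 1 - X : Mn n).PosSemidef := by
    refine psd_of_qf hY fun v => ?_
    rw [qf_sub, qf_add, qf_smul, qf_one]; linarith [h v]
  have e1 := (D.hFell x X _ hX hY hp).1
  have e2 := (D.hFell x X' (c • 1) hX' h1 (psd_of_qf h1 fun v => by
    rw [qf_smul, qf_one]; positivity)).2
  rw [add_sub_cancel] at e1
  have e3 : 0 ≤ D.lam * (X' + c • 1 - X : Mn n).trace := mul_nonneg D.hlam.le hp.trace_nonneg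
  rw [Matrix.trace_smul, Matrix.trace_one, Fintype.card_fin, smul_eq_mul] at e2
  linarith

lemma F_cont (x0 : En n) (X : Mn n) (hX : X.IsSymm) (e : ℝ) (he : 0 < e) :
    ∃ δ > 0, ∀ (x : En n) (X' : Mn n), ‖x - x0‖ < δ → X'.IsSymm →
      (∀ h, |qf X' h - qf X h| ≤ δ * ‖h‖ ^ 2) → |D.F x X' - D.F x0 X| < e := by
  have h1 := (D.hFcont X hX).tendsto x0
  obtain ⟨δ1, hδ1, h2⟩ := Metric.tendsto_nhds_nhds.mp h1 (e / 2) (by positivity)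
  have hL : 0 < D.Lam * n := mul_pos D.hLam D.hnpos
  refine ⟨min δ1 (e / (4 * (D.Lam * n))), by positivity, fun x X' hx hX' hq => ?_⟩
  set δ := min δ1 (e / (4 * (D.Lam * n))) with hδ
  have hδ0 : 0 < δ := by positivity
  have h3 := h2 (x := x) (by rw [dist_eq_norm]; exact hx.trans_le (min_le_left _ _))
  rw [Real.dist_eq] at h3
  have h4 := D.F_le x X X' hX hX' δ hδ0.le (fun h => by linarith [(abs_le.mp (hq h)).1])
  have h5 := D.F_le x X' X hX' hX δ hδ0.le (fun h => by linarith [(abs_le.mp (hq h)).2])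
  have h6 : D.Lam * n * δ ≤ e / 4 := by
    have : δ ≤ e / (4 * (D.Lam * n)) := min_le_right _ _
    calc D.Lam * n * δ ≤ D.Lam * n * (e / (4 * (D.Lam * n))) := by gcongr
      _ = e / 4 := by field_simp; exact div_self hL.ne'
  rw [abs_lt] at h3 ⊢
  constructor <;> linarith

lemma mod_tendsto {ω : ℝ → ℝ} (h : IsModulus ω) : ∀ e > 0, ∃ δ > 0, ∀ t, 0 ≤ t → t < δ → ω t < e := by
  intro e he
  have h1 := h.2.2.2
  rw [Metric.continuousWithinAt_iff] at h1
  obtain ⟨δ, hδ, h2⟩ := h1 e he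
  refine ⟨δ, hδ, fun t ht htd => ?_⟩
  have := h2 (x := t) ht (by rw [Real.dist_eq, sub_zero, abs_of_nonneg ht]; exact htd)
  rw [h.2.2.1, Real.dist_eq, sub_zero] at this
  exact lt_of_abs_lt this

lemma H_cont : Continuous (fun z : En n × En n => D.H z.1 z.2) := by
  rw [continuous_iff_continuousAt]
  rintro ⟨y, p⟩
  have hm : 0 < D.m - 1 := sub_pos.mpr D.hm1
  rw [ContinuousAt, tendsto_iff_dist_tendsto_zero]
  have hω : Tendsto (fun z : En n × En n => D.ω ‖z.1 - y‖) (𝓝 (y, p)) (𝓝 0) := by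
    rw [Metric.tendsto_nhds]
    intro e he
    obtain ⟨δ, hδ, h⟩ := mod_tendsto D.hω e he
    have hc : Tendsto (fun z : En n × En n => ‖z.1 - y‖) (𝓝 (y, p)) (𝓝 0) := by
      have : Continuous (fun z : En n × En n => ‖z.1 - y‖) := by fun_prop
      simpa using this.tendsto (y, p)
    filter_upwards [hc.eventually (gt_mem_nhds hδ)] with z hz
    rw [Real.dist_eq, sub_zero, abs_of_nonneg (D.hω.1 _ (norm_nonneg _))]
    exact h _ (norm_nonneg _) hz
  have hq : Tendsto (fun z : En n × En n => ‖z.2 - p‖) (𝓝 (y, p)) (𝓝 0) := by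
    have : Continuous (fun z : En n × En n => ‖z.2 - p‖) := by fun_prop
    simpa using this.tendsto (y, p)
  have hq2 : Tendsto (fun z : En n × En n => ‖z.2 - p‖ ^ (D.m - 1)) (𝓝 (y, p)) (𝓝 0) := by
    have := hq.rpow_const (p := D.m - 1) (Or.inr hm.le)
    rwa [Real.zero_rpow hm.ne'] at this
  have hbig : Tendsto (fun z : En n × En n => D.ω ‖z.1 - y‖ * (‖p‖ ^ D.m + 1) +
        (D.γ₁ + D.γm * (‖p‖ ^ (D.m - 1) + ‖z.2 - p‖ ^ (D.m - 1))) * ‖z.2 - p‖) (𝓝 (y, p)) (𝓝 0) := by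
    have := (hω.mul_const (‖p‖ ^ D.m + 1)).add
      (((hq2.const_add (‖p‖ ^ (D.m - 1))).const_mul D.γm |>.const_add D.γ₁).mul hq)
    simpa using this
  refine squeeze_zero (fun _ => dist_nonneg) (fun z => ?_) hbig
  have := D.hHstruct z.1 y p (z.2 - p)
  rw [add_sub_cancel] at this
  rw [Real.dist_eq]; exact this

/-- the growth of `H` -/
lemma H_abs_le (x p : En n) : |D.H x p| ≤ D.γ₁ * ‖p‖ + D.γm * ‖p‖ ^ D.m := by
  have h := D.hHstruct x x 0 p
  have hm : 0 < D.m - 1 := sub_pos.mpr D.hm1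
  rw [zero_add, D.hH0, sub_zero, sub_self, norm_zero, D.hω.2.2.1, Real.zero_rpow hm.ne'] at h
  refine h.trans (le_of_eq ?_)
  have : ‖p‖ ^ (D.m - 1) * ‖p‖ = ‖p‖ ^ D.m := by
    rcases (norm_nonneg p).eq_or_lt with h0 | h0
    · rw [← h0, mul_zero, Real.zero_rpow D.hm0.ne']
    · nth_rewrite 2 [← Real.rpow_one ‖p‖]
      rw [← Real.rpow_add h0]; congr 1; ring
  rw [← this]; ring

/-! ### Jets -/

def SubAt (u : En n → ℝ) (x0 : En n) : Prop :=
  ∀ (p : En n) (X : Mn n), X.IsSymm →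
    (∀ᶠ x in 𝓝 x0, u x ≤ u x0 + ⟪p, x - x0⟫ + 1 / 2 * qf X (x - x0)) →
    D.f x0 ≤ D.F x0 X + D.H x0 p - D.g (u x0)

def SuperAt (v : En n → ℝ) (x0 : En n) : Prop :=
  ∀ (p : En n) (X : Mn n), X.IsSymm →
    (∀ᶠ x in 𝓝 x0, v x0 + ⟪p, x - x0⟫ + 1 / 2 * qf X (x - x0) ≤ v x) →
    D.F x0 X + D.H x0 p - D.g (v x0) ≤ D.f x0

lemma SubAt.slack {D : Dat n} {u : En n → ℝ} {x0 : En n} (hu : D.SubAt u x0) (p : En n) (X : Mn n) (hX : X.IsSymm)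
    (h : ∀ η > 0, ∀ᶠ x in 𝓝 x0, u x ≤ u x0 + ⟪p, x - x0⟫ + 1 / 2 * qf X (x - x0) + η * ‖x - x0‖ ^ 2) :
    D.f x0 ≤ D.F x0 X + D.H x0 p - D.g (u x0) := by
  have hL : 0 < D.Lam * n := mul_pos D.hLam D.hnpos
  refine le_of_forall_pos_le_add fun e he => ?_
  obtain ⟨η, hη0, hη⟩ : ∃ η > 0, D.Lam * n * (2 * η) = e :=
    ⟨e / (2 * (D.Lam * n)), by positivity, by field_simp; exact div_self hL.ne'⟩
  have h1 := hu p (X + (2 * η) • 1) (symm_add hX (symm_smul _ symm_one)) (by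
    filter_upwards [h η hη0] with x hx
    rw [qf_add, qf_smul, qf_one]; linarith)
  have h2 := D.F_le x0 (X + (2 * η) • 1) X (symm_add hX (symm_smul _ symm_one)) hX (2 * η) (by positivity)
    (fun v => by rw [qf_add, qf_smul, qf_one])
  linarith

lemma SuperAt.slack {D : Dat n} {u : En n → ℝ} {x0 : En n} (hu : D.SuperAt u x0) (p : En n) (X : Mn n) (hX : X.IsSymm)
    (h : ∀ η > 0, ∀ᶠ x in 𝓝 x0, u x0 + ⟪p, x - x0⟫ + 1 / 2 * qf X (x - x0) - η * ‖x - x0‖ ^ 2 ≤ u x) :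
    D.F x0 X + D.H x0 p - D.g (u x0) ≤ D.f x0 := by
  have hL : 0 < D.Lam * n := mul_pos D.hLam D.hnpos
  refine le_of_forall_pos_le_add fun e he => ?_
  obtain ⟨η, hη0, hη⟩ : ∃ η > 0, D.Lam * n * (2 * η) = e :=
    ⟨e / (2 * (D.Lam * n)), by positivity, by field_simp; exact div_self hL.ne'⟩
  have h1 := hu p (X - (2 * η) • 1) (symm_sub hX (symm_smul _ symm_one)) (by
    filter_upwards [h η hη0] with x hx
    rw [qf_sub, qf_smul, qf_one]; linarith)
  have h2 := D.F_le x0 X (X - (2 * η) • 1) hX (symm_sub hX (symm_smul _ symm_one)) (2 * η) (by positivity)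
    (fun v => by rw [qf_sub, qf_smul, qf_one]; linarith)
  linarith

lemma visc_sub_iff (u : En n → ℝ) :
    ViscositySubsolution D.F D.H D.s D.f u ↔ ∀ x0, D.SubAt u x0 := by
  constructor
  · intro h x0 p X hX hx
    have h1 := h _ (quad_contDiff p x0 X) x0 (by
      filter_upwards [hx] with x hx
      simp only [Pi.sub_apply, sub_self, inner_zero_right, qf_at_zero]; linarith)
    rw [quad_hess p x0 X hX, quad_gradient p x0 X hX] at h1
    exact h1
  · intro h φ hφ x0 hmax
    refine (h x0).slack _ _ (hess_symm φ hφ x0) fun η hη => ?_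
    filter_upwards [hmax, taylor_two φ hφ x0 η hη] with x h1 h2
    simp only [Pi.sub_apply] at h1
    linarith [(abs_le.mp h2).2]

lemma visc_super_iff (u : En n → ℝ) :
    ViscositySupersolution D.F D.H D.s D.f u ↔ ∀ x0, D.SuperAt u x0 := by
  constructor
  · intro h x0 p X hX hx
    have h1 := h _ (quad_contDiff p x0 X) x0 (by
      filter_upwards [hx] with x hx
      simp only [Pi.sub_apply, sub_self, inner_zero_right, qf_at_zero]; linarith)
    rw [quad_hess p x0 X hX, quad_gradient p x0 X hX] at h1
    exact h1
  · intro h φ hφ x0 hmax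
    refine (h x0).slack _ _ (hess_symm φ hφ x0) fun η hη => ?_
    filter_upwards [hmax, taylor_two φ hφ x0 η hη] with x h1 h2
    simp only [Pi.sub_apply] at h1
    linarith [(abs_le.mp h2).1]

end Dat
end PE

section PF
open Set Filter Topology
open scoped RealInnerProductSpace
variable {n : ℕ}

lemma norm_sq_dot (h : En n) : ‖h‖ ^ 2 = h.ofLp ⬝ᵥ h.ofLp := by
  rw [EuclideanSpace.norm_sq_eq]; simp [dotProduct, pow_two]

lemma block_diag_qf (X Y : Mn n) (z : Fin n ⊕ Fin n → ℝ) :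
    z ⬝ᵥ (Matrix.fromBlocks X 0 0 (-Y)).mulVec z =
      qf X (WithLp.toLp 2 (z ∘ Sum.inl)) - qf Y (WithLp.toLp 2 (z ∘ Sum.inr)) := by
  rw [qf_dot, qf_dot, Matrix.fromBlocks_mulVec]
  simp only [dotProduct, Fintype.sum_sum_type, Sum.elim_inl, Sum.elim_inr, Matrix.zero_mulVec, add_zero,
    zero_add, Matrix.neg_mulVec, Pi.add_apply, Pi.neg_apply, Function.comp_apply, mul_neg, Finset.sum_neg_distrib]
  ring

lemma block_one_qf (z : Fin n ⊕ Fin n → ℝ) :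
    z ⬝ᵥ z = ‖(WithLp.toLp 2 (z ∘ Sum.inl) : En n)‖ ^ 2 + ‖(WithLp.toLp 2 (z ∘ Sum.inr) : En n)‖ ^ 2 := by
  rw [norm_sq_dot, norm_sq_dot]
  simp [dotProduct, Fintype.sum_sum_type]

lemma block_diff_qf (z : Fin n ⊕ Fin n → ℝ) :
    z ⬝ᵥ (Matrix.fromBlocks (1 : Mn n) (-1) (-1) 1).mulVec z =
      ‖(WithLp.toLp 2 (z ∘ Sum.inl) - WithLp.toLp 2 (z ∘ Sum.inr) : En n)‖ ^ 2 := by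
  rw [norm_sq_dot, Matrix.fromBlocks_mulVec]
  simp only [dotProduct, Fintype.sum_sum_type, Sum.elim_inl, Sum.elim_inr, Matrix.one_mulVec,
    Matrix.neg_mulVec, Pi.add_apply, Pi.neg_apply, Function.comp_apply, WithLp.ofLp_sub, Pi.sub_apply]
  rw [← Finset.sum_add_distrib]
  exact Finset.sum_congr rfl fun i _ => by ring

lemma block_herm (X Y Z : Mn n) (hX : X.IsSymm) (hY : Y.IsSymm) (hZ : Z.IsSymm) :
    (Matrix.fromBlocks X Z Z Y).IsHermitian := by
  rw [Matrix.IsHermitian, Matrix.conjTranspose_eq_transpose_of_trivial, Matrix.fromBlocks_transpose,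
    hX.eq, hY.eq, hZ.eq]

namespace Dat
variable (D : Dat n)

lemma F_struct (R : ℝ) (hR : 0 < R) : ∃ ωR : ℝ → ℝ, IsModulus ωR ∧
      ∀ ε > (0 : ℝ), ∀ (x y : En n) (X Y : Mn n),
        ‖x‖ < R → ‖y‖ < R → X.IsSymm → Y.IsSymm →
        (∀ h k, -(3 / ε * (‖h‖ ^ 2 + ‖k‖ ^ 2)) ≤ qf X h - qf Y k) →
        (∀ h k, qf X h - qf Y k ≤ 3 / ε * ‖h - k‖ ^ 2) →
        D.F x X - D.F y Y ≤ ωR (‖x - y‖ + ε⁻¹ * ‖x - y‖ ^ 2) := by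
  obtain ⟨ωR, h1, h2⟩ := D.hFstruct R hR
  refine ⟨ωR, h1, fun ε hε x y X Y hx hy hX hY ha hb => h2 ε hε x y X Y hx hy hX hY ?_ ?_⟩
  · have hYn : (-Y).IsSymm := by unfold Matrix.IsSymm at *; rw [Matrix.transpose_neg, hY]
    refine Matrix.PosSemidef.of_dotProduct_mulVec_nonneg ?_ ?_
    · refine (block_herm X (-Y) 0 hX hYn Matrix.transpose_zero).add ?_
      rw [Matrix.IsHermitian, Matrix.conjTranspose_eq_transpose_of_trivial, Matrix.transpose_smul, Matrix.transpose_one]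
    · intro z
      rw [star_trivial, Matrix.add_mulVec, dotProduct_add, block_diag_qf, Matrix.smul_mulVec, Matrix.one_mulVec,
        dotProduct_smul, block_one_qf, smul_eq_mul]
      linarith [ha (WithLp.toLp 2 (z ∘ Sum.inl)) (WithLp.toLp 2 (z ∘ Sum.inr))]
  · have hYn : (-Y).IsSymm := by unfold Matrix.IsSymm at *; rw [Matrix.transpose_neg, hY]
    refine Matrix.PosSemidef.of_dotProduct_mulVec_nonneg ?_ ?_
    · refine Matrix.IsHermitian.sub ?_ (block_herm X (-Y) 0 hX hYn Matrix.transpose_zero)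
      have := block_herm (1 : Mn n) 1 (-1) symm_one symm_one (by unfold Matrix.IsSymm; simp)
      rw [Matrix.IsHermitian, Matrix.conjTranspose_eq_transpose_of_trivial] at this ⊢
      rw [Matrix.transpose_smul, this]
    · intro z
      rw [star_trivial, Matrix.sub_mulVec, dotProduct_sub, block_diag_qf, Matrix.smul_mulVec,
        dotProduct_smul, block_diff_qf, smul_eq_mul]
      linarith [hb (WithLp.toLp 2 (z ∘ Sum.inl)) (WithLp.toLp 2 (z ∘ Sum.inr))]

end Dat

/-- Doubling of variables. -/
lemma doubling (a b : En n → ℝ) (B : Set (En n)) (hB : IsCompact B)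
    (ha : UpperSemicontinuousOn a B) (hb : LowerSemicontinuousOn b B) (θ : ℝ)
    (z0 : En n) (hz0 : z0 ∈ B) (hz0θ : a z0 - b z0 = θ)
    (hbd : ∀ x ∈ B, x ∉ interior B → a x - b x < θ) (δ : ℝ) (hδ : 0 < δ) :
    ∃ ε > 0, ∃ x ∈ interior B, ∃ y ∈ interior B,
      (∀ x' ∈ B, ∀ y' ∈ B, a x' - b y' - ‖x' - y'‖ ^ 2 / (2 * ε) ≤ a x - b y - ‖x - y‖ ^ 2 / (2 * ε)) ∧
      ‖x - y‖ < δ ∧ ‖x - y‖ ^ 2 / ε < δ ∧ θ ≤ a x - b y := by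
  -- maximizers
  have hex : ∀ k : ℕ, ∃ z : En n × En n, z ∈ B ×ˢ B ∧ ∀ x' ∈ B, ∀ y' ∈ B,
      a x' - b y' - ‖x' - y'‖ ^ 2 / (2 * (1 / 2) ^ k) ≤ a z.1 - b z.2 - ‖z.1 - z.2‖ ^ 2 / (2 * (1 / 2) ^ k) := by
    intro k
    have hU : UpperSemicontinuousOn (fun z : En n × En n =>
        a z.1 + (- b z.2) + - (‖z.1 - z.2‖ ^ 2 / (2 * (1 / 2) ^ k))) (B ×ˢ B) := by
      refine UpperSemicontinuousOn.add (UpperSemicontinuousOn.add ?_ ?_) ?_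
      · intro z hz c hc
        have h1 := ha z.1 hz.1 c hc
        have : Tendsto (fun z : En n × En n => z.1) (𝓝[B ×ˢ B] z) (𝓝[B] z.1) :=
          tendsto_nhdsWithin_iff.mpr ⟨continuous_fst.continuousAt.mono_left nhdsWithin_le_nhds,
            by filter_upwards [self_mem_nhdsWithin] with w hw using hw.1⟩
        exact this.eventually h1
      · intro z hz c hc
        have h1 := hb z.2 hz.2 (-c) (by simp only at hc; linarith)
        have : Tendsto (fun z : En n × En n => z.2) (𝓝[B ×ˢ B] z) (𝓝[B] z.2) :=
          tendsto_nhdsWithin_iff.mpr ⟨continuous_snd.continuousAt.mono_left nhdsWithin_le_nhds,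
            by filter_upwards [self_mem_nhdsWithin] with w hw using hw.2⟩
        filter_upwards [this.eventually h1] with w hw
        linarith
      · apply ContinuousOn.upperSemicontinuousOn
        fun_prop
    obtain ⟨z, hz, hm⟩ := hU.exists_isMaxOn ⟨(z0, z0), Set.mk_mem_prod hz0 hz0⟩ (hB.prod hB)
    refine ⟨z, hz, fun x' hx' y' hy' => ?_⟩
    have := hm (show (x', y') ∈ B ×ˢ B from ⟨hx', hy'⟩)
    simp only [mem_ofPred_eq] at this
    linarith
  choose z hzB hzmax using hex
  set M : ℕ → ℝ := fun k => a (z k).1 - b (z k).2 - ‖(z k).1 - (z k).2‖ ^ 2 / (2 * (1 / 2) ^ k) with hM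
  have hMθ : ∀ k, θ ≤ M k := by
    intro k
    have := hzmax k z0 hz0 z0 hz0
    simp only [sub_self, norm_zero] at this
    simp only [hM]
    have e : (0 : ℝ) ^ 2 / (2 * (1 / 2) ^ k) = 0 := by simp
    linarith
  have hstep : ∀ k, M (k + 1) + ‖(z (k + 1)).1 - (z (k + 1)).2‖ ^ 2 / (1 / 2) ^ (k + 1) / 4 ≤ M k := by
    intro k
    have := hzmax k _ (hzB (k + 1)).1 _ (hzB (k + 1)).2
    simp only [hM]
    have e : ‖(z (k + 1)).1 - (z (k + 1)).2‖ ^ 2 / (2 * (1 / 2) ^ k) =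
        ‖(z (k + 1)).1 - (z (k + 1)).2‖ ^ 2 / (1 / 2) ^ (k + 1) / 4 := by
      rw [pow_succ]; field_simp; ring
    have e2 : ‖(z (k + 1)).1 - (z (k + 1)).2‖ ^ 2 / (2 * (1 / 2) ^ (k + 1)) =
        ‖(z (k + 1)).1 - (z (k + 1)).2‖ ^ 2 / (1 / 2) ^ (k + 1) / 2 := by
      field_simp
    rw [e] at this
    rw [e2]
    linarith
  have hanti : Antitone M := antitone_nat_of_succ_le fun k => by
    have := hstep k
    have h0 : 0 ≤ ‖(z (k + 1)).1 - (z (k + 1)).2‖ ^ 2 / (1 / 2) ^ (k + 1) / 4 := by positivity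
    linarith
  have hlim : Tendsto M atTop (𝓝 (⨅ i, M i)) :=
    tendsto_atTop_ciInf hanti ⟨θ, by rintro _ ⟨k, rfl⟩; exact hMθ k⟩
  have hpen : Tendsto (fun k => ‖(z (k + 1)).1 - (z (k + 1)).2‖ ^ 2 / (1 / 2) ^ (k + 1)) atTop (𝓝 0) := by
    have h1 : Tendsto (fun k => 4 * (M k - M (k + 1))) atTop (𝓝 0) := by
      have := (hlim.sub ((tendsto_add_atTop_iff_nat 1).mpr hlim)).const_mul 4
      simpa using this
    refine squeeze_zero (fun k => by positivity) (fun k => ?_) h1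
    linarith [hstep k]
  have hdist : Tendsto (fun k => ‖(z (k + 1)).1 - (z (k + 1)).2‖) atTop (𝓝 0) := by
    have h1 : Tendsto (fun k => √(‖(z (k + 1)).1 - (z (k + 1)).2‖ ^ 2 / (1 / 2) ^ (k + 1))) atTop (𝓝 0) := by
      have := hpen.sqrt; simpa using this
    refine squeeze_zero (fun k => norm_nonneg _) (fun k => ?_) h1
    apply Real.le_sqrt_of_sq_le
    rw [le_div_iff₀ (by positivity)]
    have : ((1 : ℝ) / 2) ^ (k + 1) ≤ 1 := pow_le_one₀ (by norm_num) (by norm_num)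
    nlinarith [sq_nonneg ‖(z (k + 1)).1 - (z (k + 1)).2‖]
  obtain ⟨xh, hxh, φ, hφ, hconv⟩ := hB.tendsto_subseq (x := fun k => (z (k + 1)).1) (fun k => (hzB (k + 1)).1)
  have hconvy : Tendsto (fun k => (z (φ k + 1)).2) atTop (𝓝 xh) := by
    have h1 : Tendsto (fun k => (z (φ k + 1)).1 - (z (φ k + 1)).2) atTop (𝓝 0) :=
      tendsto_zero_iff_norm_tendsto_zero.mpr (hdist.comp hφ.tendsto_atTop)
    have := hconv.sub h1
    simpa using this
  have hge : ∀ k, θ ≤ a (z k).1 - b (z k).2 := by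
    intro k
    have h0 : 0 ≤ ‖(z k).1 - (z k).2‖ ^ 2 / (2 * (1 / 2) ^ k) := by positivity
    have := hMθ k
    simp only [hM] at this
    linarith
  have hxint : xh ∈ interior B := by
    by_contra hno
    have hlt := hbd xh hxh hno
    set e := (θ - (a xh - b xh)) / 3 with he
    have hepos : 0 < e := by rw [he]; linarith
    have t1 : Tendsto (fun k => (z (φ k + 1)).1) atTop (𝓝[B] xh) :=
      tendsto_nhdsWithin_iff.mpr ⟨hconv, Eventually.of_forall fun k => (hzB _).1⟩
    have t2 : Tendsto (fun k => (z (φ k + 1)).2) atTop (𝓝[B] xh) :=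
      tendsto_nhdsWithin_iff.mpr ⟨hconvy, Eventually.of_forall fun k => (hzB _).2⟩
    obtain ⟨k, hk1, hk2⟩ := ((t1.eventually (ha xh hxh (a xh + e) (by linarith))).and
      (t2.eventually (hb xh hxh (b xh - e) (by linarith)))).exists
    have := hge (φ k + 1)
    have e3 : θ = 3 * e + (a xh - b xh) := by rw [he]; ring
    linarith
  have hI : interior B ∈ 𝓝 xh := isOpen_interior.mem_nhds hxint
  obtain ⟨k, h1, h2, h3, h4⟩ := ((hconv.eventually hI).and ((hconvy.eventually hI).and
    (((hdist.comp hφ.tendsto_atTop).eventually (gt_mem_nhds hδ)).and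
      ((hpen.comp hφ.tendsto_atTop).eventually (gt_mem_nhds hδ))))).exists
  exact ⟨(1 / 2) ^ (φ k + 1), by positivity, _, h1, _, h2, hzmax _, h3, h4, hge _⟩

namespace Dat
variable (D : Dat n)

set_option maxHeartbeats 1600000 in
/-- Doubling combined with the theorem on sums and the structure condition. -/
theorem doubling_sums (a b : En n → ℝ) (B : Set (En n)) (hB : IsCompact B)
    (ha : UpperSemicontinuousOn a B) (hb : LowerSemicontinuousOn b B) (θ : ℝ)
    (z0 : En n) (hz0 : z0 ∈ B) (hz0θ : a z0 - b z0 = θ)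
    (hbd : ∀ x ∈ B, x ∉ interior B → a x - b x < θ) (δ : ℝ) (hδ : 0 < δ) :
    ∃ x ∈ B, ∃ y ∈ B, ∃ (p q : En n) (X Y : Mn n), X.IsSymm ∧ Y.IsSymm ∧ ‖x - y‖ < δ ∧ ‖p - q‖ < δ ∧
      θ - δ < a x - b y ∧ D.F x X ≤ D.F y Y + δ ∧
      (∀ η > 0, ∀ᶠ z in 𝓝 x, a z ≤ a x + ⟪p, z - x⟫ + 1 / 2 * qf X (z - x) + η * ‖z - x‖ ^ 2) ∧
      (∀ η > 0, ∀ᶠ z in 𝓝 y, b y + ⟪q, z - y⟫ + 1 / 2 * qf Y (z - y) - η * ‖z - y‖ ^ 2 ≤ b z) := by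
  obtain ⟨R, hR, hBR⟩ : ∃ R > 0, ∀ x ∈ B, ‖x‖ < R := by
    obtain ⟨R, hR⟩ := hB.isBounded.exists_norm_le
    exact ⟨max R 0 + 1, by positivity, fun x hx => by linarith [hR x hx, le_max_left R 0]⟩
  have hL : 0 < D.Lam * n := mul_pos D.hLam D.hnpos
  obtain ⟨ωR, hωR, hstr⟩ := D.F_struct R hR
  obtain ⟨τ, hτ, hωτ⟩ := mod_tendsto hωR (δ / 2) (by positivity)
  set δ0 := min (δ / 4) (τ / 8) with hδ0
  have hdzpos : 0 < δ0 := by positivity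
  obtain ⟨ε, hε, xb, hxb, yb, hyb, hmax, hd, hpen, hge⟩ := doubling a b B hB ha hb θ z0 hz0 hz0θ hbd δ0 hdzpos
  obtain ⟨rx, hrx, hrxB⟩ := Metric.isOpen_iff.mp isOpen_interior xb hxb
  obtain ⟨ry, hry, hryB⟩ := Metric.isOpen_iff.mp isOpen_interior yb hyb
  -- small parameters
  set δ1 := min (1 / ε) (δ / (4 * (D.Lam * n))) with hδ1
  have hdopos : 0 < δ1 := by positivity
  set δ2 := min (min (min rx ry) δ1) (min (min 1 (δ / 4)) (min (τ / 16) (τ * ε / 64))) with hδ2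
  have hdtpos : 0 < δ2 := by positivity
  have l1 : δ2 ≤ rx := (min_le_left _ _).trans ((min_le_left _ _).trans (min_le_left _ _))
  have l2 : δ2 ≤ ry := (min_le_left _ _).trans ((min_le_left _ _).trans (min_le_right _ _))
  have l3 : δ2 ≤ δ1 := (min_le_left _ _).trans (min_le_right _ _)
  have l4 : δ2 ≤ 1 := (min_le_right _ _).trans ((min_le_left _ _).trans (min_le_left _ _))
  have l5 : δ2 ≤ δ / 4 := (min_le_right _ _).trans ((min_le_left _ _).trans (min_le_right _ _))
  have l6 : δ2 ≤ τ / 16 := (min_le_right _ _).trans ((min_le_right _ _).trans (min_le_left _ _))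
  have l7 : δ2 ≤ τ * ε / 64 := (min_le_right _ _).trans ((min_le_right _ _).trans (min_le_right _ _))
  have m1 : δ0 ≤ δ / 4 := min_le_left _ _
  have m2 : δ0 ≤ τ / 8 := min_le_right _ _
  have k1 : δ1 ≤ 1 / ε := min_le_left _ _
  have k2 : D.Lam * n * δ1 ≤ δ / 4 := by
    have : δ1 ≤ δ / (4 * (D.Lam * n)) := min_le_right _ _
    calc D.Lam * n * δ1 ≤ D.Lam * n * (δ / (4 * (D.Lam * n))) := by gcongr
      _ = δ / 4 := by field_simp; exact div_self hL.ne'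
  obtain ⟨x, y, p, q, S, T, hx, hy, hux, hvy, hp, hq, hup, hlo, hlo', hj1, hj2⟩ :=
    sums_aux a b B hB ha hb ε hε xb yb hxb hyb hmax δ2 hdtpos
  obtain ⟨X, hX, hXS⟩ := exists_matrix S
  obtain ⟨Y, hY, hYT⟩ := exists_matrix T
  have hxB : x ∈ B := interior_subset (hrxB (by rw [Metric.mem_ball, dist_eq_norm]; linarith))
  have hyB : y ∈ B := interior_subset (hryB (by rw [Metric.mem_ball, dist_eq_norm]; linarith))
  have hxy : ‖x - y‖ ≤ ‖xb - yb‖ + 2 * δ2 := by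
    have e : x - y = (xb - yb) + (x - xb) - (y - yb) := by abel
    rw [e]
    have := norm_sub_le ((xb - yb) + (x - xb)) (y - yb)
    have := norm_add_le (xb - yb) (x - xb)
    linarith
  refine ⟨x, hxB, y, hyB, p, q, X, Y, hX, hY, by linarith, ?_, ?_, ?_, ?_, ?_⟩
  · have e : p - q = (p - ε⁻¹ • (xb - yb)) - (q - ε⁻¹ • (xb - yb)) := by abel
    rw [e]
    have := norm_sub_le (p - ε⁻¹ • (xb - yb)) (q - ε⁻¹ • (xb - yb))
    linarith
  · have h1 := abs_lt.mp hux
    have h2 := abs_lt.mp hvy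
    linarith [h1.1, h2.2]
  · have hs1 : (δ1 • (1 : Mn n)).IsSymm := symm_smul _ symm_one
    have hF := hstr (3 * ε / 4) (by positivity) x y (X - δ1 • 1) (Y + δ1 • 1) (hBR x hxB) (hBR y hyB)
      (symm_sub hX hs1) (symm_add hY hs1) ?_ ?_
    · have e1 := D.F_le x X (X - δ1 • 1) hX (symm_sub hX hs1) δ1 hdopos.le
        (fun v => by rw [qf_sub, qf_smul, qf_one]; linarith)
      have e2 := D.F_le y (Y + δ1 • 1) Y (symm_add hY hs1) hY δ1 hdopos.le
        (fun v => by rw [qf_add, qf_smul, qf_one])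
      have e3 : ωR (‖x - y‖ + (3 * ε / 4)⁻¹ * ‖x - y‖ ^ 2) < δ / 2 := by
        apply hωτ _ (by positivity)
        have s1 : ‖x - y‖ ^ 2 ≤ 2 * ‖xb - yb‖ ^ 2 + 8 * δ2 ^ 2 := by
          have : ‖x - y‖ ^ 2 ≤ (‖xb - yb‖ + 2 * δ2) ^ 2 := by gcongr
          nlinarith [sq_nonneg (‖xb - yb‖ - 2 * δ2)]
        have s2 : ‖xb - yb‖ ^ 2 < δ0 * ε := by rwa [div_lt_iff₀ hε] at hpen
        have s3 : δ2 ^ 2 ≤ τ * ε / 64 := by nlinarith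
        have s4 : ‖x - y‖ ^ 2 ≤ (τ * 3 / 8) * ε := by nlinarith
        have s5 : (3 * ε / 4)⁻¹ * ‖x - y‖ ^ 2 ≤ τ / 2 := by
          rw [inv_mul_le_iff₀ (by positivity)]; linarith
        linarith
      linarith
    · intro h k
      have h1 := hlo h
      have h2 := hlo' k
      rw [← hXS] at h1
      rw [← hYT] at h2
      rw [qf_sub, qf_add, qf_smul, qf_smul, qf_one, qf_one]
      have e : 3 / (3 * ε / 4) = 3 / ε + 1 / ε := by field_simp; norm_num
      rw [e]
      have t1 : δ1 * ‖h‖ ^ 2 ≤ 1 / ε * ‖h‖ ^ 2 := by gcongr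
      have t2 : δ1 * ‖k‖ ^ 2 ≤ 1 / ε * ‖k‖ ^ 2 := by gcongr
      linarith
    · intro h k
      have h1 := hup h k
      rw [← hXS, ← hYT] at h1
      rw [qf_sub, qf_add, qf_smul, qf_smul, qf_one, qf_one]
      have e : 3 / (3 * ε / 4) = 3 / ε + 1 / ε := by field_simp; norm_num
      rw [e]
      have t1 : δ2 * (‖h‖ ^ 2 + ‖k‖ ^ 2) ≤ δ1 * (‖h‖ ^ 2 + ‖k‖ ^ 2) := by gcongr
      have t2 : 0 ≤ 1 / ε * ‖h - k‖ ^ 2 := by positivity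
      linarith
  · intro η hη
    have : Tendsto (fun z => z - x) (𝓝 x) (𝓝 0) := by
      have : Continuous (fun z : En n => z - x) := by fun_prop
      simpa using this.tendsto x
    filter_upwards [this.eventually (hj1 η hη)] with z hz
    rw [hXS]; simpa using hz
  · intro η hη
    have : Tendsto (fun z => z - y) (𝓝 y) (𝓝 0) := by
      have : Continuous (fun z : En n => z - y) := by fun_prop
      simpa using this.tendsto y
    filter_upwards [this.eventually (hj2 η hη)] with z hz
    rw [hYT]; simpa using hz

end Dat
end PF

section PG
open Set Filter Topology
open scoped RealInnerProductSpace
variable {n : ℕ}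

lemma inv_pow_quad (N : ℕ) : ∃ K : ℝ, 0 ≤ K ∧ ∀ z : ℝ, 1 / 2 ≤ z →
    (z⁻¹) ^ N ≤ 1 - N * (z - 1) + K * (z - 1) ^ 2 := by
  induction N with
  | zero => exact ⟨0, le_rfl, fun z hz => by simp⟩
  | succ N ih =>
    obtain ⟨K, hK, h⟩ := ih
    refine ⟨2 * (K + N + 1), by positivity, fun z hz => ?_⟩
    have hz0 : 0 < z := by linarith
    have h1 := h z hz
    set t := z⁻¹ with ht
    have htz : t * z = 1 := inv_mul_cancel₀ hz0.ne'
    have ht0 : 0 < t := inv_pos.mpr hz0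
    have ht2 : t ≤ 2 := by nlinarith
    have e1 : t = 1 - (z - 1) + t * (z - 1) ^ 2 := by linear_combination (-z+2) * htz
    have e2 : t * (z - 1) = (z - 1) - t * (z - 1) ^ 2 := by linear_combination (z - 1) * htz
    rw [pow_succ]
    have h2 : t ^ N * t ≤ (1 - N * (z - 1) + K * (z - 1) ^ 2) * t := by gcongr
    have e3 : (1 - N * (z - 1) + K * (z - 1) ^ 2) * t =
        1 - (N + 1) * (z - 1) + t * ((K + N + 1) * (z - 1) ^ 2) := by
      linear_combination e1 - N * e2
    have h3 : t * ((K + N + 1) * (z - 1) ^ 2) ≤ 2 * ((K + N + 1) * (z - 1) ^ 2) := by gcongr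
    push_cast
    linarith

/-- The barrier. -/
def psi (N : ℕ) (R b : ℝ) (x : En n) : ℝ := b * ((1 - ‖x‖ ^ 2 / R ^ 2)⁻¹) ^ N

lemma psi_d {R : ℝ} {x : En n} (hx : ‖x‖ < R) : 0 < 1 - ‖x‖ ^ 2 / R ^ 2 ∧ 1 - ‖x‖ ^ 2 / R ^ 2 ≤ 1 := by
  have hR : 0 < R := (norm_nonneg x).trans_lt hx
  constructor
  · rw [sub_pos, div_lt_one (by positivity)]
    gcongr
  · have : 0 ≤ ‖x‖ ^ 2 / R ^ 2 := by positivity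
    linarith

lemma psi_W {R : ℝ} {x : En n} (hx : ‖x‖ < R) : 1 ≤ (1 - ‖x‖ ^ 2 / R ^ 2)⁻¹ :=
  (one_le_inv₀ (psi_d hx).1).mpr (psi_d hx).2

lemma psi_ge (N : ℕ) {R b : ℝ} (hb : 0 ≤ b) {x : En n} (hx : ‖x‖ < R) : b ≤ psi N R b x := by
  unfold psi
  have : 1 ≤ ((1 - ‖x‖ ^ 2 / R ^ 2)⁻¹) ^ N := one_le_pow₀ (psi_W hx)
  nlinarith

lemma psi_contAt (N : ℕ) {R b : ℝ} {x : En n} (hx : ‖x‖ < R) : ContinuousAt (psi N R b) x := by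
  unfold psi
  have h1 : ContinuousAt (fun x : En n => 1 - ‖x‖ ^ 2 / R ^ 2) x := by fun_prop
  have h2 : ContinuousAt (fun x : En n => (1 - ‖x‖ ^ 2 / R ^ 2)⁻¹) x := h1.inv₀ (psi_d hx).1.ne'
  exact continuousAt_const.mul (h2.pow N)

lemma psi_large {N : ℕ} (hN : 1 ≤ N) {R b : ℝ} (hR : 0 < R) (hb : 0 < b) (M : ℝ) :
    ∃ r, 0 < r ∧ r < R ∧ ∀ x : En n, r ≤ ‖x‖ → ‖x‖ < R → M < psi N R b x := by
  set T := max (M / b) 1 + 1 with hT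
  have hT1 : 1 < T := by have := le_max_right (M / b) 1; linarith
  refine ⟨R * √(1 - 1 / T), ?_, ?_, fun x hx1 hx2 => ?_⟩
  · have : 1 / T < 1 := by rw [div_lt_one (by linarith)]; exact hT1
    have : 0 < √(1 - 1 / T) := Real.sqrt_pos.mpr (by linarith)
    positivity
  · have : 0 < 1 / T := by positivity
    have : √(1 - 1 / T) < 1 := by rw [Real.sqrt_lt' one_pos]; linarith
    nlinarith
  · have hd := psi_d hx2
    have h1 : 1 / T < 1 := by rw [div_lt_one (by linarith)]; exact hT1
    have h2 : R ^ 2 * (1 - 1 / T) ≤ ‖x‖ ^ 2 := by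
      have : (R * √(1 - 1 / T)) ^ 2 ≤ ‖x‖ ^ 2 := by gcongr
      rwa [mul_pow, Real.sq_sqrt (by linarith)] at this
    have h3 : 1 - 1 / T ≤ ‖x‖ ^ 2 / R ^ 2 := by
      rw [le_div_iff₀ (by positivity)]; linarith
    have h4 : T ≤ (1 - ‖x‖ ^ 2 / R ^ 2)⁻¹ := by
      rw [le_inv_comm₀ (by linarith) hd.1]
      rw [one_div] at h3; linarith
    have h5 : (1 - ‖x‖ ^ 2 / R ^ 2)⁻¹ ≤ ((1 - ‖x‖ ^ 2 / R ^ 2)⁻¹) ^ N :=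
      le_self_pow₀ (psi_W hx2) (by omega)
    unfold psi
    have h6 : M / b < T := by have := le_max_left (M / b) 1; linarith
    rw [div_lt_iff₀ hb] at h6
    have : T * b ≤ ((1 - ‖x‖ ^ 2 / R ^ 2)⁻¹) ^ N * b := by gcongr; linarith
    linarith

lemma psi_jet (N : ℕ) : ∃ C : ℝ, 0 < C ∧ ∀ R b : ℝ, 0 < b → ∀ x0 : En n, ‖x0‖ < R →
    ∃ P : En n, ‖P‖ ≤ C * (b / R) * ((1 - ‖x0‖ ^ 2 / R ^ 2)⁻¹) ^ (N + 1) ∧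
      ∀ᶠ x in 𝓝 x0, psi N R b x ≤ psi N R b x0 + ⟪P, x - x0⟫ +
        1 / 2 * (C * (b / R ^ 2) * ((1 - ‖x0‖ ^ 2 / R ^ 2)⁻¹) ^ (N + 2)) * ‖x - x0‖ ^ 2 := by
  obtain ⟨K, hK, hq⟩ := inv_pow_quad N
  refine ⟨2 * N + 18 * K + 1, by positivity, fun R b hb x0 hx0 => ?_⟩
  have hR : 0 < R := (norm_nonneg x0).trans_lt hx0
  obtain ⟨hd0, hd1⟩ := psi_d hx0
  set d0 := 1 - ‖x0‖ ^ 2 / R ^ 2 with hd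
  set W := d0⁻¹ with hW
  have hW1 : 1 ≤ W := psi_W hx0
  have hW0 : 0 < W := by linarith
  refine ⟨(2 * b * N * W ^ (N + 1) / R ^ 2) • x0, ?_, ?_⟩
  · rw [norm_smul, Real.norm_of_nonneg (by positivity)]
    calc 2 * b * N * W ^ (N + 1) / R ^ 2 * ‖x0‖ ≤ 2 * b * N * W ^ (N + 1) / R ^ 2 * R := by gcongr
      _ = (2 * N) * (b / R) * W ^ (N + 1) := by field_simp
      _ ≤ _ := by gcongr; linarith
  · have hc : ContinuousAt (fun x : En n => (1 - ‖x‖ ^ 2 / R ^ 2) / d0) x0 := by fun_prop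
    have hc1 : Tendsto (fun x : En n => (1 - ‖x‖ ^ 2 / R ^ 2) / d0) (𝓝 x0) (𝓝 1) := by
      have := hc.tendsto
      rwa [← hd, div_self hd0.ne'] at this
    filter_upwards [hc1.eventually (lt_mem_nhds (show (1 / 2 : ℝ) < 1 by norm_num)),
      Metric.ball_mem_nhds x0 hR] with x hx hxb
    rw [Metric.mem_ball, dist_eq_norm] at hxb
    set h := x - x0 with hh
    have hxe : x = x0 + h := by rw [hh]; abel
    have hns : ‖x‖ ^ 2 = ‖x0‖ ^ 2 + (2 * ⟪x0, h⟫ + ‖h‖ ^ 2) := by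
      rw [hxe, norm_add_sq_real]; ring
    set l := 2 * ⟪x0, h⟫ + ‖h‖ ^ 2 with hl
    have hl2 : l ^ 2 ≤ 9 * R ^ 2 * ‖h‖ ^ 2 := by
      have h1 : |l| ≤ 3 * R * ‖h‖ := by
        have := abs_real_inner_le_norm x0 h
        have h2 : |l| ≤ 2 * |⟪x0, h⟫| + ‖h‖ ^ 2 := by
          rw [hl]
          refine (abs_add_le _ _).trans (le_of_eq ?_)
          rw [abs_mul, abs_of_nonneg (sq_nonneg ‖h‖)]; norm_num
        have h3 : ‖x0‖ * ‖h‖ ≤ R * ‖h‖ := by gcongr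
        nlinarith [norm_nonneg h]
      calc l ^ 2 = |l| ^ 2 := (sq_abs l).symm
        _ ≤ (3 * R * ‖h‖) ^ 2 := by gcongr
        _ = _ := by ring
    have hz := hq _ hx.le
    set z := (1 - ‖x‖ ^ 2 / R ^ 2) / d0 with hzdef
    have hz1 : z - 1 = - (l / R ^ 2 * W) := by
      have e5 : 1 - ‖x‖ ^ 2 / R ^ 2 = d0 - l / R ^ 2 := by rw [hns, hd]; ring
      rw [hzdef, e5, hW, sub_div, div_self hd0.ne', div_eq_mul_inv _ d0]; ring
    have e1 : psi N R b x = b * W ^ N * (z⁻¹) ^ N := by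
      unfold psi
      rw [mul_assoc, ← mul_pow]
      congr 2
      rw [hzdef, hW, inv_div]; field_simp
    have e0 : psi N R b x0 = b * W ^ N := by unfold psi; rw [← hd]
    rw [e1, e0]
    rw [hz1] at hz
    have h1 : b * W ^ N * z⁻¹ ^ N ≤ b * W ^ N * (1 - N * (-(l / R ^ 2 * W)) + K * (-(l / R ^ 2 * W)) ^ 2) := by
      gcongr
    refine h1.trans ?_
    rw [real_inner_smul_left]
    have e2 : b * W ^ N * (1 - N * (-(l / R ^ 2 * W)) + K * (-(l / R ^ 2 * W)) ^ 2) =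
        b * W ^ N + 2 * b * N * W ^ (N + 1) / R ^ 2 * ⟪x0, h⟫ + b * N * W ^ (N + 1) / R ^ 2 * ‖h‖ ^ 2
          + b * W ^ (N + 2) * K / R ^ 4 * l ^ 2 := by
      rw [hl]; field_simp; ring
    rw [e2]
    have h2 : b * W ^ (N + 2) * K / R ^ 4 * l ^ 2 ≤ b * W ^ (N + 2) * K / R ^ 4 * (9 * R ^ 2 * ‖h‖ ^ 2) := by
      gcongr
    have e3 : b * W ^ (N + 2) * K / R ^ 4 * (9 * R ^ 2 * ‖h‖ ^ 2) = 9 * K * (b / R ^ 2) * W ^ (N + 2) * ‖h‖ ^ 2 := by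
      field_simp
    have h3 : b * N * W ^ (N + 1) / R ^ 2 * ‖h‖ ^ 2 ≤ N * (b / R ^ 2) * W ^ (N + 2) * ‖h‖ ^ 2 := by
      have : W ^ (N + 1) ≤ W ^ (N + 2) := pow_le_pow_right₀ hW1 (by omega)
      calc b * N * W ^ (N + 1) / R ^ 2 * ‖h‖ ^ 2 = N * (b / R ^ 2) * W ^ (N + 1) * ‖h‖ ^ 2 := by ring
        _ ≤ _ := by gcongr
    have h4 : 0 ≤ (b / R ^ 2) * W ^ (N + 2) * ‖h‖ ^ 2 := by positivity
    linarith

namespace Dat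
variable (D : Dat n)

/-- The barrier inequality. -/
theorem barrier : ∃ N : ℕ, 1 ≤ N ∧ ∃ C : ℝ, 0 < C ∧ ∀ R b k E κ : ℝ, 1 ≤ R → 0 < b → 0 ≤ k → 0 ≤ E →
    C * (b / R) + k * C * (b / R) ^ D.m + E ≤ κ * b ^ D.s →
    ∀ x0 : En n, ‖x0‖ < R → ∃ (P : En n) (c : ℝ), 0 ≤ c ∧
      (∀ᶠ x in 𝓝 x0, psi N R b x ≤ psi N R b x0 + ⟪P, x - x0⟫ + 1 / 2 * c * ‖x - x0‖ ^ 2) ∧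
      D.Lam * n * c + D.γ₁ * ‖P‖ + k * ‖P‖ ^ D.m + E ≤ κ * (psi N R b x0) ^ D.s := by
  have hs1 := D.hs1
  have hm0 := D.hm0
  obtain ⟨N, hN⟩ := exists_nat_ge (max 1 (max (2 / (D.s - 1)) (D.m / (D.s - D.m))))
  have hN1 : (1 : ℝ) ≤ N := (le_max_left _ _).trans hN
  have hN2 : (N : ℝ) + 2 ≤ N * D.s := by
    have : 2 / (D.s - 1) ≤ N := (le_max_left _ _).trans ((le_max_right _ _).trans hN)
    rw [div_le_iff₀ (by linarith)] at this
    linarith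
  have hN3 : D.m * ((N : ℝ) + 1) ≤ N * D.s := by
    have : D.m / (D.s - D.m) ≤ N := (le_max_right _ _).trans ((le_max_right _ _).trans hN)
    rw [div_le_iff₀ (by linarith [D.hsm])] at this
    linarith
  obtain ⟨C1, hC1, hj⟩ := psi_jet (n := n) N
  have hLn : 0 < D.Lam * n := mul_pos D.hLam D.hnpos
  have hg := D.hγ₁
  refine ⟨N, by exact_mod_cast hN1, D.Lam * n * C1 + D.γ₁ * C1 + C1 ^ D.m, by positivity, ?_⟩
  intro R b k E κ hR hb hk hE hyp x0 hx0
  obtain ⟨P, hP, hjet⟩ := hj R b hb x0 hx0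
  have hR0 : 0 < R := by linarith
  set W := (1 - ‖x0‖ ^ 2 / R ^ 2)⁻¹ with hW
  have hW1 : 1 ≤ W := psi_W hx0
  have hW0 : 0 < W := by linarith
  refine ⟨P, _, ?_, hjet, ?_⟩
  · positivity
  have hψ : psi N R b x0 ^ D.s = b ^ D.s * W ^ (N * D.s) := by
    unfold psi
    rw [← hW, Real.mul_rpow hb.le (by positivity), ← Real.rpow_natCast, ← Real.rpow_mul hW0.le]
  set Z := W ^ (N * D.s) with hZ
  have hZ1 : 1 ≤ Z := Real.one_le_rpow hW1 (by nlinarith)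
  have w2 : W ^ (N + 2) ≤ Z := by
    rw [← Real.rpow_natCast]
    apply Real.rpow_le_rpow_of_exponent_le hW1
    push_cast; exact hN2
  have w1 : W ^ (N + 1) ≤ Z := (pow_le_pow_right₀ hW1 (by omega)).trans w2
  have wm : (W ^ (N + 1)) ^ D.m ≤ Z := by
    rw [← Real.rpow_natCast, ← Real.rpow_mul hW0.le]
    apply Real.rpow_le_rpow_of_exponent_le hW1
    push_cast; linarith
  have hbR : 0 < b / R := by positivity
  have hbR2 : b / R ^ 2 ≤ b / R := by
    gcongr
    nlinarith
  have t1 : D.Lam * n * (C1 * (b / R ^ 2) * W ^ (N + 2)) ≤ D.Lam * n * (C1 * (b / R) * Z) := by gcongr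
  have t2 : D.γ₁ * ‖P‖ ≤ D.γ₁ * (C1 * (b / R) * Z) := by
    gcongr
    exact hP.trans (by gcongr)
  have t3 : ‖P‖ ^ D.m ≤ C1 ^ D.m * (b / R) ^ D.m * Z := by
    calc ‖P‖ ^ D.m ≤ (C1 * (b / R) * W ^ (N + 1)) ^ D.m := by gcongr
      _ = C1 ^ D.m * (b / R) ^ D.m * (W ^ (N + 1)) ^ D.m := by
        rw [Real.mul_rpow (by positivity) (by positivity), Real.mul_rpow (by positivity) (by positivity)]
      _ ≤ _ := by gcongr
  have t3' : k * ‖P‖ ^ D.m ≤ k * (C1 ^ D.m * (b / R) ^ D.m * Z) := by gcongr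
  have t4 : E ≤ E * Z := by nlinarith
  rw [hψ]
  have t5 := mul_le_mul_of_nonneg_right hyp (show 0 ≤ Z by linarith)
  have t6 : 0 ≤ C1 ^ D.m * (b / R) * Z := by positivity
  have t7 : 0 ≤ k * (D.Lam * n * C1 + D.γ₁ * C1) * (b / R) ^ D.m * Z := by positivity
  linarith

end Dat
end PG

section PH
open Set Filter Topology
open scoped RealInnerProductSpace
variable {n : ℕ}

lemma rpow_add_le_two {a b p : ℝ} (ha : 0 ≤ a) (hb : 0 ≤ b) (hp : 0 ≤ p) :
    (a + b) ^ p ≤ 2 ^ p * (a ^ p + b ^ p) := by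
  have h1 : 0 ≤ a ^ p := by positivity
  have h2 : 0 ≤ b ^ p := by positivity
  rcases le_total a b with h | h
  · calc (a + b) ^ p ≤ (2 * b) ^ p := by gcongr; linarith
      _ = 2 ^ p * b ^ p := Real.mul_rpow (by norm_num) hb
      _ ≤ _ := by gcongr; linarith
  · calc (a + b) ^ p ≤ (2 * a) ^ p := by gcongr; linarith
      _ = 2 ^ p * a ^ p := Real.mul_rpow (by norm_num) ha
      _ ≤ _ := by gcongr; linarith

lemma rpow_split {a p : ℝ} (ha : 0 ≤ a) (hp : 1 < p) : a ^ (p - 1) * a = a ^ p := by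
  rcases ha.eq_or_lt with rfl | h0
  · rw [mul_zero, Real.zero_rpow (by linarith)]
  · nth_rewrite 2 [← Real.rpow_one a]
    rw [← Real.rpow_add h0]; congr 1; ring

lemma young_aux {a b m η : ℝ} (ha : 0 ≤ a) (hb : 0 ≤ b) (hm : 1 < m) (hη : 0 < η) :
    a ^ (m - 1) * b ≤ η * a ^ m + η ^ (1 - m) * b ^ m := by
  have h1 : 0 ≤ η * a ^ m := by positivity
  have h2 : 0 ≤ η ^ (1 - m) * b ^ m := by positivity
  rcases le_total b (η * a) with h | h
  · have : a ^ (m - 1) * b ≤ a ^ (m - 1) * (η * a) := by gcongr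
    have e : a ^ (m - 1) * (η * a) = η * a ^ m := by rw [← rpow_split ha hm]; ring
    linarith
  · have h3 : a ≤ b / η := by rw [le_div_iff₀ hη]; linarith
    have h4 : a ^ (m - 1) ≤ (b / η) ^ (m - 1) := by
      apply Real.rpow_le_rpow ha h3; linarith
    have h5 : a ^ (m - 1) * b ≤ (b / η) ^ (m - 1) * b := by gcongr
    have e : (b / η) ^ (m - 1) * b = η ^ (1 - m) * b ^ m := by
      rw [Real.div_rpow hb hη.le, ← rpow_split hb hm, show 1 - m = -(m - 1) by ring,
        Real.rpow_neg hη.le, div_eq_mul_inv]; ring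
    linarith

lemma contact {w : En n → ℝ} (hw : UpperSemicontinuous w) {N : ℕ} (hN : 1 ≤ N) {R b : ℝ}
    (hb : 0 < b) (x1 : En n) (hx1 : ‖x1‖ < R) :
    ∃ r, 0 < r ∧ r < R ∧ ∃ x0 : En n, ‖x0‖ < r ∧
      (∀ x, ‖x‖ ≤ r → w x - psi N R b x ≤ w x0 - psi N R b x0) ∧
      (∀ x, ‖x‖ = r → w x - psi N R b x < w x0 - psi N R b x0) ∧
      w x1 - psi N R b x1 ≤ w x0 - psi N R b x0 := by
  have hR : 0 < R := (norm_nonneg x1).trans_lt hx1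
  obtain ⟨M, hM⟩ := (hw.upperSemicontinuousOn (Metric.closedBall (0 : En n) R)).bddAbove_of_isCompact
    (isCompact_closedBall _ _)
  obtain ⟨r, hr0, hrR, hr⟩ := psi_large (n := n) hN hR hb (M - (w x1 - psi N R b x1))
  have key : ∀ x : En n, r ≤ ‖x‖ → ‖x‖ < R → w x - psi N R b x < w x1 - psi N R b x1 := by
    intro x h1 h2
    have h3 := hr x h1 h2
    have h4 : w x ≤ M := hM ⟨x, by rw [mem_closedBall_zero_iff]; exact h2.le, rfl⟩
    linarith
  have hx1r : ‖x1‖ < r := by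
    by_contra h
    exact lt_irrefl _ (key x1 (not_lt.mp h) hx1)
  have hU : UpperSemicontinuousOn (fun x => w x + - psi N R b x) (Metric.closedBall (0 : En n) r) := by
    refine UpperSemicontinuousOn.add (hw.upperSemicontinuousOn _) (ContinuousOn.upperSemicontinuousOn ?_)
    intro x hx
    rw [mem_closedBall_zero_iff] at hx
    exact (psi_contAt N (hx.trans_lt hrR)).neg.continuousWithinAt
  obtain ⟨x0, hx0, hmax⟩ := hU.exists_isMaxOn ⟨x1, by rw [mem_closedBall_zero_iff]; exact hx1r.le⟩
    (isCompact_closedBall _ _)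
  rw [mem_closedBall_zero_iff] at hx0
  have hm : ∀ x, ‖x‖ ≤ r → w x - psi N R b x ≤ w x0 - psi N R b x0 := fun x hx => by
    have := hmax (show x ∈ Metric.closedBall (0 : En n) r by rwa [mem_closedBall_zero_iff])
    simp only [mem_ofPred_eq] at this
    linarith
  have h1 := hm x1 hx1r.le
  refine ⟨r, hr0, hrR, x0, ?_, hm, fun x hx => ?_, h1⟩
  · by_contra h
    have := key x0 (not_lt.mp h) (hx0.trans_lt hrR)
    linarith
  · have := key x hx.ge (hx.trans_lt hrR)
    linarith

namespace Dat
variable (D : Dat n)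

lemma f_lower : ∃ D0 : ℝ, 0 < D0 ∧ ∀ R, 1 ≤ R → ∀ x : En n, ‖x‖ ≤ R → - D.f x ≤ D0 * R ^ D.ρ := by
  obtain ⟨C, M, hCM⟩ := D.hflimsup
  obtain ⟨L, hL⟩ := (isCompact_closedBall (0 : En n) |M|).bddBelow_image D.hf.continuousOn
  refine ⟨|C| + |L| + 1, by positivity, fun R hR x hx => ?_⟩
  have hR1 : 1 ≤ R ^ D.ρ := Real.one_le_rpow hR D.hρ
  rcases le_total M ‖x‖ with h | h
  · have h1 := hCM x h
    have h2 : C * ‖x‖ ^ D.ρ ≤ |C| * R ^ D.ρ := by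
      have := D.hρ
      calc C * ‖x‖ ^ D.ρ ≤ |C| * ‖x‖ ^ D.ρ := by gcongr; exact le_abs_self C
        _ ≤ _ := by gcongr
    have h3 := le_max_left (-D.f x) 0
    have : 0 ≤ (|L| + 1) * R ^ D.ρ := by positivity
    linarith
  · have h1 : L ≤ D.f x := hL ⟨x, by rw [mem_closedBall_zero_iff]; exact h.trans (le_abs_self M), rfl⟩
    have h2 := neg_abs_le L
    have h3 : |L| ≤ |L| * R ^ D.ρ := le_mul_of_one_le_right (abs_nonneg L) hR1
    have : 0 ≤ (|C| + 1) * R ^ D.ρ := by positivity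
    linarith

theorem upper : ∃ D1 : ℝ, 0 < D1 ∧ ∀ u : En n → ℝ, UpperSemicontinuous u → (∀ x, D.SubAt u x) →
    ∀ R, 1 ≤ R → ∀ x : En n, ‖x‖ ≤ R → (max (u x) 0) ^ D.s ≤ D1 * R ^ D.ρ := by
  have hs1 := D.hs1
  have hs0 := D.hs0
  have hm0 := D.hm0
  have hρ := D.hρ
  have hγm := D.hγm
  obtain ⟨N, hN, C, hC, hbar⟩ := D.barrier
  obtain ⟨D0, hD0, hf⟩ := D.f_lower
  -- choose B
  obtain ⟨B, hB1, hB⟩ : ∃ B : ℝ, 1 ≤ B ∧ C * B + D.γm * C * B ^ D.m + D0 ≤ B ^ D.s := by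
    have hsm : 0 < D.s - D.m := sub_pos.mpr D.hsm
    set T := C + D.γm * C + D0 + 1 with hT
    have hT1 : 1 ≤ T := by
      have : 0 < D.γm * C := by positivity
      linarith
    refine ⟨T ^ (D.s - D.m)⁻¹, Real.one_le_rpow hT1 (by positivity), ?_⟩
    set B := T ^ (D.s - D.m)⁻¹ with hBd
    have hB1 : 1 ≤ B := Real.one_le_rpow hT1 (by positivity)
    have e1 : B ^ (D.s - D.m) = T := by
      rw [hBd, ← Real.rpow_mul (by linarith), inv_mul_cancel₀ hsm.ne', Real.rpow_one]
    have e2 : B ^ D.s = B ^ D.m * T := by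
      rw [← e1, ← Real.rpow_add (by linarith)]; congr 1; ring
    have h1 : B ≤ B ^ D.m := Real.self_le_rpow_of_one_le hB1 D.hm1.le
    have h2 : 1 ≤ B ^ D.m := hB1.trans h1
    rw [e2, hT]
    nlinarith
  set D1 := (B * 2 ^ (D.ρ / D.s) * (4 / 3) ^ N) ^ D.s with hD1
  refine ⟨D1, by positivity, fun u hu hsub R hR x1 hx1 => ?_⟩
  set R' := 2 * R with hR'
  have hR'1 : 1 ≤ R' := by linarith
  have hR'0 : 0 < R' := by linarith
  set b := B * R' ^ (D.ρ / D.s) with hb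
  have hb0 : 0 < b := by positivity
  have hbs : b ^ D.s = B ^ D.s * R' ^ D.ρ := by
    rw [hb, Real.mul_rpow (by linarith) (by positivity), ← Real.rpow_mul hR'0.le, div_mul_cancel₀ _ hs0.ne']
  have hcond : C * (b / R') + D.γm * C * (b / R') ^ D.m + D0 * R' ^ D.ρ ≤ 1 * b ^ D.s := by
    have hbR : b / R' ≤ B * R' ^ (D.ρ / D.s - 1) := by
      rw [hb, Real.rpow_sub_one hR'0.ne', mul_div_assoc]
    have hq : D.ρ / D.s ≤ D.ρ := div_le_self hρ hs1.le
    have a1 : R' ^ (D.ρ / D.s - 1) ≤ R' ^ D.ρ := Real.rpow_le_rpow_of_exponent_le hR'1 (by linarith)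
    have a2 : (R' ^ (D.ρ / D.s - 1)) ^ D.m ≤ R' ^ D.ρ := by
      rw [← Real.rpow_mul hR'0.le]
      apply Real.rpow_le_rpow_of_exponent_le hR'1
      have : D.ρ / D.s * D.m ≤ D.ρ := by
        rw [div_mul_eq_mul_div, div_le_iff₀ hs0]; nlinarith [D.hsm]
      nlinarith
    have a3 : b / R' ≤ B * R' ^ D.ρ := hbR.trans (by gcongr)
    have a4 : (b / R') ^ D.m ≤ B ^ D.m * R' ^ D.ρ := by
      calc (b / R') ^ D.m ≤ (B * R' ^ (D.ρ / D.s - 1)) ^ D.m := by gcongr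
        _ = B ^ D.m * (R' ^ (D.ρ / D.s - 1)) ^ D.m := Real.mul_rpow (by linarith) (by positivity)
        _ ≤ _ := by gcongr
    rw [hbs]
    have a5 : C * (b / R') ≤ C * (B * R' ^ D.ρ) := by gcongr
    have a6 : D.γm * C * (b / R') ^ D.m ≤ D.γm * C * (B ^ D.m * R' ^ D.ρ) := by gcongr
    have a7 := mul_le_mul_of_nonneg_right hB (show 0 ≤ R' ^ D.ρ by positivity)
    linarith
  have hx1' : ‖x1‖ < R' := by linarith
  have main : u x1 ≤ psi N R' b x1 := by
    by_contra hcon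
    obtain ⟨r, hr0, hrR, x0, hx0, hmax, -, hge⟩ := contact hu hN hb0 x1 hx1'
    have hx0R := hx0.trans hrR
    obtain ⟨P, c, hc, hjet, hineq⟩ := hbar R' b D.γm (D0 * R' ^ D.ρ) 1 hR'1 hb0 hγm.le (by positivity) hcond x0 hx0R
    have hpos : psi N R' b x0 < u x0 := by linarith [not_le.mp hcon]
    have hψ0 : 0 < psi N R' b x0 := hb0.trans_le (psi_ge N hb0.le hx0R)
    have hj := hsub x0 P (c • 1) (symm_smul _ symm_one) (by
      filter_upwards [hjet, (isOpen_lt continuous_norm continuous_const).mem_nhds hx0] with x h1 h2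
      have := hmax x (le_of_lt h2)
      rw [qf_smul, qf_one]
      linarith)
    have hF := D.F_le x0 (c • 1) 0 (symm_smul _ symm_one) (by unfold Matrix.IsSymm; simp) c hc
      (fun h => by rw [qf_smul, qf_one, qf_zero]; linarith)
    rw [D.hF0] at hF
    have hH := (abs_le.mp (D.H_abs_le x0 P)).2
    rw [D.g_of_nonneg (hψ0.trans hpos).le] at hj
    have hlt : psi N R' b x0 ^ D.s < u x0 ^ D.s := Real.rpow_lt_rpow hψ0.le hpos hs0
    have := hf R' hR'1 x0 hx0R.le
    linarith
  have hψ : psi N R' b x1 ≤ b * (4 / 3) ^ N := by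
    unfold psi
    have h1 : 3 / 4 ≤ 1 - ‖x1‖ ^ 2 / R' ^ 2 := by
      have : ‖x1‖ ^ 2 / R' ^ 2 ≤ 1 / 4 := by
        rw [div_le_iff₀ (by positivity), hR']
        have : ‖x1‖ ^ 2 ≤ R ^ 2 := by gcongr
        linarith
      linarith
    have h2 : (1 - ‖x1‖ ^ 2 / R' ^ 2)⁻¹ ≤ 4 / 3 := by
      rw [inv_le_comm₀ (by linarith) (by norm_num)]; norm_num; linarith
    have h3 : 0 ≤ (1 - ‖x1‖ ^ 2 / R' ^ 2)⁻¹ := inv_nonneg.mpr (by linarith)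
    gcongr
  have h1 : max (u x1) 0 ≤ b * (4 / 3) ^ N := max_le (main.trans hψ) (by positivity)
  calc (max (u x1) 0) ^ D.s ≤ (b * (4 / 3) ^ N) ^ D.s := by
        apply Real.rpow_le_rpow (le_max_right _ _) h1 hs0.le
    _ = D1 * R ^ D.ρ := by
      rw [Real.mul_rpow hb0.le (by positivity), hbs, hD1, hR', Real.mul_rpow (by norm_num) (by linarith),
        Real.mul_rpow (by positivity) (by positivity), Real.mul_rpow (by positivity) (by positivity),
        ← Real.rpow_mul (by norm_num), div_mul_cancel₀ _ hs0.ne']; ring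

end Dat
end PH

section PI
open Set Filter Topology
open scoped RealInnerProductSpace
variable {n : ℕ}
namespace Dat
variable (D : Dat n)

lemma g_diff {u w : ℝ} (h : w ≤ u) : (1 / 2 ^ D.s) * (u - w) ^ D.s ≤ D.g u - D.g w := by
  have hs0 := D.hs0
  have hs1 := D.hs1
  have h2 : (1 : ℝ) ≤ 2 ^ D.s := Real.one_le_rpow (by norm_num) hs0.le
  have h3 : (1 : ℝ) / 2 ^ D.s ≤ 1 := by rw [div_le_one (by positivity)]; exact h2
  have gm : ∀ t : ℝ, t ≤ 0 → D.g t = - (-t) ^ D.s := by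
    intro t ht
    have := D.g_neg (-t)
    rw [neg_neg] at this
    rw [this, D.g_of_nonneg (by linarith)]
  have hA : ∀ a b : ℝ, 0 ≤ b → b ≤ a → (1 / 2 ^ D.s) * (a - b) ^ D.s ≤ a ^ D.s - b ^ D.s := by
    intro a b hb hab
    have h4 := Real.add_rpow_le_rpow_add (p := D.s) (sub_nonneg.mpr hab) hb hs1.le
    rw [sub_add_cancel] at h4
    have h5 : 0 ≤ (a - b) ^ D.s := Real.rpow_nonneg (sub_nonneg.mpr hab) _
    nlinarith
  rcases le_total 0 w with hw | hw
  · rw [D.g_of_nonneg hw, D.g_of_nonneg (hw.trans h)]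
    exact hA u w hw h
  · rcases le_total 0 u with hu | hu
    · rw [D.g_of_nonneg hu, gm w hw]
      have := rpow_add_le_two hu (neg_nonneg.mpr hw) hs0.le
      rw [← sub_eq_add_neg] at this
      rw [div_mul_eq_mul_div, div_le_iff₀ (by positivity)]
      linarith
    · rw [gm u hu, gm w hw]
      have := hA (-w) (-u) (by linarith) (by linarith)
      have e : -w - -u = u - w := by ring
      rw [e] at this
      linarith

lemma g_scale {σ : ℝ} (hσ : 0 < σ) (v : ℝ) : σ * D.g v = σ ^ (1 - D.s) * D.g (σ * v) := by
  unfold g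
  rw [abs_mul, abs_of_pos hσ, Real.mul_rpow hσ.le (abs_nonneg v)]
  have e : σ ^ (1 - D.s) * σ ^ (D.s - 1) = 1 := by
    rw [← Real.rpow_add hσ]; simp
  linear_combination (-(σ * (|v| ^ (D.s - 1) * v))) * e

lemma sigma_pow {ε : ℝ} (h0 : 0 < ε) (h1 : D.s * ε ≤ 1 / 2) :
    1 ≤ (1 - ε) ^ (1 - D.s) ∧ (1 - ε) ^ (1 - D.s) ≤ 1 + 2 * D.s * ε := by
  have hs0 := D.hs0
  have hs1 := D.hs1
  have hε : ε ≤ 1 / 2 := by nlinarith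
  have hσ : 0 < 1 - ε := by linarith
  constructor
  · apply Real.one_le_rpow_of_pos_of_le_one_of_nonpos hσ (by linarith) (by linarith)
  · have h2 := one_add_mul_self_le_rpow_one_add (s := -ε) (by linarith) hs1.le
    have e1 : (1 : ℝ) + -ε = 1 - ε := by ring
    rw [e1] at h2
    have h3 : 0 < 1 - D.s * ε := by linarith
    have e2 : (1 - ε) ^ (1 - D.s) = (1 - ε) / (1 - ε) ^ D.s := by rw [Real.rpow_sub hσ, Real.rpow_one]
    rw [e2, div_le_iff₀ (by positivity)]
    have h4 : (1 + 2 * D.s * ε) * (1 - D.s * ε) ≤ (1 + 2 * D.s * ε) * (1 - ε) ^ D.s := by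
      gcongr; linarith
    have h5 : 0 ≤ D.s * ε := by positivity
    nlinarith

lemma H_est {ε μ : ℝ} (hε : 0 < ε) (hε1 : ε < 1 - D.σ₀) (hμ : μ ≤ ε * D.cbar / 2) (x y q Q : En n)
    (hxy : D.ω ‖x - y‖ ≤ μ) :
    D.H x (q + Q) - (1 - ε) * D.H y ((1 - ε)⁻¹ • q) ≤
      μ + D.γ₁ * ‖Q‖ + (D.γm + D.γm * (ε * D.cbar / (2 * D.γm)) ^ (1 - D.m)) * ‖Q‖ ^ D.m + ε * D.A := by
  have h1 := (abs_le.mp (D.hHstruct x y q Q)).2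
  have h2 := D.hHconv y q (1 - ε) ⟨by linarith, by linarith⟩
  have hγ := D.hγm
  have hc := D.hcbar
  have h3 := young_aux (norm_nonneg q) (norm_nonneg Q) D.hm1 (η := ε * D.cbar / (2 * D.γm)) (by positivity)
  have h4 : D.ω ‖x - y‖ * (‖q‖ ^ D.m + 1) ≤ μ * (‖q‖ ^ D.m + 1) := by gcongr
  have h5 : μ * ‖q‖ ^ D.m ≤ ε * D.cbar / 2 * ‖q‖ ^ D.m := by gcongr
  have h6 := rpow_split (norm_nonneg Q) D.hm1
  have h7 := mul_le_mul_of_nonneg_left h3 hγ.le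
  have e1 : D.γm * (ε * D.cbar / (2 * D.γm) * ‖q‖ ^ D.m + (ε * D.cbar / (2 * D.γm)) ^ (1 - D.m) * ‖Q‖ ^ D.m)
      = ε * D.cbar / 2 * ‖q‖ ^ D.m + D.γm * (ε * D.cbar / (2 * D.γm)) ^ (1 - D.m) * ‖Q‖ ^ D.m := by
    field_simp
  rw [e1] at h7
  have e2 : (1 - (1 - ε)) * (-D.cbar * ‖q‖ ^ D.m + D.A) = - (ε * D.cbar * ‖q‖ ^ D.m) + ε * D.A := by ring
  rw [e2] at h2
  have e3 : (D.γ₁ + D.γm * (‖q‖ ^ (D.m - 1) + ‖Q‖ ^ (D.m - 1))) * ‖Q‖ =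
      D.γ₁ * ‖Q‖ + D.γm * (‖q‖ ^ (D.m - 1) * ‖Q‖) + D.γm * ‖Q‖ ^ D.m := by rw [← h6]; ring
  rw [e3] at h1
  linarith

set_option maxHeartbeats 1600000 in
/-- Core of the comparison. -/
theorem compare_core {N : ℕ} (hN : 1 ≤ N) (D0 D1 R b ε C : ℝ) (hR : 1 ≤ R) (hb : 0 < b)
    (hε : 0 < ε) (hε1 : ε < 1 - D.σ₀) (hε2 : D.s * ε ≤ 1 / 2) (hD0 : 0 < D0) (hD1 : 0 < D1)
    (hf : ∀ x : En n, ‖x‖ ≤ R → - D.f x ≤ D0 * R ^ D.ρ)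
    (u v : En n → ℝ) (hu : UpperSemicontinuous u) (hv : LowerSemicontinuous v)
    (hsub : ∀ x, D.SubAt u x) (hsup : ∀ x, D.SuperAt v x)
    (hup : ∀ x : En n, ‖x‖ ≤ R → (max (u x) 0) ^ D.s ≤ D1 * R ^ D.ρ)
    (k E κ : ℝ) (hk : k = 4 * (D.γm + D.γm * (ε * D.cbar / (2 * D.γm)) ^ (1 - D.m)))
    (hE : E = ε * (D.A + D0 * R ^ D.ρ + 2 * D.s * (D1 * R ^ D.ρ))) (hκ : κ = 1 / 2 ^ D.s)
    (hbar : ∀ x0 : En n, ‖x0‖ < R → ∃ (P : En n) (c : ℝ), 0 ≤ c ∧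
      (∀ᶠ x in 𝓝 x0, psi N R b x ≤ psi N R b x0 + ⟪P, x - x0⟫ + 1 / 2 * c * ‖x - x0‖ ^ 2) ∧
      D.Lam * n * c + D.γ₁ * ‖P‖ + k * ‖P‖ ^ D.m + E ≤ κ * (psi N R b x0) ^ D.s)
    (x1 : En n) (hx1 : ‖x1‖ < R) : u x1 - (1 - ε) * v x1 ≤ psi N R b x1 := by
  by_contra hcon
  have hs0 := D.hs0
  have hs1 := D.hs1
  have hm0 := D.hm0
  have hγ1 := D.hγ₁
  have hγm := D.hγm
  have hc := D.hcbar
  have hε3 : ε ≤ 1 / 2 := by nlinarith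
  set σ := 1 - ε with hσ
  have hσ0 : 0 < σ := by rw [hσ]; linarith
  have hσ1 : σ < 1 := by rw [hσ]; linarith
  have hκ0 : 0 < κ := by rw [hκ]; positivity
  have hk0 : 0 < k := by rw [hk]; positivity
  -- semicontinuity
  have hσv : LowerSemicontinuous (fun x => σ * v x) := by
    intro x c hcx
    have hcx' : σ * v x > c := hcx
    have : c / σ < v x := by rw [div_lt_iff₀ hσ0]; linarith
    filter_upwards [hv x _ this] with z hz
    rw [gt_iff_lt, div_lt_iff₀ hσ0] at hz; linarith
  have hw : UpperSemicontinuous (fun x => u x + - (σ * v x)) := by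
    refine hu.add ?_
    intro x c hcx
    have hcx' : - (σ * v x) < c := hcx
    filter_upwards [hσv x (-c) (by linarith)] with z hz
    linarith
  obtain ⟨r, hr0, hrR, z0, hz0, hmax, hbd, hge⟩ := contact hw hN hb x1 hx1
  set θ := u z0 + -(σ * v z0) - psi N R b z0 with hθ
  have hθ0 : 0 < θ := by linarith [not_le.mp hcon]
  set m0 := κ * (θ / 2) ^ D.s / 8 with hm0d
  have hm0p : 0 < m0 := by positivity
  set μ := min (ε * D.cbar / 2) m0 with hμ
  have hμ0 : 0 < μ := by positivity
  obtain ⟨δω, hδω, hω⟩ := mod_tendsto D.hω μ hμ0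
  have hcB : IsCompact (Metric.closedBall (0 : En n) r) := isCompact_closedBall _ _
  obtain ⟨δf, hδf, huf⟩ := Metric.uniformContinuousOn_iff.mp
    (hcB.uniformContinuousOn_of_continuous D.hf.continuousOn) m0 hm0p
  set δ := min (min (min (θ / 2) m0) (min δω δf)) (min (min 1 (m0 / D.γ₁)) (m0 / k)) with hδ
  have hδ0 : 0 < δ := by positivity
  have d1 : δ ≤ θ / 2 := (min_le_left _ _).trans ((min_le_left _ _).trans (min_le_left _ _))
  have d2 : δ ≤ m0 := (min_le_left _ _).trans ((min_le_left _ _).trans (min_le_right _ _))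
  have d3 : δ ≤ δω := (min_le_left _ _).trans ((min_le_right _ _).trans (min_le_left _ _))
  have d4 : δ ≤ δf := (min_le_left _ _).trans ((min_le_right _ _).trans (min_le_right _ _))
  have d5 : δ ≤ 1 := (min_le_right _ _).trans ((min_le_left _ _).trans (min_le_left _ _))
  have d6 : D.γ₁ * δ ≤ m0 := by
    have : δ ≤ m0 / D.γ₁ := (min_le_right _ _).trans ((min_le_left _ _).trans (min_le_right _ _))
    rw [le_div_iff₀ hγ1] at this; linarith
  have d7 : k * δ ≤ m0 := by
    have : δ ≤ m0 / k := (min_le_right _ _).trans (min_le_right _ _)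
    rw [le_div_iff₀ hk0] at this; linarith
  clear_value δ
  have hψc : ContinuousOn (fun x => - psi N R b x) (Metric.closedBall (0 : En n) r) := by
    intro x hx
    rw [mem_closedBall_zero_iff] at hx
    exact (psi_contAt N (hx.trans_lt hrR)).neg.continuousWithinAt
  obtain ⟨x, hxB, y, hyB, p, q, X, Y, hX, hY, hxy, hpq, hval, hFF, hj1, hj2⟩ :=
    D.doubling_sums (fun x => u x + - psi N R b x) (fun x => σ * v x) (Metric.closedBall 0 r) hcB
      ((hu.upperSemicontinuousOn _).add hψc.upperSemicontinuousOn) (hσv.lowerSemicontinuousOn _) θ z0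
      (by rw [mem_closedBall_zero_iff]; exact hz0.le) (by rw [hθ]; ring) (by
        intro x hx hx'
        rw [interior_closedBall _ hr0.ne', mem_ball_zero_iff] at hx'
        rw [mem_closedBall_zero_iff] at hx
        have := hbd x (le_antisymm hx (not_lt.mp hx'))
        linarith) δ hδ0
  have hxr := mem_closedBall_zero_iff.mp hxB
  have hyr := mem_closedBall_zero_iff.mp hyB
  obtain ⟨P, c, hc0, hjet, hineq⟩ := hbar x (hxr.trans_lt hrR)
  have hsc : (c • (1 : Mn n)).IsSymm := symm_smul _ symm_one
  -- the subsolution inequality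
  have hS : D.f x ≤ D.F x (X + c • 1) + D.H x (p + P) - D.g (u x) := by
    refine (hsub x).slack (p + P) (X + c • 1) (symm_add hX hsc) fun η hη => ?_
    filter_upwards [hj1 η hη, hjet] with z h1 h2
    rw [qf_add, qf_smul, qf_one, inner_add_left]
    linarith
  -- the supersolution inequality
  have hT : D.F y (σ⁻¹ • Y) + D.H y (σ⁻¹ • q) - D.g (v y) ≤ D.f y := by
    refine (hsup y).slack (σ⁻¹ • q) (σ⁻¹ • Y) (symm_smul _ hY) fun η hη => ?_
    filter_upwards [hj2 (σ * η) (by positivity)] with z h1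
    rw [qf_smul, real_inner_smul_left]
    have h2 := mul_le_mul_of_nonneg_left h1 (inv_nonneg.mpr hσ0.le)
    have e1 : σ⁻¹ * (σ * v z) = v z := by field_simp
    have e2 : σ⁻¹ * (σ * v y + ⟪q, z - y⟫ + 1 / 2 * qf Y (z - y) - σ * η * ‖z - y‖ ^ 2) =
        v y + σ⁻¹ * ⟪q, z - y⟫ + 1 / 2 * (σ⁻¹ * qf Y (z - y)) - η * ‖z - y‖ ^ 2 := by field_simp
    rw [e1, e2] at h2
    exact h2
  have hT2 : D.F y Y + σ * D.H y (σ⁻¹ • q) - σ * D.g (v y) ≤ σ * D.f y := by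
    have h1 := D.hFhom σ ⟨hσ0, hσ1⟩ y (σ⁻¹ • Y)
    rw [smul_smul, mul_inv_cancel₀ hσ0.ne', one_smul] at h1
    have h2 := mul_le_mul_of_nonneg_left hT hσ0.le
    rw [h1]; linarith
  have hF1 := D.F_le x (X + c • 1) X (symm_add hX hsc) hX c hc0 (fun h => by rw [qf_add, qf_smul, qf_one])
  -- H part
  set Q := p - q + P with hQ
  have hQn : ‖Q‖ ≤ ‖P‖ + δ := by
    have := norm_add_le (p - q) P
    rw [hQ]; linarith
  have hH := D.H_est hε hε1 (min_le_left _ _ : μ ≤ _) x y q Q (hω _ (norm_nonneg _) (by linarith)).le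
  have e1 : q + Q = p + P := by rw [hQ]; abel
  rw [e1, ← hσ] at hH
  have hμm : μ ≤ m0 := min_le_right _ _
  have hQm : ‖Q‖ ^ D.m ≤ 4 * (‖P‖ ^ D.m + δ) := by
    have h1 : ‖Q‖ ^ D.m ≤ (‖P‖ + δ) ^ D.m := by gcongr
    have h2 := rpow_add_le_two (norm_nonneg P) hδ0.le hm0.le
    have h3 : (2 : ℝ) ^ D.m ≤ 4 := by
      calc (2 : ℝ) ^ D.m ≤ 2 ^ (2 : ℝ) := Real.rpow_le_rpow_of_exponent_le (by norm_num) D.hm2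
        _ = 4 := by norm_num
    have h4 : δ ^ D.m ≤ δ := by
      calc δ ^ D.m ≤ δ ^ (1 : ℝ) := Real.rpow_le_rpow_of_exponent_ge hδ0 d5 D.hm1.le
        _ = δ := Real.rpow_one _
    have h5 : (2 : ℝ) ^ D.m * (‖P‖ ^ D.m + δ ^ D.m) ≤ 4 * (‖P‖ ^ D.m + δ) := by gcongr
    linarith
  have hQm2 : (D.γm + D.γm * (ε * D.cbar / (2 * D.γm)) ^ (1 - D.m)) * ‖Q‖ ^ D.m ≤ k * ‖P‖ ^ D.m + k * δ := by
    have h1 : 0 ≤ D.γm + D.γm * (ε * D.cbar / (2 * D.γm)) ^ (1 - D.m) := by positivity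
    have h2 := mul_le_mul_of_nonneg_left hQm h1
    rw [hk]; linarith
  have hQ1 : D.γ₁ * ‖Q‖ ≤ D.γ₁ * ‖P‖ + D.γ₁ * δ := by
    rw [← mul_add]; gcongr
  -- f part
  have hfxy : D.f y - m0 ≤ D.f x := by
    have := huf x hxB y hyB (by rw [dist_eq_norm]; linarith)
    rw [Real.dist_eq] at this
    linarith [(abs_lt.mp this).1]
  have hfy : - D.f y ≤ D0 * R ^ D.ρ := hf y (by linarith)
  have hfy2 := mul_le_mul_of_nonneg_left hfy hε.le
  -- g part
  have hψx : b ≤ psi N R b x := psi_ge N hb.le (hxr.trans_lt hrR)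
  have hdiff : psi N R b x + θ / 2 ≤ u x - σ * v y := by linarith
  have hg1 := D.g_diff (u := u x) (w := σ * v y) (by linarith)
  rw [← hκ] at hg1
  obtain ⟨hj0, hjC⟩ := D.sigma_pow hε hε2
  rw [← hσ] at hj0 hjC
  have hgs := D.g_scale hσ0 (v y)
  have hgw : D.g (σ * v y) ≤ D1 * R ^ D.ρ := by
    have h1 : D.g (σ * v y) ≤ D.g (max (u x) 0) :=
      D.g_strictMono.monotone (le_trans (by linarith) (le_max_left (u x) 0))
    rw [D.g_of_nonneg (le_max_right _ _)] at h1
    exact h1.trans (hup x (by linarith))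
  have hj1 : (σ ^ (1 - D.s) - 1) * D.g (σ * v y) ≤ 2 * D.s * ε * (D1 * R ^ D.ρ) := by
    have hR0 : 0 ≤ D1 * R ^ D.ρ := by positivity
    calc (σ ^ (1 - D.s) - 1) * D.g (σ * v y) ≤ (σ ^ (1 - D.s) - 1) * (D1 * R ^ D.ρ) := by
          apply mul_le_mul_of_nonneg_left hgw; linarith
      _ ≤ _ := by apply mul_le_mul_of_nonneg_right _ hR0; linarith
  have hsup2 : psi N R b x ^ D.s + (θ / 2) ^ D.s ≤ (u x - σ * v y) ^ D.s := by
    have h1 := Real.add_rpow_le_rpow_add (p := D.s) (hb.le.trans hψx) (by positivity : 0 ≤ θ / 2) hs1.le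
    have h2 : (psi N R b x + θ / 2) ^ D.s ≤ (u x - σ * v y) ^ D.s := by
      apply Real.rpow_le_rpow (by linarith) hdiff hs0.le
    linarith
  have hsup3 := mul_le_mul_of_nonneg_left hsup2 hκ0.le
  have e8 : κ * (θ / 2) ^ D.s = 8 * m0 := by rw [hm0d]; ring
  have eσ : σ * D.f y = D.f y - ε * D.f y := by rw [hσ]; ring
  rw [hE] at hineq
  linarith

lemma rho_lt : D.ρ < D.m / (D.m - 1) := by
  have hm := D.hm1
  have hs := D.hs1
  have hs0 := D.hs0
  have hm1 : 0 < D.m - 1 := by linarith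
  rcases le_or_gt D.m (2 * D.s / (D.s + 1)) with h | h
  · refine (D.hρ1 h).trans_le ?_
    rw [div_le_div_iff₀ (by positivity) hm1]
    have : 0 ≤ D.m * (D.m - 1) := by nlinarith
    nlinarith
  · refine (D.hρ2 h).trans_le ?_
    rw [div_lt_iff₀ (by linarith)] at h
    rw [div_le_div_iff₀ (by positivity) hm1]
    have : 0 ≤ (D.m - 1) * (D.m * D.s + D.m - 2 * D.s) := mul_nonneg hm1.le (by linarith)
    nlinarith

/-- Comparison principle. -/
theorem comparison (u v : En n → ℝ) (hu : UpperSemicontinuous u) (hv : LowerSemicontinuous v)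
    (hsub : ∀ x, D.SubAt u x) (hsup : ∀ x, D.SuperAt v x) (x1 : En n) : u x1 ≤ v x1 := by
  obtain ⟨N, hN, C, hC, hbar⟩ := D.barrier
  obtain ⟨D0, hD0, hf⟩ := D.f_lower
  obtain ⟨D1, hD1, hup⟩ := D.upper
  have hs0 := D.hs0
  have hs1 := D.hs1
  have hm0 := D.hm0
  have hm1 : 0 < D.m - 1 := by linarith [D.hm1]
  have hsm : 0 < D.s - D.m := by linarith [D.hsm]
  have hγm := D.hγm
  have hc := D.hcbar
  have hA := D.hA
  obtain ⟨e, he1, he2⟩ := exists_between D.rho_lt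
  have he0 : 0 < e := D.hρ.trans_lt he1
  rw [lt_div_iff₀ hm1] at he2
  obtain ⟨τ, hτ0, t1, t2, t3⟩ : ∃ τ > 0, τ * (D.s - 1) < 1 ∧ τ * (D.s - D.m) < D.m - e * (D.m - 1) ∧
      τ * D.s < e - D.ρ := by
    have h1 : 0 < 1 / (D.s - 1) := by apply div_pos one_pos; linarith
    have h2 : 0 < (D.m - e * (D.m - 1)) / (D.s - D.m) := by apply div_pos _ hsm; linarith
    have h3 : 0 < (e - D.ρ) / D.s := by apply div_pos _ hs0; linarith
    obtain ⟨τ, hτ0, hτ⟩ := exists_between (lt_min h1 (lt_min h2 h3))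
    rw [lt_min_iff, lt_min_iff, lt_div_iff₀ (by linarith), lt_div_iff₀ hsm, lt_div_iff₀ hs0] at hτ
    exact ⟨τ, hτ0, hτ.1, hτ.2.1, hτ.2.2⟩
  set κ : ℝ := 1 / 2 ^ D.s with hκ
  have hκ0 : 0 < κ := by positivity
  set k2 := 4 * D.γm * (D.cbar / (2 * D.γm)) ^ (1 - D.m) with hk2
  set D2 := D0 + 2 * D.s * D1 with hD2
  have tend : ∀ a : ℝ, a < 0 → Tendsto (fun R : ℝ => R ^ a) atTop (𝓝 0) := by
    intro a ha
    have := tendsto_rpow_neg_atTop (y := -a) (by linarith)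
    simpa using this
  have T : Tendsto (fun R : ℝ => C * R ^ (τ * D.s - τ - 1) + 4 * D.γm * C * R ^ (τ * D.s - (τ + 1) * D.m)
      + k2 * C * R ^ (e * (D.m - 1) + τ * D.s - (τ + 1) * D.m) + D.A * R ^ (τ * D.s - e)
      + D2 * R ^ (D.ρ - e + τ * D.s)) atTop (𝓝 0) := by
    have a1 := (tend (τ * D.s - τ - 1) (by linarith)).const_mul C
    have a2 := (tend (τ * D.s - (τ + 1) * D.m) (by nlinarith)).const_mul (4 * D.γm * C)
    have a3 := (tend (e * (D.m - 1) + τ * D.s - (τ + 1) * D.m) (by linarith)).const_mul (k2 * C)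
    have a4 := (tend (τ * D.s - e) (by linarith [D.hρ])).const_mul D.A
    have a5 := (tend (D.ρ - e + τ * D.s) (by linarith)).const_mul D2
    simpa using (((a1.add a2).add a3).add a4).add a5
  have Te := tend (-e) (by linarith)
  have Tτ := tend (-τ) (by linarith)
  have hσ₀ := D.hσ₀
  have ev : ∀ᶠ R : ℝ in atTop, u x1 - (1 - R ^ (-e)) * v x1 ≤ R ^ (-τ) * (4 / 3) ^ N := by
    filter_upwards [T.eventually (gt_mem_nhds hκ0), eventually_ge_atTop 1, eventually_ge_atTop (2 * ‖x1‖),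
      eventually_gt_atTop ‖x1‖,
      Te.eventually (gt_mem_nhds (show 0 < 1 - D.σ₀ by linarith [hσ₀.2])),
      Te.eventually (gt_mem_nhds (show 0 < 1 / (2 * D.s) by positivity))] with R h1 hR1 hR2 hR3 hε1 hε2
    have hR0 : 0 < R := by linarith
    set ε := R ^ (-e) with hε
    set b := R ^ (-τ) with hb
    have hε0 : 0 < ε := by positivity
    have hb0 : 0 < b := by positivity
    have hk : 4 * (D.γm + D.γm * (ε * D.cbar / (2 * D.γm)) ^ (1 - D.m)) =
        4 * D.γm + k2 * R ^ (e * (D.m - 1)) := by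
      rw [mul_div_assoc, Real.mul_rpow hε0.le (by positivity), hε, ← Real.rpow_mul hR0.le, hk2]
      have : -e * (1 - D.m) = e * (D.m - 1) := by ring
      rw [this]; ring
    have hcond : C * (b / R) + (4 * (D.γm + D.γm * (ε * D.cbar / (2 * D.γm)) ^ (1 - D.m))) * C * (b / R) ^ D.m
        + ε * (D.A + D0 * R ^ D.ρ + 2 * D.s * (D1 * R ^ D.ρ)) ≤ κ * b ^ D.s := by
      rw [hk]
      have hbs : b ^ D.s = R ^ (- (τ * D.s)) := by rw [hb, ← Real.rpow_mul hR0.le]; congr 1; ring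
      have hbR : b / R = R ^ (-τ - 1) := by rw [hb, Real.rpow_sub_one hR0.ne']
      have hbRm : (b / R) ^ D.m = R ^ (-(τ + 1) * D.m) := by
        rw [hbR, ← Real.rpow_mul hR0.le]; congr 1; ring
      have h2 := mul_le_mul_of_nonneg_right h1.le (show 0 ≤ R ^ (-(τ * D.s)) by positivity)
      rw [← hbs] at h2
      refine le_trans (le_of_eq ?_) h2
      rw [hbRm, hbR, hbs, hε]
      simp only [add_mul, mul_add]
      simp only [mul_assoc]
      simp only [← Real.rpow_add hR0]
      have q1 : τ * D.s - τ - 1 + -(τ * D.s) = -τ - 1 := by ring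
      have q2 : τ * D.s - (τ * D.m + 1 * D.m) + -(τ * D.s) = -(τ + 1) * D.m := by ring
      have q3 : e * (D.m - 1) + τ * D.s - (τ * D.m + 1 * D.m) + -(τ * D.s) = e * (D.m - 1) + -(τ + 1) * D.m := by ring
      have q4 : τ * D.s - e + -(τ * D.s) = -e := by ring
      have q5 : D.ρ - e + τ * D.s + -(τ * D.s) = -e + D.ρ := by ring
      rw [q1, q2, q3, q4, q5, Real.rpow_add hR0 (-e), Real.rpow_add hR0 (e * (D.m - 1)), hD2]
      ring
    have hε2' : D.s * ε ≤ 1 / 2 := by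
      rw [lt_div_iff₀ (by positivity)] at hε2; linarith
    have hcore := D.compare_core hN D0 D1 R b ε C hR1 hb0 hε0 hε1 hε2' hD0 hD1 (hf R hR1) u v hu hv hsub hsup
      (hup u hu hsub R hR1) _ _ κ rfl rfl hκ
      (hbar R b _ _ κ hR1 hb0 (by positivity) (by positivity) hcond) x1 hR3
    refine hcore.trans ?_
    unfold psi
    have h1 : 3 / 4 ≤ 1 - ‖x1‖ ^ 2 / R ^ 2 := by
      have : ‖x1‖ ^ 2 / R ^ 2 ≤ 1 / 4 := by
        rw [div_le_iff₀ (by positivity)]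
        nlinarith [norm_nonneg x1]
      linarith
    have h2 : (1 - ‖x1‖ ^ 2 / R ^ 2)⁻¹ ≤ 4 / 3 := by
      rw [inv_le_comm₀ (by linarith) (by norm_num)]; norm_num; linarith
    have h3 : 0 ≤ (1 - ‖x1‖ ^ 2 / R ^ 2)⁻¹ := inv_nonneg.mpr (by linarith)
    gcongr
  have L1 : Tendsto (fun R : ℝ => u x1 - (1 - R ^ (-e)) * v x1) atTop (𝓝 (u x1 - (1 - 0) * v x1)) :=
    tendsto_const_nhds.sub ((tendsto_const_nhds.sub Te).mul_const _)
  have L2 := Tτ.mul_const ((4 / 3 : ℝ) ^ N)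
  have := le_of_tendsto_of_tendsto L1 L2 ev
  linarith

end Dat
end PI

section PJ
open Set Filter Topology
open scoped RealInnerProductSpace
variable {n : ℕ}

lemma jet_zero {a : En n} {Z : Mn n} {x0 : En n}
    (h : ∀ᶠ x in 𝓝 x0, 0 ≤ ⟪a, x - x0⟫ + 1 / 2 * qf Z (x - x0)) : a = 0 ∧ ∀ v, 0 ≤ qf Z v := by
  have key : ∀ v : En n, ∀ᶠ t : ℝ in 𝓝[>] 0, 0 ≤ t * ⟪a, v⟫ + 1 / 2 * (t ^ 2 * qf Z v) := by
    intro v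
    have hc : Tendsto (fun t : ℝ => x0 + t • v) (𝓝[>] 0) (𝓝 x0) := by
      have : Continuous (fun t : ℝ => x0 + t • v) := by fun_prop
      have := this.tendsto 0
      simp only [zero_smul, add_zero] at this
      exact this.mono_left nhdsWithin_le_nhds
    filter_upwards [hc.eventually h] with t ht
    rwa [add_sub_cancel_left, real_inner_smul_right, qf_at_smul] at ht
  have ha : a = 0 := by
    have h1 : ∀ᶠ t : ℝ in 𝓝[>] 0, ‖a‖ ^ 2 ≤ 1 / 2 * (t * qf Z (-a)) := by
      filter_upwards [key (-a), self_mem_nhdsWithin] with t ht ht0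
      have ht0' : 0 < t := ht0
      rw [inner_neg_right, real_inner_self_eq_norm_sq] at ht
      have : t * ‖a‖ ^ 2 ≤ t * (1 / 2 * (t * qf Z (-a))) := by linarith
      exact le_of_mul_le_mul_left this ht0'
    have h2 : Tendsto (fun t : ℝ => 1 / 2 * (t * qf Z (-a))) (𝓝[>] 0) (𝓝 0) := by
      have : Continuous (fun t : ℝ => 1 / 2 * (t * qf Z (-a))) := by fun_prop
      have := this.tendsto 0
      simp only [zero_mul, mul_zero] at this
      exact this.mono_left nhdsWithin_le_nhds
    have h3 := ge_of_tendsto h2 h1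
    have : ‖a‖ = 0 := by nlinarith [norm_nonneg a]
    exact norm_eq_zero.mp this
  refine ⟨ha, fun v => ?_⟩
  obtain ⟨t, ht, ht0⟩ := ((key v).and self_mem_nhdsWithin).exists
  have ht0' : 0 < t := ht0
  rw [ha, inner_zero_left, mul_zero, zero_add] at ht
  by_contra hneg
  have : t ^ 2 * qf Z v < 0 := mul_neg_of_pos_of_neg (by positivity) (not_le.mp hneg)
  linarith

/-! ### Upper envelope -/

def env (U : En n → ℝ) (x : En n) : ℝ := sInf {c | ∀ᶠ y in 𝓝 x, U y ≤ c}

lemma env_bdd (U : En n → ℝ) (x : En n) : BddBelow {c | ∀ᶠ y in 𝓝 x, U y ≤ c} :=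
  ⟨U x, fun _ hc => Eventually.self_of_nhds (p := fun y => U y ≤ _) hc⟩

lemma env_le {U : En n → ℝ} {x : En n} {c : ℝ} (h : ∀ᶠ y in 𝓝 x, U y ≤ c) : env U x ≤ c :=
  csInf_le (env_bdd U x) h

lemma le_env {U : En n → ℝ} (hU : ∀ x, ∃ c, ∀ᶠ y in 𝓝 x, U y ≤ c) (x : En n) : U x ≤ env U x :=
  le_csInf (hU x) fun _ hc => Eventually.self_of_nhds (p := fun y => U y ≤ _) hc

lemma env_lt {U : En n → ℝ} (hU : ∀ x, ∃ c, ∀ᶠ y in 𝓝 x, U y ≤ c) {x : En n} {c : ℝ}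
    (h : env U x < c) : ∃ c' < c, ∀ᶠ y in 𝓝 x, U y ≤ c' := by
  obtain ⟨c', h1, h2⟩ := (csInf_lt_iff (env_bdd U x) (hU x)).mp h
  exact ⟨c', h2, h1⟩

lemma env_usc {U : En n → ℝ} (hU : ∀ x, ∃ c, ∀ᶠ y in 𝓝 x, U y ≤ c) : UpperSemicontinuous (env U) := by
  intro x c hc
  obtain ⟨c', h1, h2⟩ := env_lt hU hc
  filter_upwards [eventually_eventually_nhds.mpr h2] with y hy
  exact (env_le hy).trans_lt h1

lemma env_freq {U : En n → ℝ} {x : En n} {c : ℝ} (h : c < env U x) : ∃ᶠ y in 𝓝 x, c < U y := by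
  intro hcon
  have : env U x ≤ c := env_le (by filter_upwards [hcon] with y hy using not_lt.mp hy)
  linarith

namespace Dat
variable (D : Dat n)

lemma subAt_of_lower {w : En n → ℝ} {x0 : En n} (p : En n) (X : Mn n) (hX : X.IsSymm)
    (h : ∀ᶠ x in 𝓝 x0, w x0 + ⟪p, x - x0⟫ + 1 / 2 * qf X (x - x0) ≤ w x)
    (hf : D.f x0 ≤ D.F x0 X + D.H x0 p - D.g (w x0)) : D.SubAt w x0 := by
  intro q Y hY hq
  obtain ⟨h1, h2⟩ := jet_zero (a := q - p) (Z := Y - X) (x0 := x0) (by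
    filter_upwards [h, hq] with x h1 h2
    rw [inner_sub_left, qf_sub]; linarith)
  have e : q = p := sub_eq_zero.mp h1
  have h3 := D.F_le x0 X Y hX hY 0 le_rfl (fun v => by have := h2 v; rw [qf_sub] at this; linarith)
  rw [e]; linarith

lemma SubAt.mono {D : Dat n} {u w : En n → ℝ} {x0 : En n} (hu : D.SubAt u x0) (h : ∀ᶠ x in 𝓝 x0, u x ≤ w x)
    (h0 : u x0 = w x0) : D.SubAt w x0 := by
  intro p X hX hj
  have := hu p X hX (by filter_upwards [h, hj] with x h1 h2; rw [h0]; linarith)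
  rwa [h0] at this

lemma contF (X : Mn n) (hX : X.IsSymm) (x0 p : En n) :
    Continuous (fun z : En n × ℝ => D.F z.1 X + D.H z.1 (p + opm X (z.1 - x0)) - D.g z.2) := by
  have h1 := (D.hFcont X hX).comp (continuous_fst (X := En n) (Y := ℝ))
  have h2 : Continuous (fun z : En n × ℝ => (z.1, p + opm X (z.1 - x0))) := by fun_prop
  exact (h1.add (D.H_cont.comp h2)).sub (D.g_cont.comp continuous_snd)

/-- recentering of a quadratic -/
lemma quad_recenter (X : Mn n) (hX : X.IsSymm) (p x0 x1 x : En n) :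
    ⟪p, x - x0⟫ + 1 / 2 * qf X (x - x0) = ⟪p, x1 - x0⟫ + 1 / 2 * qf X (x1 - x0) +
      ⟪p + opm X (x1 - x0), x - x1⟫ + 1 / 2 * qf X (x - x1) := by
  have e : x - x0 = (x1 - x0) + (x - x1) := by abel
  rw [e, qf_at_add X hX, inner_add_right, inner_add_left]; ring

/-- Stability of subsolutions under suprema. -/
theorem sup_subAt (S : Set (En n → ℝ)) (hS : ∀ w ∈ S, UpperSemicontinuous w ∧ ∀ x, D.SubAt w x)
    (U : En n → ℝ) (hU : ∀ x, ∃ c, ∀ᶠ y in 𝓝 x, U y ≤ c) (hSU : ∀ w ∈ S, ∀ x, w x ≤ U x)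
    (hUS : ∀ x c, c < U x → ∃ w ∈ S, c < w x) (x0 : En n) : D.SubAt (env U) x0 := by
  intro p X hX hj
  have hL : 0 < D.Lam * n := mul_pos D.hLam D.hnpos
  refine le_of_forall_pos_le_add fun e he => ?_
  obtain ⟨η, hη0, hη⟩ : ∃ η > 0, D.Lam * n * (2 * η) = e :=
    ⟨e / (2 * (D.Lam * n)), by positivity, by field_simp; exact div_self hL.ne'⟩
  set X' := X + (2 * η) • (1 : Mn n) with hX'
  have hX's : X'.IsSymm := symm_add hX (symm_smul _ symm_one)
  have hF := D.F_le x0 X' X hX's hX (2 * η) (by positivity) (fun v => by rw [hX', qf_add, qf_smul, qf_one])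
  have hq' : ∀ v, qf X' v = qf X v + 2 * η * ‖v‖ ^ 2 := fun v => by rw [hX', qf_add, qf_smul, qf_one]
  set V := env U with hV
  suffices hmain : D.f x0 ≤ D.F x0 X' + D.H x0 p - D.g (V x0) by linarith
  have hcl : IsClosed {z : En n × ℝ | D.f z.1 ≤ D.F z.1 X' + D.H z.1 (p + opm X' (z.1 - x0)) - D.g z.2} :=
    isClosed_le (D.hf.comp continuous_fst) (D.contF X' hX's x0 p)
  have hmem : (x0, V x0) ∈ closure {z : En n × ℝ | D.f z.1 ≤ D.F z.1 X' + D.H z.1 (p + opm X' (z.1 - x0)) - D.g z.2} := by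
    rw [Metric.mem_closure_iff]
    intro δ hδ
    obtain ⟨r, hr, hjr⟩ := Metric.eventually_nhds_iff.mp hj
    -- φ is continuous
    set φ : En n → ℝ := fun x => V x0 + (⟪p, x - x0⟫ + 1 / 2 * qf X' (x - x0)) with hφ
    have hφc : Continuous φ := by
      have := qf_continuous X'
      fun_prop
    have hφ0 : φ x0 = V x0 := by simp only [hφ, sub_self, inner_zero_right, qf_at_zero]; ring
    obtain ⟨δ1, hδ1, hφδ⟩ := Metric.continuous_iff.mp hφc x0 (δ / 4) (by positivity)
    set r1 := min (min (r / 2) (δ / 2)) (δ1 / 2) with hr1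
    have hr10 : 0 < r1 := by positivity
    have b1 : r1 ≤ r / 2 := (min_le_left _ _).trans (min_le_left _ _)
    have b2 : r1 ≤ δ / 2 := (min_le_left _ _).trans (min_le_right _ _)
    have b3 : r1 ≤ δ1 / 2 := min_le_right _ _
    clear_value r1
    set d := min (δ / 16) (η * r1 ^ 2 / 8) with hd
    have hd0 : 0 < d := by positivity
    have c1 : d ≤ δ / 16 := min_le_left _ _
    have c2 : d ≤ η * r1 ^ 2 / 8 := min_le_right _ _
    have hVφ : ∀ x, ‖x - x0‖ ≤ r1 → V x ≤ φ x - η * ‖x - x0‖ ^ 2 := by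
      intro x hx
      have := hjr (y := x) (by rw [dist_eq_norm]; linarith)
      simp only [hφ, hq']; linarith
    obtain ⟨x1, hx1U, hx1φ, hx1r⟩ := ((env_freq (U := U) (x := x0) (c := V x0 - d) (by rw [← hV]; linarith)).and_eventually
      ((hφc.tendsto x0).eventually (gt_mem_nhds (show φ x0 < V x0 + d by linarith)) |>.and
        (Metric.ball_mem_nhds x0 hr10))).exists
    rw [dist_eq_norm] at hx1r
    obtain ⟨w, hw, hwx1⟩ := hUS x1 _ hx1U
    obtain ⟨hwu, hwsub⟩ := hS w hw
    have hUs : UpperSemicontinuousOn (fun x => w x + - φ x) (Metric.closedBall x0 r1) :=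
      (hwu.upperSemicontinuousOn _).add (hφc.neg.continuousOn.upperSemicontinuousOn)
    obtain ⟨x2, hx2, hmax⟩ := hUs.exists_isMaxOn
      ⟨x1, by rw [Metric.mem_closedBall, dist_eq_norm]; exact hx1r.le⟩ (isCompact_closedBall _ _)
    rw [Metric.mem_closedBall, dist_eq_norm] at hx2
    have hm : ∀ x, ‖x - x0‖ ≤ r1 → w x - φ x ≤ w x2 - φ x2 := fun x hx => by
      have := hmax (show x ∈ Metric.closedBall x0 r1 by rwa [Metric.mem_closedBall, dist_eq_norm])
      simp only [mem_ofPred_eq] at this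
      linarith
    have h1 := hm x1 hx1r.le
    have h2 : w x2 ≤ V x2 := (hSU w hw x2).trans (le_env hU x2)
    have h3 := hVφ x2 hx2
    have h4 : η * ‖x2 - x0‖ ^ 2 ≤ 2 * d := by linarith
    have h5 : ‖x2 - x0‖ < r1 := by
      by_contra hcon
      have h6 : r1 ^ 2 ≤ ‖x2 - x0‖ ^ 2 := by gcongr; exact not_lt.mp hcon
      have h7 : η * r1 ^ 2 ≤ η * ‖x2 - x0‖ ^ 2 := by gcongr
      have : 0 < η * r1 ^ 2 := by positivity
      linarith
    have h6 := hφδ x2 (by rw [dist_eq_norm]; linarith)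
    rw [hφ0, Real.dist_eq, abs_lt] at h6
    refine ⟨(x2, w x2), ?_, ?_⟩
    · refine hwsub x2 (p + opm X' (x2 - x0)) X' hX's ?_
      have hopen : IsOpen {x : En n | ‖x - x0‖ < r1} := isOpen_lt (by fun_prop) continuous_const
      filter_upwards [hopen.mem_nhds h5] with x hx
      have h7 := hm x (le_of_lt hx)
      simp only [hφ] at h7
      rw [quad_recenter X' hX's p x0 x2 x] at h7
      linarith
    · rw [Prod.dist_eq, max_lt_iff, dist_comm, dist_eq_norm, dist_comm, Real.dist_eq]
      refine ⟨by simp only; linarith, ?_⟩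
      simp only
      have : 0 ≤ η * ‖x2 - x0‖ ^ 2 := by positivity
      rw [abs_lt]; constructor <;> linarith [h6.1, h6.2]
  rw [hcl.closure_eq] at hmem
  have := hmem
  simp only [mem_ofPred_eq, sub_self, map_zero, add_zero] at this
  exact this

/-- local bound from above -/
lemma upper_loc : ∃ G : En n → ℝ, Continuous G ∧ ∀ u : En n → ℝ, UpperSemicontinuous u → (∀ x, D.SubAt u x) →
    ∀ x, u x ≤ G x := by
  obtain ⟨D1, hD1, h⟩ := D.upper
  have hs0 := D.hs0
  have hρ := D.hρ
  refine ⟨fun x => (D1 * (‖x‖ + 1) ^ D.ρ) ^ D.s⁻¹, ?_, fun u hu hsub x => ?_⟩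
  · refine Continuous.rpow_const ?_ (fun x => Or.inr (by positivity))
    refine continuous_const.mul (Continuous.rpow_const (by fun_prop) (fun x => Or.inr hρ))
  · have h1 := h u hu hsub (‖x‖ + 1) (by linarith [norm_nonneg x]) x (by linarith)
    have h2 : (0 : ℝ) ≤ max (u x) 0 := le_max_right _ _
    refine (le_max_left (u x) 0).trans ?_
    calc max (u x) 0 = ((max (u x) 0) ^ D.s) ^ D.s⁻¹ := (Real.rpow_rpow_inv h2 hs0.ne').symm
      _ ≤ _ := Real.rpow_le_rpow (Real.rpow_nonneg h2 _) h1 (by positivity)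

/-- The largest subsolution. -/
theorem max_sub (w0 : En n → ℝ) (hw0 : UpperSemicontinuous w0) (hw0s : ∀ x, D.SubAt w0 x) :
    ∃ U : En n → ℝ, UpperSemicontinuous U ∧ (∀ x, D.SubAt U x) ∧
      ∀ w : En n → ℝ, UpperSemicontinuous w → (∀ x, D.SubAt w x) → ∀ x, w x ≤ U x := by
  obtain ⟨G, hG, hub⟩ := D.upper_loc
  set S : Set (En n → ℝ) := {w | UpperSemicontinuous w ∧ ∀ x, D.SubAt w x} with hS
  have hw0S : w0 ∈ S := ⟨hw0, hw0s⟩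
  set U : En n → ℝ := fun x => sSup ((fun w : En n → ℝ => w x) '' S) with hUdef
  have hbdd : ∀ x, BddAbove ((fun w : En n → ℝ => w x) '' S) := fun x =>
    ⟨G x, by rintro _ ⟨w, hw, rfl⟩; exact hub w hw.1 hw.2 x⟩
  have hne : ∀ x, ((fun w : En n → ℝ => w x) '' S).Nonempty := fun x => ⟨_, w0, hw0S, rfl⟩
  have hSU : ∀ w ∈ S, ∀ x, w x ≤ U x := fun w hw x => le_csSup (hbdd x) ⟨w, hw, rfl⟩
  have hUS : ∀ x c, c < U x → ∃ w ∈ S, c < w x := by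
    intro x c hc
    obtain ⟨_, ⟨w, hw, rfl⟩, h⟩ := exists_lt_of_lt_csSup (hne x) hc
    exact ⟨w, hw, h⟩
  have hUG : ∀ x, U x ≤ G x := fun x => csSup_le (hne x) (by rintro _ ⟨w, hw, rfl⟩; exact hub w hw.1 hw.2 x)
  have hUloc : ∀ x, ∃ c, ∀ᶠ y in 𝓝 x, U y ≤ c := fun x => ⟨G x + 1, by
    filter_upwards [(hG.tendsto x).eventually (gt_mem_nhds (show G x < G x + 1 by linarith))] with y hy
    exact (hUG y).trans hy.le⟩
  have hV : env U ∈ S := ⟨env_usc hUloc, D.sup_subAt S (fun w hw => hw) U hUloc hSU hUS⟩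
  have e : env U = U := funext fun x => le_antisymm (hSU _ hV x) (le_env hUloc x)
  rw [e] at hV
  exact ⟨U, hV.1, hV.2, fun w h1 h2 => hSU w ⟨h1, h2⟩⟩

end Dat
end PJ

section PK
open Set Filter Topology
open scoped RealInnerProductSpace
variable {n : ℕ}

/-- reciprocal of the barrier, extended by zero -/
def qfun (N : ℕ) (R b : ℝ) (x : En n) : ℝ := (max (1 - ‖x‖ ^ 2 / R ^ 2) 0) ^ N / b

lemma qfun_cont (N : ℕ) (R b : ℝ) : Continuous (qfun N R b : En n → ℝ) := by
  unfold qfun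
  fun_prop

lemma qfun_nonneg (N : ℕ) (R : ℝ) {b : ℝ} (hb : 0 < b) (x : En n) : 0 ≤ qfun N R b x := by
  unfold qfun
  have := le_max_right (1 - ‖x‖ ^ 2 / R ^ 2) 0
  positivity

lemma qfun_le (N : ℕ) (R : ℝ) {b : ℝ} (hb : 0 < b) (x : En n) : qfun N R b x ≤ 1 / b := by
  unfold qfun
  have h0 := le_max_right (1 - ‖x‖ ^ 2 / R ^ 2) 0
  have h1 : max (1 - ‖x‖ ^ 2 / R ^ 2) 0 ≤ 1 :=
    max_le (by have : 0 ≤ ‖x‖ ^ 2 / R ^ 2 := by positivity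
               linarith) zero_le_one
  have := pow_le_one₀ h0 h1 (n := N)
  gcongr

lemma qfun_inv (N : ℕ) {R b : ℝ} {x : En n} (hx : ‖x‖ < R) : (qfun N R b x)⁻¹ = psi N R b x := by
  unfold qfun psi
  rw [max_eq_left (psi_d hx).1.le, inv_div, inv_pow, div_eq_mul_inv]

lemma qfun_pos (N : ℕ) {R b : ℝ} (hb : 0 < b) {x : En n} (hx : ‖x‖ < R) : 0 < qfun N R b x := by
  unfold qfun
  rw [max_eq_left (psi_d hx).1.le]
  have := (psi_d hx).1
  positivity

lemma qfun_zero {N : ℕ} (hN : 1 ≤ N) {R b : ℝ} (hR : 0 < R) {x : En n} (hx : R ≤ ‖x‖) : qfun N R b x = 0 := by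
  unfold qfun
  rw [max_eq_right, zero_pow (by omega), zero_div]
  rw [sub_nonpos, one_le_div (by positivity)]
  gcongr

namespace Dat
variable (D : Dat n)

lemma exists_b (C k E R L : ℝ) (hC : 0 < C) (hk : 0 ≤ k) (hE : 0 ≤ E) (hR : 1 ≤ R) :
    ∃ b, 1 ≤ b ∧ L ≤ b ∧ C * (b / R) + k * C * (b / R) ^ D.m + E ≤ 1 * b ^ D.s := by
  have h1 := (tendsto_rpow_atTop (sub_pos.mpr D.hsm)).eventually_ge_atTop (C + k * C + E)
  obtain ⟨b, h1, h2, h3⟩ := (h1.and ((eventually_ge_atTop L).and (eventually_ge_atTop 1))).exists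
  have hb0 : 0 < b := by linarith
  have hm0 := D.hm0
  refine ⟨b, h3, h2, ?_⟩
  have e1 : b / R ≤ b := div_le_self hb0.le hR
  have e2 : b ≤ b ^ D.m := by
    calc b = b ^ (1 : ℝ) := (Real.rpow_one b).symm
      _ ≤ _ := Real.rpow_le_rpow_of_exponent_le h3 D.hm1.le
  have e3 : (b / R) ^ D.m ≤ b ^ D.m := Real.rpow_le_rpow (by positivity) e1 hm0.le
  have e4 : 1 ≤ b ^ D.m := by linarith
  have e5 : b ^ D.s = b ^ (D.s - D.m) * b ^ D.m := by
    rw [← Real.rpow_add hb0]; congr 1; ring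
  rw [e5]
  calc C * (b / R) + k * C * (b / R) ^ D.m + E ≤ C * b ^ D.m + k * C * b ^ D.m + E * b ^ D.m := by
        gcongr
        · linarith
        · exact le_mul_of_one_le_right hE e4
    _ = (C + k * C + E) * b ^ D.m := by ring
    _ ≤ 1 * (b ^ (D.s - D.m) * b ^ D.m) := by rw [one_mul]; gcongr

theorem exists_sub : ∃ w : En n → ℝ, UpperSemicontinuous w ∧ (∀ x, D.SubAt w x) ∧
    ∀ x, ∃ c, ∀ᶠ y in 𝓝 x, c ≤ w y := by
  obtain ⟨N, hN, C, hC, hbar⟩ := D.barrier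
  have hE : ∀ k : ℕ, ∃ E : ℝ, 0 ≤ E ∧ ∀ x : En n, ‖x‖ < k + 1 → D.f x ≤ E := by
    intro k
    obtain ⟨E, hE⟩ := (isCompact_closedBall (0 : En n) (k + 1)).bddAbove_image D.hf.continuousOn
    refine ⟨max E 0, le_max_right _ _, fun x hx => le_max_of_le_left (hE ⟨x, ?_, rfl⟩)⟩
    rw [mem_closedBall_zero_iff]; exact hx.le
  choose E hE0 hE using hE
  have hR : ∀ k : ℕ, (1 : ℝ) ≤ k + 1 := fun k => by have := Nat.cast_nonneg (α := ℝ) k; linarith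
  have hbk := fun k : ℕ => D.exists_b C D.γm (E k) (k + 1) (k + 1) hC D.hγm.le (hE0 k) (hR k)
  choose b hb1 hbk hb using hbk
  have hb0 : ∀ k, 0 < b k := fun k => by linarith [hb1 k]
  set q : ℕ → En n → ℝ := fun k => qfun N (k + 1) (b k) with hq
  have hqle : ∀ k x, q k x ≤ 1 / ((k : ℝ) + 1) := fun k x =>
    (qfun_le N _ (hb0 k) x).trans (by have := hR k; have := hbk k; gcongr)
  have hatt : ∀ x, ∃ k0 : ℕ, ‖x‖ < (k0 : ℝ) + 1 ∧ ∀ k, q k x ≤ q k0 x := by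
    intro x
    obtain ⟨k1, hk1⟩ := exists_nat_gt ‖x‖
    have hpos : 0 < q k1 x := qfun_pos N (hb0 k1) (by linarith)
    obtain ⟨K, hK⟩ := exists_nat_one_div_lt hpos
    obtain ⟨k0, -, hk0⟩ := Finset.exists_max_image (Finset.range (max K k1 + 1)) (fun k => q k x)
      ⟨0, by simp⟩
    have h1 : q k1 x ≤ q k0 x := hk0 k1 (by simp)
    refine ⟨k0, ?_, fun k => ?_⟩
    · by_contra hcon
      have : q k0 x = 0 := qfun_zero hN (by linarith [hR k0]) (not_lt.mp hcon)
      linarith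
    · by_cases hk : k ≤ max K k1
      · exact hk0 k (by simp; omega)
      · have h2 := hqle k x
        have h3 : 1 / ((k : ℝ) + 1) ≤ 1 / ((K : ℝ) + 1) := by
          have : (K : ℝ) ≤ k := by exact_mod_cast (by omega : K ≤ k)
          gcongr
        linarith
  choose κ hκ hmax using hatt
  have hpos : ∀ x, 0 < q (κ x) x := fun x => qfun_pos N (hb0 _) (hκ x)
  have hlow : ∀ (k : ℕ) (x : En n), ‖x‖ < (k : ℝ) + 1 → - psi N (k + 1) (b k) x ≤ - (q (κ x) x)⁻¹ := by
    intro k x hx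
    have h1 : 0 < q k x := qfun_pos N (hb0 k) hx
    rw [← qfun_inv N hx, neg_le_neg_iff]
    exact inv_anti₀ h1 (hmax x k)
  have hball : ∀ (k : ℕ) (x : En n), ‖x‖ < (k : ℝ) + 1 → ∀ᶠ y in 𝓝 x, ‖y‖ < (k : ℝ) + 1 := fun k x hx =>
    (continuous_norm.tendsto x).eventually (gt_mem_nhds hx)
  refine ⟨fun x => - (q (κ x) x)⁻¹, ?_, ?_, ?_⟩
  · intro x0 y hy
    rcases le_or_gt 0 y with h0 | h0
    · refine Eventually.of_forall fun x => ?_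
      have : 0 < (q (κ x) x)⁻¹ := inv_pos.mpr (hpos x)
      change - (q (κ x) x)⁻¹ < y
      linarith
    · have hc : 0 < (-y)⁻¹ := inv_pos.mpr (by linarith)
      have hiff : ∀ x, q (κ x) x < (-y)⁻¹ ↔ - (q (κ x) x)⁻¹ < y := by
        intro x
        rw [lt_inv_comm₀ (hpos x) (by linarith)]
        constructor <;> intro h <;> linarith
      have hy' := (hiff x0).mpr hy
      obtain ⟨K, hK⟩ := exists_nat_one_div_lt hc
      have : ∀ᶠ x in 𝓝 x0, ∀ k ∈ Finset.range K, q k x < (-y)⁻¹ := by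
        rw [Filter.eventually_all_finset]
        intro k _
        exact ((qfun_cont N _ (b k)).tendsto x0).eventually (gt_mem_nhds ((hmax x0 k).trans_lt hy'))
      filter_upwards [this] with x hx
      rw [← hiff]
      by_cases hk : κ x < K
      · exact hx _ (Finset.mem_range.mpr hk)
      · have h2 := hqle (κ x) x
        have h3 : 1 / ((κ x : ℝ) + 1) ≤ 1 / ((K : ℝ) + 1) := by
          have : (K : ℝ) ≤ κ x := by exact_mod_cast (by omega : K ≤ κ x)
          gcongr
        linarith
  · intro x0
    obtain ⟨P, c, hc, hj, hin⟩ := hbar (κ x0 + 1) (b (κ x0)) D.γm (E (κ x0)) 1 (hR _) (hb0 _) D.hγm.le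
      (hE0 _) (hb _) x0 (hκ x0)
    have e0 : (q (κ x0) x0)⁻¹ = psi N (κ x0 + 1) (b (κ x0)) x0 := qfun_inv N (hκ x0)
    have hs : (-(c • (1 : Mn n))).IsSymm := by
      have := symm_smul (-c) (symm_one (n := n)); rwa [neg_smul] at this
    refine D.subAt_of_lower (-P) (-(c • 1)) hs ?_ ?_
    · filter_upwards [hj, hball _ x0 (hκ x0)] with x h1 h2
      have h3 := hlow _ x h2
      rw [e0, qf_neg, qf_smul, qf_one, inner_neg_left]
      linarith
    · have h1 := D.F_le x0 0 (-(c • 1)) Matrix.isSymm_zero hs c hc (fun h => by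
        rw [qf_zero, qf_neg, qf_smul, qf_one]; linarith)
      rw [D.hF0] at h1
      have h2 := (abs_le.mp (D.H_abs_le x0 (-P))).1
      rw [norm_neg] at h2
      have h3 : 0 ≤ psi N (κ x0 + 1) (b (κ x0)) x0 := (hb0 _).le.trans (psi_ge N (hb0 _).le (hκ x0))
      rw [e0, D.g_neg, D.g_of_nonneg h3]
      have h4 := hE _ x0 (hκ x0)
      linarith
  · intro x
    obtain ⟨k, hk⟩ := exists_nat_gt ‖x‖
    have hk' : ‖x‖ < (k : ℝ) + 1 := by linarith
    refine ⟨- (psi N (k + 1) (b k) x + 1), ?_⟩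
    filter_upwards [hball k x hk', (psi_contAt N (b := b k) hk').eventually (gt_mem_nhds (lt_add_one _))] with y h1 h2
    have := hlow k y h1
    linarith
end Dat
end PK

section PL
open Set Filter Topology
open scoped RealInnerProductSpace
variable {n : ℕ}
namespace Dat
variable (D : Dat n)

theorem perron (U : En n → ℝ) (hU : UpperSemicontinuous U) (hUs : ∀ x, D.SubAt U x)
    (hmax : ∀ w : En n → ℝ, UpperSemicontinuous w → (∀ x, D.SubAt w x) → ∀ x, w x ≤ U x)
    (hlow : ∀ x, ∃ c, ∀ᶠ y in 𝓝 x, - U y ≤ c) (x0 : En n) :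
    D.SuperAt (fun x => - env (fun y => - U y) x) x0 := by
  intro p X hX hj
  by_contra hcon
  rw [not_le] at hcon
  set L : En n → ℝ := fun x => - env (fun y => - U y) x with hL
  have hLU : ∀ x, L x ≤ U x := fun x => by
    have := le_env hlow x
    simp only [hL]; linarith
  have hLn : 0 < D.Lam * n := mul_pos D.hLam D.hnpos
  change D.f x0 < D.F x0 X + D.H x0 p - D.g (L x0) at hcon
  obtain ⟨η, hη0, hη⟩ : ∃ η > 0, D.Lam * n * (2 * η) = (D.F x0 X + D.H x0 p - D.g (L x0) - D.f x0) / 2 :=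
    ⟨(D.F x0 X + D.H x0 p - D.g (L x0) - D.f x0) / 4 / (D.Lam * n),
      by have : 0 < D.F x0 X + D.H x0 p - D.g (L x0) - D.f x0 := by linarith
         positivity, by
      generalize D.F x0 X + D.H x0 p - D.g (L x0) - D.f x0 = t
      generalize D.Lam * n = l at hLn
      field_simp; ring⟩
  set X' : Mn n := X - (2 * η) • 1 with hX'
  have hX's : X'.IsSymm := symm_sub hX (symm_smul _ symm_one)
  have hq' : ∀ h, qf X' h = qf X h - 2 * η * ‖h‖ ^ 2 := fun h => by
    rw [hX', qf_sub, qf_smul, qf_one]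
  have h1 := D.F_le x0 X X' hX hX's (2 * η) (by positivity) (fun v => by rw [hq']; linarith)
  have h2 : D.f x0 < D.F x0 X' + D.H x0 (p + opm X' (x0 - x0)) - D.g (L x0) := by
    rw [sub_self, map_zero, add_zero]; linarith
  have hopen : IsOpen {z : En n × ℝ | D.f z.1 < D.F z.1 X' + D.H z.1 (p + opm X' (z.1 - x0)) - D.g z.2} :=
    isOpen_lt (D.hf.comp continuous_fst) (D.contF X' hX's x0 p)
  obtain ⟨e, he0, he⟩ := Metric.isOpen_iff.mp hopen (x0, L x0) h2
  set q : En n → ℝ := fun x => ⟪p, x - x0⟫ + 1 / 2 * qf X' (x - x0) with hqdef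
  have hqc : Continuous q := by
    have := qf_continuous X'
    simp only [hqdef]; fun_prop
  have hq0 : q x0 = 0 := by simp [hqdef, qf_at_zero]
  have hqe : ∀ᶠ x in 𝓝 x0, |q x| < e / 2 := by
    have := hqc.abs.tendsto x0
    rw [hq0, abs_zero] at this
    exact this.eventually (gt_mem_nhds (by positivity))
  obtain ⟨r0, hr00, hr0⟩ := Metric.eventually_nhds_iff.mp (hj.and hqe)
  set r1 := min (r0 / 2) (e / 2) with hr1
  have hr10 : 0 < r1 := by positivity
  have hr1a : r1 ≤ r0 / 2 := min_le_left _ _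
  have hr1b : r1 ≤ e / 2 := min_le_right _ _
  set δ := min (e / 4) (η * r1 ^ 2 / 8) with hδ
  have hδ0 : 0 < δ := by positivity
  have hδa : δ ≤ e / 4 := min_le_left _ _
  have hδb : δ ≤ η * r1 ^ 2 / 8 := min_le_right _ _
  set φ : En n → ℝ := fun x => L x0 + δ + q x with hφ
  have hφc : Continuous φ := by simp only [hφ]; fun_prop
  have hUφ : ∀ x, ‖x - x0‖ ≤ r1 → φ x - δ + η * ‖x - x0‖ ^ 2 ≤ U x := by
    intro x hx
    have h3 := (hr0 (y := x) (by rw [dist_eq_norm]; linarith)).1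
    have h4 := hLU x
    simp only [hφ, hqdef, hq']
    change L x0 + ⟪p, x - x0⟫ + 1 / 2 * qf X (x - x0) ≤ L x at h3
    linarith
  have hann : ∀ x, r1 / 2 ≤ ‖x - x0‖ → ‖x - x0‖ ≤ r1 → φ x < U x := by
    intro x ha hb
    have h3 := hUφ x hb
    have h4 : (r1 / 2) ^ 2 ≤ ‖x - x0‖ ^ 2 := by gcongr
    have h5 : η * (r1 / 2) ^ 2 ≤ η * ‖x - x0‖ ^ 2 := by gcongr
    have h6 : 0 < η * r1 ^ 2 := by positivity
    nlinarith
  have hφsub : ∀ x, ‖x - x0‖ < r1 → D.f x ≤ D.F x X' + D.H x (p + opm X' (x - x0)) - D.g (φ x) := by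
    intro x hx
    refine le_of_lt (he (a := (x, φ x)) ?_)
    have h3 := (hr0 (y := x) (by rw [dist_eq_norm]; linarith)).2
    rw [Metric.mem_ball, Prod.dist_eq, max_lt_iff]
    refine ⟨by rw [dist_eq_norm]; linarith, ?_⟩
    rw [Real.dist_eq, abs_lt]
    rw [abs_lt] at h3
    simp only [hφ]
    constructor <;> linarith
  classical
  set w : En n → ℝ := fun x => if ‖x - x0‖ < r1 then max (U x) (φ x) else U x with hw
  have hUw : ∀ x, U x ≤ w x := fun x => by
    simp only [hw]; split_ifs
    · exact le_max_left _ _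
    · exact le_rfl
  have hwin : ∀ x, ‖x - x0‖ < r1 → w x = max (U x) (φ x) := fun x hx => by simp only [hw]; rw [if_pos hx]
  have hwout : ∀ x, r1 / 2 ≤ ‖x - x0‖ → w x = U x := fun x hx => by
    simp only [hw]; split_ifs with h
    · exact max_eq_left (hann x hx h.le).le
    · rfl
  have hnc : Continuous (fun x : En n => ‖x - x0‖) := by fun_prop
  have hwusc : UpperSemicontinuous w := by
    intro x y hy
    rcases lt_or_ge (r1 / 2) ‖x - x0‖ with h | h
    · rw [hwout x h.le] at hy
      filter_upwards [hU x y hy, (hnc.tendsto x).eventually (lt_mem_nhds h)] with z h1 h2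
      rw [hwout z (le_of_lt h2)]; exact h1
    · have h' : ‖x - x0‖ < r1 := by linarith
      rw [hwin x h', max_lt_iff] at hy
      filter_upwards [hU x y hy.1, (hφc.tendsto x).eventually (gt_mem_nhds hy.2),
        (hnc.tendsto x).eventually (gt_mem_nhds h')] with z h1 h2 h3
      rw [hwin z h3, max_lt_iff]; exact ⟨h1, h2⟩
  have hwsub : ∀ x, D.SubAt w x := by
    intro x
    by_cases hx : U x = w x
    · exact (hUs x).mono (Eventually.of_forall hUw) hx
    · have h' : ‖x - x0‖ < r1 := by
        by_contra hc
        exact hx (hwout x (by linarith)).symm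
      have hwx : w x = φ x := by
        rw [hwin x h']
        rcases max_choice (U x) (φ x) with h | h
        · exact absurd (h.symm.trans (hwin x h').symm) hx
        · exact h
      refine D.subAt_of_lower (p + opm X' (x - x0)) X' hX's ?_ (by rw [hwx]; exact hφsub x h')
      filter_upwards [(hnc.tendsto x).eventually (gt_mem_nhds h')] with z hz
      have h3 := quad_recenter X' hX's p x0 x z
      have h4 : φ z ≤ w z := by rw [hwin z hz]; exact le_max_right _ _
      rw [hwx]
      simp only [hφ, hqdef] at h4 ⊢
      linarith
  have hfin : ∀ x, ‖x - x0‖ < r1 → φ x ≤ U x := fun x hx => by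
    have h3 := hmax w hwusc hwsub x
    rw [hwin x hx] at h3
    exact (le_max_right _ _).trans h3
  have hlast : env (fun y => - U y) x0 ≤ - (L x0 + δ / 2) := by
    refine env_le ?_
    have hz : ‖x0 - x0‖ < r1 := by rw [sub_self, norm_zero]; exact hr10
    filter_upwards [(hφc.tendsto x0).eventually (lt_mem_nhds (show L x0 + δ / 2 < φ x0 by
      simp only [hφ, hq0]; linarith)), (hnc.tendsto x0).eventually (gt_mem_nhds hz)] with x h3 h4
    have := hfin x h4
    linarith
  have : L x0 = - env (fun y => - U y) x0 := rfl
  linarith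

theorem existence : ∃ u : En n → ℝ, Continuous u ∧ (∀ x, D.SubAt u x) ∧ ∀ x, D.SuperAt u x := by
  obtain ⟨w0, hw0, hw0s, hw0l⟩ := D.exists_sub
  obtain ⟨U, hU, hUs, hmax⟩ := D.max_sub w0 hw0 hw0s
  have hlow : ∀ x, ∃ c, ∀ᶠ y in 𝓝 x, - U y ≤ c := fun x => by
    obtain ⟨c, hc⟩ := hw0l x
    refine ⟨-c, ?_⟩
    filter_upwards [hc] with y hy
    have := hmax w0 hw0 hw0s y
    linarith
  have hsup := D.perron U hU hUs hmax hlow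
  have hLlsc : LowerSemicontinuous (fun x => - env (fun y => - U y) x) := by
    intro x y hy
    have := env_usc hlow x (-y) (by linarith)
    filter_upwards [this] with z hz
    linarith
  have hle := D.comparison U _ hU hLlsc hUs hsup
  have heq : U = fun x => - env (fun y => - U y) x := by
    funext x
    refine le_antisymm (hle x) ?_
    have := le_env hlow x
    linarith
  refine ⟨U, continuous_iff_lower_upperSemicontinuous.mpr ⟨?_, hU⟩, hUs, ?_⟩
  · rw [heq]; exact hLlsc
  · rw [heq]; exact hsup
end Dat
end PL

theorem wellposedness_convex_case
    (n : ℕ) (hn : 1 ≤ n) (lam Lam m s ρ γ₁ γm cbar A σ₀ : ℝ) (ω : ℝ → ℝ)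
    (F : En n → Matrix (Fin n) (Fin n) ℝ → ℝ)
    (H : En n → En n → ℝ) (f : En n → ℝ)
    (hlam : 0 < lam) (hlamLam : lam ≤ Lam)
    (hm1 : 1 < m) (hm2 : m ≤ 2) (hsm : m < s)
    -- (i) uniform ellipticity
    (hFell : ∀ (x : En n) (X Y : Matrix (Fin n) (Fin n) ℝ), X.IsSymm → Y.IsSymm →
      Y.PosSemidef →
      lam * Y.trace ≤ F x (X + Y) - F x X ∧ F x (X + Y) - F x X ≤ Lam * Y.trace)
    -- (ii)
    (hF0 : ∀ x, F x 0 = 0)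
    -- (iii)
    (hFcont : ∀ X : Matrix (Fin n) (Fin n) ℝ, X.IsSymm → Continuous fun x => F x X)
    -- (iv) structure condition
    (hFstruct : ∀ R > (0 : ℝ), ∃ ωR : ℝ → ℝ, IsModulus ωR ∧
      ∀ ε > (0 : ℝ), ∀ (x y : En n) (X Y : Matrix (Fin n) (Fin n) ℝ),
        ‖x‖ < R → ‖y‖ < R → X.IsSymm → Y.IsSymm →
        (Matrix.fromBlocks X 0 0 (-Y) +
          (3 / ε) • (1 : Matrix (Fin n ⊕ Fin n) (Fin n ⊕ Fin n) ℝ)).PosSemidef →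
        ((3 / ε) • Matrix.fromBlocks (1 : Matrix (Fin n) (Fin n) ℝ) (-1) (-1) 1 -
          Matrix.fromBlocks X 0 0 (-Y)).PosSemidef →
        F x X - F y Y ≤ ωR (‖x - y‖ + ε⁻¹ * ‖x - y‖ ^ 2))
    -- (v) positive homogeneity
    (hFhom : ∀ σ ∈ Set.Ioo (0 : ℝ) 1, ∀ (x : En n) (X : Matrix (Fin n) (Fin n) ℝ),
      F x (σ • X) = σ * F x X)
    (hH0 : ∀ x, H x 0 = 0)
    (hγ₁ : 0 < γ₁) (hγm : 0 < γm) (hω : IsModulus ω)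
    -- (a) structure condition on H
    (hHstruct : ∀ x y p q : En n,
      |H x (p + q) - H y p| ≤ ω ‖x - y‖ * (‖p‖ ^ m + 1) +
        (γ₁ + γm * (‖p‖ ^ (m - 1) + ‖q‖ ^ (m - 1))) * ‖q‖)
    -- (b) convexity-type condition on H
    (hcbar : 0 < cbar) (hA : 0 < A) (hσ₀ : σ₀ ∈ Set.Ioo (0 : ℝ) 1)
    (hHconv : ∀ (x p : En n), ∀ σ ∈ Set.Ioo σ₀ 1,
      H x p - σ * H x (σ⁻¹ • p) ≤ (1 - σ) * (-cbar * ‖p‖ ^ m + A))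
    (hf : Continuous f) (hρ : 0 ≤ ρ)
    (hρ1 : m ≤ 2 * s / (s + 1) → ρ < m * (s - 1) / ((m - 1) * s))
    (hρ2 : 2 * s / (s + 1) < m → ρ < 2 * (s - m) / (s * (m - 1)))
    (hflimsup : ∃ C M : ℝ, ∀ x : En n, M ≤ ‖x‖ → max (-f x) 0 ≤ C * ‖x‖ ^ ρ) :
    ∃! u : En n → ℝ, Continuous u ∧
      ViscositySubsolution F H s f u ∧ ViscositySupersolution F H s f u := by
  let D : Dat n := ⟨lam, Lam, m, s, ρ, γ₁, γm, cbar, A, σ₀, ω, F, H, f, hn, hlam, hlamLam, hm1, hm2, hsm,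
    hFell, hF0, hFcont, hFstruct, hFhom, hH0, hγ₁, hγm, hω, hHstruct, hcbar, hA, hσ₀, hHconv, hf, hρ,
    hρ1, hρ2, hflimsup⟩
  obtain ⟨u, hu, hsub, hsup⟩ := D.existence
  refine ⟨u, ⟨hu, (D.visc_sub_iff u).mpr hsub, (D.visc_super_iff u).mpr hsup⟩, ?_⟩
  rintro v ⟨hv, hv1, hv2⟩
  have hvsub := (D.visc_sub_iff v).mp hv1
  have hvsup := (D.visc_super_iff v).mp hv2
  funext x
  exact le_antisymm
    (D.comparison v u hv.upperSemicontinuous hu.lowerSemicontinuous hvsub hsup x)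
    (D.comparison u v hu.upperSemicontinuous hv.lowerSemicontinuous hsub hvsup x)
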